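/- arXiv:1505.06748 — 8 statements merged into one kernel-verified Lean document; each statement's English description precedes it below -/
import Mathlib

section
/- Let ψ : 𝔻 → ℝ be smooth with a ≤ ψ(z) ≤ b for all z ∈ 𝔻, where 0 < a ≤ b < +∞, and let φ : ∂𝔻 → ℝ be bounded and lower semicontinuous. Then every smooth convex function u : 𝔻 → ℝ with det D²u(z) = (1/ψ(z))·(1−|z|²)⁻² on 𝔻 and liminf_{w→z, w∈𝔻} u(w) = φ(z) for every z ∈ ∂𝔻 satisfies co(φ)(z) − (1/√a)·√(1−|z|²) ≤ u(z) ≤ co(φ)(z) for every z ∈ 𝔻. (Geometrically: every Cauchy surface of curvature bounded away from zero has bounded cosmological time.) -/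
open Metric Filter
open scoped RealInnerProductSpace Topology

noncomputable section

/-- The plane `ℝ²`, as a Euclidean space. -/
abbrev E2 : Type := EuclideanSpace ℝ (Fin 2)

/-- The Hessian of `f : ℝ² → ℝ` at `p`, evaluated as a bilinear form on `(v, w)`. -/
def hess (f : E2 → ℝ) (p v w : E2) : ℝ := fderiv ℝ (fderiv ℝ f) p v w

/-- The determinant of the Hessian of `f : ℝ² → ℝ` at `p`. -/
def detHess (f : E2 → ℝ) (p : E2) : ℝ :=
  hess f p (EuclideanSpace.single 0 1) (EuclideanSpace.single 0 1) *
    hess f p (EuclideanSpace.single 1 1) (EuclideanSpace.single 1 1) -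
  hess f p (EuclideanSpace.single 0 1) (EuclideanSpace.single 1 1) *
    hess f p (EuclideanSpace.single 1 1) (EuclideanSpace.single 0 1)
/-- The convex envelope `co(φ)` of a boundary function `φ : ∂𝔻 → ℝ`:
`co(φ)(z) = sup{ℓ(z) : ℓ affine on ℝ², ℓ ≤ φ on ∂𝔻}`. -/
def convEnv (φ : E2 → ℝ) (z : E2) : ℝ :=
  sSup {y : ℝ | ∃ (a : E2) (b : ℝ),
    (∀ w ∈ sphere (0 : E2) 1, ⟪a, w⟫ + b ≤ φ w) ∧ y = ⟪a, z⟫ + b}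

theorem second_deriv_nonneg {g g1 : ℝ → ℝ} {c : ℝ}
    (h1 : ∀ᶠ t in 𝓝 (0:ℝ), HasDerivAt g (g1 t) t) (h2 : HasDerivAt g1 c 0)
    (hm : IsLocalMin g 0) : 0 ≤ c := by
  by_contra hc
  push Not at hc
  have e1 : deriv g =ᶠ[𝓝 0] g1 := h1.mono fun t ht => ht.deriv
  have e2 : deriv (deriv g) 0 = c := by rw [e1.deriv_eq, h2.deriv]
  have hmax : IsLocalMax g 0 :=
    isLocalMax_of_deriv_deriv_neg (by rw [e2]; exact hc) hm.deriv_eq_zero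
      h1.self_of_nhds.continuousAt
  have e3 : g =ᶠ[𝓝 0] fun _ => g 0 := by
    filter_upwards [hm, hmax] with t h h'
    exact le_antisymm h' h
  have e4 : deriv (deriv g) 0 = 0 := by
    rw [e3.deriv.deriv_eq]
    simp
  linarith

theorem tangent_le {u : E2 → ℝ} (huc : ConvexOn ℝ (ball (0 : E2) 1) u) {z : E2}
    (hz : z ∈ ball (0 : E2) 1) (hd : DifferentiableAt ℝ u z) :
    ∃ (g : E2) (c : ℝ), ⟪g, z⟫ + c = u z ∧ ∀ x ∈ ball (0 : E2) 1, ⟪g, x⟫ + c ≤ u x := by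
  refine ⟨(InnerProductSpace.toDual ℝ E2).symm (fderiv ℝ u z), u z - fderiv ℝ u z z, ?_, ?_⟩
  · simp
  intro x hx
  have hconv := huc.comp_affineMap (AffineMap.lineMap (k := ℝ) z x)
  have hmap : HasDerivAt (fun t : ℝ => AffineMap.lineMap (k := ℝ) z x t) (x - z) 0 :=
    AffineMap.hasDerivAt_lineMap
  have hd' : HasFDerivAt u (fderiv ℝ u z) (AffineMap.lineMap (k := ℝ) z x (0:ℝ)) := by
    simpa using hd.hasFDerivAt
  have hder : HasDerivAt (u ∘ (AffineMap.lineMap (k := ℝ) z x)) (fderiv ℝ u z (x - z)) 0 :=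
    hd'.comp_hasDerivAt 0 hmap
  have := hconv.le_slope_of_hasDerivAt (x := 0) (y := 1) (by simpa using hz) (by simpa using hx)
    one_pos hder
  simp [slope_def_field] at this
  simp
  linarith

theorem det_mono {A B D α β δ : ℝ} (hα : 0 < α) (hdet : β ^ 2 ≤ α * δ)
    (h : ∀ x y : ℝ, α * x ^ 2 + 2 * β * (x * y) + δ * y ^ 2
      ≤ A * x ^ 2 + 2 * B * (x * y) + D * y ^ 2) :
    α * δ - β ^ 2 ≤ A * D - B ^ 2 := by
  have hA : 0 ≤ A - α := by have := h 1 0; linarith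
  have hD : 0 ≤ D - δ := by have := h 0 1; linarith
  have h1 := h β (-α)
  have hmix : 0 ≤ α * (α * (D - δ) + δ * (A - α) - 2 * β * (B - β)) := by
    nlinarith [mul_le_mul_of_nonneg_right hdet hA]
  have hmix' := nonneg_of_mul_nonneg_right hmix hα
  have hdet1 : (B - β) ^ 2 ≤ (A - α) * (D - δ) := by
    rcases hA.eq_or_lt with h0 | h0
    · rcases hD.eq_or_lt with h3 | h3
      · have a1 := h 1 1
        have a2 := h 1 (-1)
        have : B - β = 0 := by linarith
        rw [this, ← h0]; simp
      · have a1 := h (D - δ) (-(B - β))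
        have : 0 ≤ (D - δ) * ((A - α) * (D - δ) - (B - β) ^ 2) := by nlinarith
        have := nonneg_of_mul_nonneg_right this h3
        linarith
    · have a1 := h (B - β) (-(A - α))
      have : 0 ≤ (A - α) * ((A - α) * (D - δ) - (B - β) ^ 2) := by nlinarith
      have := nonneg_of_mul_nonneg_right this h0
      linarith
  nlinarith

theorem hess_ge {u : E2 → ℝ} {p g : E2} {c C : ℝ} (hu : ContDiffAt ℝ 2 u p)
    (hp : ‖p‖ < 1)
    (hm : IsLocalMin (fun x => u x - (⟪g, x⟫ + c - C * √(1 - ‖x‖ ^ 2))) p) (v : E2) :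
    C * (‖v‖ ^ 2 / √(1 - ‖p‖ ^ 2) + ⟪p, v⟫ ^ 2 / √(1 - ‖p‖ ^ 2) ^ 3) ≤ hess u p v v := by
  set s := √(1 - ‖p‖ ^ 2) with hs
  have hpos : 0 < 1 - ‖p‖ ^ 2 := by nlinarith [norm_nonneg p]
  have hs0 : 0 < s := Real.sqrt_pos.mpr hpos
  set q : ℝ → ℝ := fun t => 1 - ‖p‖ ^ 2 - 2 * t * ⟪p, v⟫ - t ^ 2 * ‖v‖ ^ 2 with hq
  have hqn : ∀ t : ℝ, 1 - ‖p + t • v‖ ^ 2 = q t := by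
    intro t
    rw [norm_add_sq_real, norm_smul, inner_smul_right, mul_pow, Real.norm_eq_abs, sq_abs]
    simp only [hq]; ring
  have hq0 : q 0 = 1 - ‖p‖ ^ 2 := by simp [hq]
  have hqd : ∀ t, HasDerivAt q (-2 * (⟪p, v⟫ + t * ‖v‖ ^ 2)) t := by
    intro t
    have h1 := ((hasDerivAt_id t).const_mul 2).mul_const ⟪p, v⟫
    have h2 := ((hasDerivAt_id t).pow 2).mul_const (‖v‖ ^ 2)
    have := ((hasDerivAt_const t (1 - ‖p‖ ^ 2)).sub h1).sub h2
    refine this.congr_deriv ?_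
    simp; ring
  have hline : ∀ t : ℝ, HasDerivAt (fun t : ℝ => p + t • v) v t := by
    intro t
    simpa using ((hasDerivAt_id t).smul_const v).const_add p
  have hlc : Tendsto (fun t : ℝ => p + t • v) (𝓝 0) (𝓝 p) := by
    have := (hline 0).continuousAt.tendsto
    simpa using this
  have hqc : Continuous q := by fun_prop
  have hqpos : ∀ᶠ t in 𝓝 (0:ℝ), 0 < q t :=
    hqc.continuousAt.eventually (lt_mem_nhds (by rw [hq0]; exact hpos))
  have hud : ∀ᶠ x in 𝓝 p, DifferentiableAt ℝ u x := by
    have := hu.eventually (by simp)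
    exact this.mono fun x hx => hx.differentiableAt (by norm_num)
  have hdd : DifferentiableAt ℝ (fderiv ℝ u) p :=
    (hu.fderiv_right (m := 1) (by norm_num)).differentiableAt (by norm_num)
  set G : ℝ → ℝ := fun t => u (p + t • v) - (⟪g, p⟫ + t * ⟪g, v⟫ + c - C * √(q t)) with hG
  set G1 : ℝ → ℝ := fun t => fderiv ℝ u (p + t • v) v -
    (⟪g, v⟫ + C * ((⟪p, v⟫ + t * ‖v‖ ^ 2) / √(q t))) with hG1
  have hmin : IsLocalMin G 0 := by
    have h := hlc.eventually hm
    filter_upwards [h] with t ht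
    have e : ∀ t : ℝ, G t = u (p + t • v) -
        (⟪g, p + t • v⟫ + c - C * √(1 - ‖p + t • v‖ ^ 2)) := by
      intro t
      simp only [hG, hqn, inner_add_right, inner_smul_right]
    rw [e, e]
    simpa using ht
  have hd1 : ∀ᶠ t in 𝓝 (0:ℝ), HasDerivAt G (G1 t) t := by
    filter_upwards [hqpos, hlc.eventually hud] with t ht hut
    have a1 := hut.hasFDerivAt.comp_hasDerivAt t (hline t)
    have a2 := ((hqd t).sqrt ht.ne').const_mul C
    have a3 := ((((hasDerivAt_id t).mul_const ⟪g, v⟫).const_add ⟪g, p⟫).add_const c).sub a2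
    refine (a1.sub a3).congr_deriv ?_
    simp only [hG1]
    have : 0 < √(q t) := Real.sqrt_pos.mpr ht
    field_simp
    ring
  have hd2 : HasDerivAt G1 (hess u p v v - C * (‖v‖ ^ 2 / s + ⟪p, v⟫ ^ 2 / s ^ 3)) 0 := by
    have hdd' : HasFDerivAt (fderiv ℝ u) (fderiv ℝ (fderiv ℝ u) p) (p + (0:ℝ) • v) := by
      simpa using hdd.hasFDerivAt
    have a0 : HasDerivAt (fun t : ℝ => fderiv ℝ u (p + t • v)) (fderiv ℝ (fderiv ℝ u) p v) 0 :=
      hdd'.comp_hasDerivAt (0:ℝ) (hline 0)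
    have a1 : HasDerivAt (fun t : ℝ => fderiv ℝ u (p + t • v) v) (hess u p v v) 0 := by
      have := a0.clm_apply (hasDerivAt_const (0:ℝ) v)
      refine this.congr_deriv ?_
      simp [hess]
    have hsq : √(q 0) = s := by rw [hq0]
    have a2 := (hqd 0).sqrt (by rw [hq0]; exact hpos.ne')
    have a3 := (((hasDerivAt_id (0:ℝ)).mul_const (‖v‖ ^ 2)).const_add ⟪p, v⟫).div a2
      (by rw [hsq]; exact hs0.ne')
    have a4 := (a3.const_mul C).const_add ⟪g, v⟫
    refine (a1.sub a4).congr_deriv ?_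
    rw [hsq]
    simp only [id, zero_mul, add_zero, one_mul]
    field_simp
    ring
  have := second_deriv_nonneg hd1 hd2 hmin
  linarith

theorem det_ge {u : E2 → ℝ} {p g : E2} {c C : ℝ} (hC : 0 < C) (hu : ContDiffAt ℝ 2 u p)
    (hp : ‖p‖ < 1)
    (hm : IsLocalMin (fun x => u x - (⟪g, x⟫ + c - C * √(1 - ‖x‖ ^ 2))) p) :
    C ^ 2 * ((1 - ‖p‖ ^ 2) ^ 2)⁻¹ ≤ detHess u p := by
  have key := hess_ge hu hp hm
  have hsym : hess u p (EuclideanSpace.single 1 1) (EuclideanSpace.single 0 1)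
      = hess u p (EuclideanSpace.single 0 1) (EuclideanSpace.single 1 1) :=
    (hu.isSymmSndFDerivAt (by simp)) _ _
  set s := √(1 - ‖p‖ ^ 2) with hs
  have hpos : 0 < 1 - ‖p‖ ^ 2 := by nlinarith [norm_nonneg p]
  have hs0 : 0 < s := Real.sqrt_pos.mpr hpos
  have hs2 : s ^ 2 = 1 - ‖p‖ ^ 2 := Real.sq_sqrt hpos.le
  have hpn : ‖p‖ ^ 2 = p 0 ^ 2 + p 1 ^ 2 := by
    rw [EuclideanSpace.norm_sq_eq]; simp
  have e : C * (1 / s + p 0 ^ 2 / s ^ 3) * (C * (1 / s + p 1 ^ 2 / s ^ 3))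
      - (C * (p 0 * p 1 / s ^ 3)) ^ 2 = C ^ 2 * ((1 - ‖p‖ ^ 2) ^ 2)⁻¹ := by
    rw [← hs2]
    have : p 1 ^ 2 = 1 - s ^ 2 - p 0 ^ 2 := by linarith
    field_simp
    rw [this]
    ring
  unfold detHess
  rw [hsym, ← e, ← sq (hess u p (EuclideanSpace.single 0 1) (EuclideanSpace.single 1 1))]
  apply det_mono
  · positivity
  · have : 0 ≤ C ^ 2 * ((1 - ‖p‖ ^ 2) ^ 2)⁻¹ := by positivity
    linarith
  intro x y
  have h := key (x • EuclideanSpace.single 0 1 + y • EuclideanSpace.single 1 1)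
  have hn : ‖(x • EuclideanSpace.single 0 1 + y • EuclideanSpace.single 1 1 : E2)‖ ^ 2
      = x ^ 2 + y ^ 2 := by
    rw [EuclideanSpace.norm_sq_eq]; simp
  have hi : ⟪p, (x • EuclideanSpace.single 0 1 + y • EuclideanSpace.single 1 1 : E2)⟫
      = x * p 0 + y * p 1 := by
    simp [inner_add_right, inner_smul_right, EuclideanSpace.inner_single_right]
  rw [hn, hi] at h
  have hb : hess u p (x • EuclideanSpace.single 0 1 + y • EuclideanSpace.single 1 1)
      (x • EuclideanSpace.single 0 1 + y • EuclideanSpace.single 1 1)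
      = hess u p (EuclideanSpace.single 0 1) (EuclideanSpace.single 0 1) * x ^ 2
        + 2 * hess u p (EuclideanSpace.single 0 1) (EuclideanSpace.single 1 1) * (x * y)
        + hess u p (EuclideanSpace.single 1 1) (EuclideanSpace.single 1 1) * y ^ 2 := by
    have hsym' := hsym
    simp only [hess] at hsym' ⊢
    simp only [map_add, map_smul, add_apply, smul_apply,
      smul_eq_mul, hsym']
    ring
  rw [hb] at h
  refine le_trans (le_of_eq ?_) h
  field_simp
  ring

theorem comparison {U : Set E2} (hU : IsOpen U) (hUb : U ⊆ ball (0 : E2) 1) {u : E2 → ℝ}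
    (hus : ContDiffOn ℝ (⊤ : ℕ∞) u U) {C : ℝ} (hC : 0 < C)
    (hdet : ∀ z ∈ U, detHess u z < C ^ 2 * ((1 - ‖z‖ ^ 2) ^ 2)⁻¹) (g : E2) (c : ℝ)
    (hbd : ∀ w ∈ frontier U, ∀ δ > 0, ∀ᶠ x in 𝓝[U] w, -δ < u x - (⟪g, x⟫ + c)) :
    ∀ z ∈ U, ⟪g, z⟫ + c - C * √(1 - ‖z‖ ^ 2) ≤ u z := by
  intro z hz
  by_contra hlt
  push Not at hlt
  set f : E2 → ℝ := fun x => u x - (⟪g, x⟫ + c - C * √(1 - ‖x‖ ^ 2)) with hf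
  have hfz : f z < 0 := by simp only [hf]; linarith
  have hfc : ContinuousOn f U := by
    apply hus.continuousOn.sub
    fun_prop
  set K : Set E2 := {x | x ∈ U ∧ f x ≤ f z} with hK
  have hKc : IsClosed K := by
    apply isClosed_of_closure_subset
    intro w hw
    have hwU : w ∈ closure U := closure_mono (fun x hx => hx.1) hw
    by_cases hwm : w ∈ U
    · refine ⟨hwm, ?_⟩
      by_contra hgt
      push Not at hgt
      have hev : ∀ᶠ x in 𝓝 w, f z < f x :=
        (hfc.continuousAt (hU.mem_nhds hwm)).eventually (lt_mem_nhds hgt)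
      obtain ⟨x, hx1, hx2⟩ := (mem_closure_iff_frequently.mp hw |>.and_eventually hev).exists
      exact absurd hx1.2 (not_le.mpr hx2)
    · exfalso
      have hwf : w ∈ frontier U := by
        rw [hU.frontier_eq]; exact ⟨hwU, hwm⟩
      have hev := eventually_nhdsWithin_iff.mp (hbd w hwf (-f z) (by linarith))
      obtain ⟨x, hx1, hx2⟩ := (mem_closure_iff_frequently.mp hw |>.and_eventually hev).exists
      have h1 := hx2 hx1.1
      have h2 := hx1.2
      have h3 : 0 ≤ C * √(1 - ‖x‖ ^ 2) := by positivity
      have h4 : f x = u x - (⟪g, x⟫ + c) + C * √(1 - ‖x‖ ^ 2) := by simp only [hf]; ring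
      linarith
  have hKcomp : IsCompact K :=
    Metric.isCompact_of_isClosed_isBounded hKc
      (Metric.isBounded_ball.subset (fun x hx => hUb hx.1))
  obtain ⟨p, hpK, hpmin⟩ := hKcomp.exists_isMinOn ⟨z, hz, le_rfl⟩
    (hfc.mono fun x hx => hx.1)
  have hloc : IsLocalMin f p := by
    filter_upwards [hU.mem_nhds hpK.1] with x hx
    by_cases hxK : f x ≤ f z
    · exact hpmin ⟨hx, hxK⟩
    · exact hpK.2.trans (not_le.mp hxK).le
  have hp1 : ‖p‖ < 1 := by simpa using hUb hpK.1
  have hup : ContDiffAt ℝ 2 u p :=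
    (hus.contDiffAt (hU.mem_nhds hpK.1)).of_le (by
      have : ((2 : ℕ∞) : WithTop ℕ∞) ≤ ((⊤ : ℕ∞) : WithTop ℕ∞) := WithTop.coe_le_coe.mpr le_top
      exact this)
  exact absurd (det_ge hC hup hp1 hloc) (not_le.mpr (hdet p hpK.1))

theorem affine_le_of_sphere {g : E2} {c M : ℝ}
    (h : ∀ w ∈ sphere (0 : E2) 1, ⟪g, w⟫ + c ≤ M) {z : E2} (hz : z ∈ ball (0 : E2) 1) :
    ⟪g, z⟫ + c ≤ M := by
  have hz1 : ‖z‖ < 1 := by simpa using hz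
  have h1 : ⟪g, z⟫ ≤ ‖g‖ :=
    (real_inner_le_norm g z).trans (by nlinarith [norm_nonneg g])
  rcases eq_or_ne g 0 with rfl | hg
  · have := h (EuclideanSpace.single 0 1) (by simp)
    simpa using this
  · have hg' : 0 < ‖g‖ := norm_pos_iff.mpr hg
    have := h (‖g‖⁻¹ • g) (by simp [norm_smul, hg'.ne'])
    rw [inner_smul_right, real_inner_self_eq_norm_sq] at this
    have e : ‖g‖⁻¹ * ‖g‖ ^ 2 = ‖g‖ := by field_simp
    linarith

/-- **Proposition 3.6 (a priori estimate).** Every smooth convex solution of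
`det D²u(z) = (1/ψ(z))·(1−|z|²)⁻²` on `𝔻` with bounded lower semicontinuous boundary
value `φ` satisfies `co(φ)(z) − (1/√a)·√(1−|z|²) ≤ u(z) ≤ co(φ)(z)` on `𝔻`. -/
theorem apriori_estimate_monge_ampere
    (ψ : E2 → ℝ) (a b : ℝ) (ha : 0 < a) (hab : a ≤ b)
    (hψs : ContDiffOn ℝ (⊤ : ℕ∞) ψ (ball (0 : E2) 1))
    (hψ : ∀ z ∈ ball (0 : E2) 1, a ≤ ψ z ∧ ψ z ≤ b)
    (φ : E2 → ℝ)
    (hφb : ∃ M : ℝ, ∀ z ∈ sphere (0 : E2) 1, |φ z| ≤ M)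
    (hφl : LowerSemicontinuousOn φ (sphere (0 : E2) 1))
    (u : E2 → ℝ)
    (hus : ContDiffOn ℝ (⊤ : ℕ∞) u (ball (0 : E2) 1))
    (huc : ConvexOn ℝ (ball (0 : E2) 1) u)
    (hueq : ∀ z ∈ ball (0 : E2) 1,
      detHess u z = (1 / ψ z) * ((1 - ‖z‖ ^ 2) ^ 2)⁻¹)
    (hubd : ∀ z ∈ sphere (0 : E2) 1,
      Filter.liminf u (𝓝[ball (0 : E2) 1] z) = φ z) :
    ∀ z ∈ ball (0 : E2) 1,
      convEnv φ z - (1 / Real.sqrt a) * Real.sqrt (1 - ‖z‖ ^ 2) ≤ u z ∧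
      u z ≤ convEnv φ z := by
  obtain ⟨M, hM⟩ := hφb
  have hdiff : ∀ z ∈ ball (0 : E2) 1, DifferentiableAt ℝ u z := fun z hz =>
    (hus.contDiffAt (isOpen_ball.mem_nhds hz)).differentiableAt (by simp)
  -- determinant bound
  have hdet : ∀ C : ℝ, 1 / √a < C → ∀ z ∈ ball (0 : E2) 1,
      detHess u z < C ^ 2 * ((1 - ‖z‖ ^ 2) ^ 2)⁻¹ := by
    intro C hC z hz
    have hz1 : ‖z‖ < 1 := by simpa using hz
    have hpos : 0 < 1 - ‖z‖ ^ 2 := by nlinarith [norm_nonneg z]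
    rw [hueq z hz]
    apply mul_lt_mul_of_pos_right _ (by positivity)
    have h1 : 1 / ψ z ≤ 1 / a := one_div_le_one_div_of_le ha (hψ z hz).1
    have h2 : (1 / √a) ^ 2 = 1 / a := by rw [div_pow, Real.sq_sqrt ha.le, one_pow]
    have h3 : (1 / √a) ^ 2 < C ^ 2 := by gcongr
    linarith
  have hsa : 0 < 1 / √a := by positivity
  -- lower bound for u
  obtain ⟨m, hm⟩ : ∃ m : ℝ, ∀ x ∈ ball (0 : E2) 1, m ≤ u x := by
    have h0 : (0 : E2) ∈ ball (0 : E2) 1 := by simp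
    obtain ⟨g, c, -, h⟩ := tangent_le huc h0 (hdiff 0 h0)
    refine ⟨-‖g‖ + c, fun x hx => le_trans ?_ (h x hx)⟩
    have hx1 : ‖x‖ < 1 := by simpa using hx
    have := neg_le_of_abs_le (abs_real_inner_le_norm g x)
    nlinarith [norm_nonneg g]
  have hme : ∀ w, ∀ᶠ x in 𝓝[ball (0 : E2) 1] w, m ≤ u x := fun w =>
    eventually_nhdsWithin_of_forall hm
  -- consequences of the liminf condition
  have hlow : ∀ w ∈ sphere (0 : E2) 1, ∀ c < φ w, ∀ᶠ x in 𝓝[ball (0 : E2) 1] w, c < u x := by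
    intro w hw c hc
    rw [← hubd w hw, liminf_eq] at hc
    obtain ⟨d, hd, hcd⟩ := exists_lt_of_lt_csSup ⟨m, hme w⟩ hc
    filter_upwards [hd] with x hx
    linarith
  have hup : ∀ w ∈ sphere (0 : E2) 1,
      (∀ N : ℝ, ∀ᶠ x in 𝓝[ball (0 : E2) 1] w, N ≤ u x) ∨
      ∀ c : ℝ, (∀ᶠ x in 𝓝[ball (0 : E2) 1] w, c ≤ u x) → c ≤ φ w := by
    intro w hw
    by_cases hb : BddAbove {c : ℝ | ∀ᶠ x in 𝓝[ball (0 : E2) 1] w, c ≤ u x}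
    · right
      intro c hc
      rw [← hubd w hw, liminf_eq]
      exact le_csSup hb hc
    · left
      intro N
      rw [not_bddAbove_iff] at hb
      obtain ⟨d, hd, hNd⟩ := hb N
      filter_upwards [hd] with x hx
      linarith
  -- if an affine function lies below u, it lies below genuine boundary values
  have haff : ∀ (g : E2) (c : ℝ), (∀ x ∈ ball (0 : E2) 1, ⟪g, x⟫ + c ≤ u x) →
      ∀ w ∈ sphere (0 : E2) 1,
      (∀ d : ℝ, (∀ᶠ x in 𝓝[ball (0 : E2) 1] w, d ≤ u x) → d ≤ φ w) → ⟪g, w⟫ + c ≤ φ w := by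
    intro g c h w hw hgen
    apply le_of_forall_lt
    intro d hd
    obtain ⟨d', h1, h2⟩ := exists_between hd
    refine lt_of_lt_of_le h1 (hgen d' ?_)
    have hcont : Continuous fun x : E2 => ⟪g, x⟫ + c := by fun_prop
    filter_upwards [nhdsWithin_le_nhds (hcont.continuousAt.eventually (lt_mem_nhds h2)),
      self_mem_nhdsWithin] with x hx hxb
    exact hx.le.trans (h x hxb)
  -- u does not tend to infinity on an arc
  have hcap : ∀ w0 ∈ sphere (0 : E2) 1, ∀ c : ℝ, c < 1 → ∃ w ∈ sphere (0 : E2) 1, c < ⟪w0, w⟫ ∧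
      ¬ ∀ N : ℝ, ∀ᶠ x in 𝓝[ball (0 : E2) 1] w, N ≤ u x := by
    intro w0 hw0 c0 hc0
    by_contra hcon
    push Not at hcon
    have hw1 : ‖w0‖ = 1 := by simpa using hw0
    obtain ⟨c, hc1, hc2⟩ : ∃ c, max c0 0 < c ∧ c < 1 :=
      exists_between (max_lt hc0 one_pos)
    have hcc0 : c0 < c := lt_of_le_of_lt (le_max_left _ _) hc1
    have hcpos : 0 < c := lt_of_le_of_lt (le_max_right _ _) hc1
    set U : Set E2 := ball (0 : E2) 1 ∩ {x | c < ⟪w0, x⟫} with hU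
    have hUo : IsOpen U := isOpen_ball.inter (isOpen_lt continuous_const (by fun_prop))
    have hUb : U ⊆ ball (0 : E2) 1 := Set.inter_subset_left
    set C := 1 / √a + 1 with hC
    have hcomp : ∀ N : ℝ, ∀ z ∈ U,
        ⟪N • w0, z⟫ + (m - N * c) - C * √(1 - ‖z‖ ^ 2) ≤ u z := by
      intro N
      apply comparison hUo hUb (hus.mono hUb) (by positivity)
        (fun z hz => hdet C (by linarith) z (hUb hz))
      intro w hw δ hδ
      have hcont : Continuous fun x : E2 => ⟪N • w0, x⟫ + (m - N * c) := by fun_prop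
      rw [hUo.frontier_eq] at hw
      obtain ⟨hwc, hwn⟩ := hw
      have hwcl : w ∈ closedBall (0 : E2) 1 :=
        closure_minimal (hUb.trans ball_subset_closedBall) isClosed_closedBall hwc
      have hwge : c ≤ ⟪w0, w⟫ := by
        have hcl : IsClosed {x : E2 | c ≤ ⟪w0, x⟫} :=
          isClosed_le continuous_const (by fun_prop)
        have hsub : U ⊆ {x : E2 | c ≤ ⟪w0, x⟫} := fun x hx => le_of_lt (Set.mem_setOf.mp hx.2)
        exact closure_minimal hsub hcl hwc
      by_cases hws : w ∈ sphere (0 : E2) 1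
      · have h1 := nhdsWithin_mono w hUb
          (hcon w hws (by linarith) (⟪N • w0, w⟫ + (m - N * c) + 1))
        have h2 : ∀ᶠ x in 𝓝[U] w, ⟪N • w0, x⟫ + (m - N * c) < ⟪N • w0, w⟫ + (m - N * c) + 1 :=
          nhdsWithin_le_nhds (hcont.continuousAt.eventually (gt_mem_nhds (by linarith)))
        filter_upwards [h1, h2] with x hx1 hx2
        linarith
      · have hwb : w ∈ ball (0 : E2) 1 := by
          simp only [mem_closedBall, mem_sphere, mem_ball] at *
          exact lt_of_le_of_ne hwcl hws
        have hweq : ⟪w0, w⟫ = c := by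
          apply le_antisymm _ hwge
          by_contra hh
          exact hwn ⟨hwb, not_le.mp hh⟩
        have hval : ⟪N • w0, w⟫ + (m - N * c) = m := by
          rw [real_inner_smul_left, hweq]; ring
        have h2 : ∀ᶠ x in 𝓝[U] w, ⟪N • w0, x⟫ + (m - N * c) < m + δ :=
          nhdsWithin_le_nhds (hcont.continuousAt.eventually (gt_mem_nhds (by linarith)))
        filter_upwards [h2, self_mem_nhdsWithin] with x hx2 hxU
        have := hm x (hUb hxU)
        linarith
    -- test point
    obtain ⟨t, ht1, ht2⟩ := exists_between hc2
    have hin : ⟪w0, t • w0⟫ = t := by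
      rw [inner_smul_right, real_inner_self_eq_norm_sq, hw1]; ring
    have htU : t • w0 ∈ U := by
      refine ⟨?_, ?_⟩
      · simp [norm_smul, hw1, abs_of_pos (hcpos.trans ht1), ht2]
      · show c < ⟪w0, t • w0⟫
        rw [hin]; exact ht1
    have h := hcomp ((u (t • w0) - m + C * √(1 - ‖t • w0‖ ^ 2) + 1) / (t - c)) _ htU
    rw [real_inner_smul_left, hin] at h
    have htc : t - c ≠ 0 := by linarith [sub_pos.mpr ht1]
    have e : (u (t • w0) - m + C * √(1 - ‖t • w0‖ ^ 2) + 1) / (t - c) * (t - c) =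
      u (t • w0) - m + C * √(1 - ‖t • w0‖ ^ 2) + 1 := div_mul_cancel₀ _ htc
    linarith
  -- u is bounded above by M
  have huM : ∀ z ∈ ball (0 : E2) 1, u z ≤ M := by
    intro z hz
    obtain ⟨g, c, hgz, hg⟩ := tangent_le huc hz (hdiff z hz)
    rw [← hgz]
    apply affine_le_of_sphere _ hz
    intro w0 hw0
    have hw1 : ‖w0‖ = 1 := by simpa using hw0
    by_contra hgt
    push Not at hgt
    have hcont : Continuous fun x : E2 => ⟪g, x⟫ + c := by fun_prop
    obtain ⟨ε, hε, hball⟩ := Metric.eventually_nhds_iff_ball.mp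
      (hcont.continuousAt.eventually (lt_mem_nhds hgt))
    obtain ⟨w, hw, hwc, hwn⟩ := hcap w0 hw0 (1 - ε ^ 2 / 2) (by nlinarith)
    have hww : ‖w‖ = 1 := by simpa using hw
    have hd : w ∈ ball w0 ε := by
      rw [mem_ball, dist_comm, dist_eq_norm]
      have := norm_sub_sq_real w0 w
      rw [hw1, hww] at this
      apply lt_of_pow_lt_pow_left₀ 2 hε.le
      linarith
    have h1 := hball w hd
    have h2 := haff g c hg w hw ((hup w hw).resolve_left hwn)
    have h3 := (abs_le.mp (hM w hw)).2
    linarith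
  -- hence all boundary values are genuine
  have hgen : ∀ w ∈ sphere (0 : E2) 1,
      ∀ c : ℝ, (∀ᶠ x in 𝓝[ball (0 : E2) 1] w, c ≤ u x) → c ≤ φ w := by
    intro w hw
    refine (hup w hw).resolve_left fun hN => ?_
    have hcl : w ∈ closure (ball (0 : E2) 1) := by
      rw [closure_ball _ one_ne_zero]
      exact sphere_subset_closedBall hw
    have : (𝓝[ball (0 : E2) 1] w).NeBot := mem_closure_iff_nhdsWithin_neBot.mp hcl
    obtain ⟨x, hx1, hx2⟩ := ((hN (M + 1)).and self_mem_nhdsWithin).exists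
    have := huM x hx2
    linarith
  intro z hz
  constructor
  · rw [sub_le_iff_le_add]
    apply csSup_le
    · refine ⟨_, 0, -M, fun w hw => ?_, rfl⟩
      have := (abs_le.mp (hM w hw)).1
      simpa using this
    rintro y ⟨g, c, hgc, rfl⟩
    have hkey : ∀ C : ℝ, 1 / √a < C → ⟪g, z⟫ + c ≤ u z + C * √(1 - ‖z‖ ^ 2) := by
      intro C hC
      have := comparison isOpen_ball subset_rfl hus (hsa.trans hC) (hdet C hC) g c ?_ z hz
      · linarith
      intro w hw δ hδ
      rw [frontier_ball _ one_ne_zero] at hw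
      have hcont : Continuous fun x : E2 => ⟪g, x⟫ + c := by fun_prop
      have h1 := hlow w hw (φ w - δ / 2) (by linarith)
      have h2 : ∀ᶠ x in 𝓝[ball (0 : E2) 1] w, ⟪g, x⟫ + c < φ w + δ / 2 :=
        nhdsWithin_le_nhds (hcont.continuousAt.eventually
          (gt_mem_nhds (by linarith [hgc w hw])))
      filter_upwards [h1, h2] with x hx1 hx2
      linarith
    have hlim : Tendsto (fun C : ℝ => u z + C * √(1 - ‖z‖ ^ 2)) (𝓝[>] (1 / √a))
        (𝓝 (u z + 1 / √a * √(1 - ‖z‖ ^ 2))) := by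
      have : Continuous fun C : ℝ => u z + C * √(1 - ‖z‖ ^ 2) := by fun_prop
      exact this.continuousAt.tendsto.mono_left nhdsWithin_le_nhds
    exact ge_of_tendsto hlim (eventually_nhdsWithin_of_forall hkey)
  · obtain ⟨g, c, hgz, hg⟩ := tangent_le huc hz (hdiff z hz)
    rw [← hgz]
    apply le_csSup
    · refine ⟨M, ?_⟩
      rintro y ⟨g', c', h', rfl⟩
      exact affine_le_of_sphere
        (fun w hw => (h' w hw).trans (abs_le.mp (hM w hw)).2) hz
    · exact ⟨g, c, fun w hw => haff g c hg w hw (hgen w hw), rfl⟩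
end
end

section
/- Fix K < 0 and let uₙ : 𝔻 → ℝ (n ∈ ℕ) be a sequence of smooth convex functions satisfying det D²uₙ(z) = (1/|K|)·(1−|z|²)⁻² for all z ∈ 𝔻, and suppose there is M₀ such that |uₙ(z)| ≤ M₀ for all n and all z ∈ 𝔻. Then for every compact set Ω ⊂ 𝔻 there exists a constant M such that for all n and all z ∈ Ω one has |uₙ(z)| + ‖∇uₙ(z)‖ + ‖D²uₙ(z)‖ ≤ M; that is, the C²-norms of uₙ on Ω are uniformly bounded. -/
open Metric Filter
open scoped RealInnerProductSpace Topology

noncomputable section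

/-- Directional derivative. -/
def Dd (w : E2) (f : E2 → ℝ) : E2 → ℝ := fun p => fderiv ℝ f p w

lemma snd_deriv_nonpos {g g' : ℝ → ℝ} {g2 : ℝ} (hg : ∀ᶠ t in 𝓝 (0:ℝ), HasDerivAt g (g' t) t)
    (hg' : HasDerivAt g' g2 0) (hm : IsLocalMax g 0) : g' 0 = 0 ∧ g2 ≤ 0 := by
  have h0 : HasDerivAt g (g' 0) 0 := hg.self_of_nhds
  have h1 : g' 0 = 0 := hm.hasDerivAt_eq_zero h0
  refine ⟨h1, ?_⟩
  by_contra hc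
  push Not at hc
  have hd : deriv g =ᶠ[𝓝 0] g' := hg.mono fun t ht => ht.deriv
  have hdd : deriv (deriv g) 0 = g2 := by rw [hd.deriv_eq]; exact hg'.deriv
  have hmin : IsLocalMin g 0 :=
    isLocalMin_of_deriv_deriv_pos (by rw [hdd]; exact hc) (by rw [h0.deriv, h1]) h0.continuousAt
  have hconst : g =ᶠ[𝓝 0] fun _ => g 0 := by
    filter_upwards [hm, hmin] with t a b using le_antisymm a b
  have hd0 : deriv g =ᶠ[𝓝 0] fun _ => 0 := by
    have := hconst.deriv
    simpa using this
  have : deriv (deriv g) 0 = 0 := by rw [hd0.deriv_eq]; simp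
  linarith

lemma Dd_smooth {U : Set E2} (hU : IsOpen U) {f : E2 → ℝ} (hf : ContDiffOn ℝ (⊤ : ℕ∞) f U)
    (w : E2) : ContDiffOn ℝ (⊤ : ℕ∞) (Dd w f) U := by
  have h : ContDiffOn ℝ (⊤ : ℕ∞) (fderiv ℝ f) U := hf.fderiv_of_isOpen hU (by simp)
  exact h.clm_apply contDiffOn_const

lemma smooth_diffAt {U : Set E2} (hU : IsOpen U) {f : E2 → ℝ} (hf : ContDiffOn ℝ (⊤ : ℕ∞) f U)
    {p : E2} (hp : p ∈ U) : DifferentiableAt ℝ f p :=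
  ((hf.contDiffAt (hU.mem_nhds hp)).differentiableAt (by simp))

lemma Dd_Dd {U : Set E2} (hU : IsOpen U) {f : E2 → ℝ} (hf : ContDiffOn ℝ (⊤ : ℕ∞) f U)
    {p : E2} (hp : p ∈ U) (v w : E2) :
    Dd v (Dd w f) p = fderiv ℝ (fderiv ℝ f) p v w := by
  have h : ContDiffOn ℝ (⊤ : ℕ∞) (fderiv ℝ f) U := hf.fderiv_of_isOpen hU (by simp)
  have hd : DifferentiableAt ℝ (fderiv ℝ f) p :=
    ((h.contDiffAt (hU.mem_nhds hp)).differentiableAt (by simp))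
  unfold Dd
  rw [fderiv_clm_apply hd (differentiableAt_const _)]
  simp

lemma Dd_comm {U : Set E2} (hU : IsOpen U) {f : E2 → ℝ} (hf : ContDiffOn ℝ (⊤ : ℕ∞) f U)
    {p : E2} (hp : p ∈ U) (v w : E2) :
    Dd v (Dd w f) p = Dd w (Dd v f) p := by
  rw [Dd_Dd hU hf hp, Dd_Dd hU hf hp]
  have h := (hf.contDiffAt (hU.mem_nhds hp)).isSymmSndFDerivAt (by simp only [minSmoothness_of_isRCLikeNormedField]; exact WithTop.coe_le_coe.2 (le_top : (2:ℕ∞) ≤ ⊤))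
  exact h v w

lemma Dd_congr {U : Set E2} (hU : IsOpen U) {f g : E2 → ℝ} (h : ∀ q ∈ U, f q = g q)
    {p : E2} (hp : p ∈ U) (w : E2) : Dd w f p = Dd w g p := by
  unfold Dd
  have : f =ᶠ[𝓝 p] g := Filter.eventuallyEq_of_mem (hU.mem_nhds hp) h
  rw [this.fderiv_eq]

lemma Dd_lin (f : E2 → ℝ) (p v w : E2) (s t : ℝ) :
    Dd (s • v + t • w) f p = s * Dd v f p + t * Dd w f p := by
  simp [Dd]

lemma Dd_mul {f g : E2 → ℝ} {p : E2} (hf : DifferentiableAt ℝ f p) (hg : DifferentiableAt ℝ g p)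
    (w : E2) : Dd w (fun q => f q * g q) p = Dd w f p * g p + f p * Dd w g p := by
  unfold Dd
  rw [fderiv_fun_mul hf hg]
  simp; ring

lemma Dd_sub {f g : E2 → ℝ} {p : E2} (hf : DifferentiableAt ℝ f p) (hg : DifferentiableAt ℝ g p)
    (w : E2) : Dd w (fun q => f q - g q) p = Dd w f p - Dd w g p := by
  unfold Dd
  rw [fderiv_fun_sub hf hg]
  simp

lemma Dd_add {f g : E2 → ℝ} {p : E2} (hf : DifferentiableAt ℝ f p) (hg : DifferentiableAt ℝ g p)
    (w : E2) : Dd w (fun q => f q + g q) p = Dd w f p + Dd w g p := by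
  unfold Dd
  rw [fderiv_fun_add hf hg]
  simp

lemma Dd_line {f : E2 → ℝ} {p w : E2} {t : ℝ} (hf : DifferentiableAt ℝ f (p + t • w)) :
    HasDerivAt (fun s : ℝ => f (p + s • w)) (Dd w f (p + t • w)) t := by
  have h1 : HasDerivAt (fun s : ℝ => p + s • w) w t := by
    simpa using ((hasDerivAt_id t).smul_const w).const_add p
  exact hf.hasFDerivAt.comp_hasDerivAt t h1

lemma line_mem {U : Set E2} (hU : IsOpen U) {p : E2} (hp : p ∈ U) (w : E2) :
    ∀ᶠ t in 𝓝 (0:ℝ), p + t • w ∈ U := by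
  have : ContinuousAt (fun s : ℝ => p + s • w) 0 := by fun_prop
  exact this.eventually (by simpa using hU.mem_nhds hp)

/-- One-dimensional version of the maximum principle for the Pogorelov function. -/
lemma pog_1d {η η1 α α1 β β1 : ℝ → ℝ} {η2 α2 β2 : ℝ}
    (hη : ∀ᶠ t in 𝓝 (0:ℝ), HasDerivAt η (η1 t) t) (hη1 : HasDerivAt η1 η2 0)
    (hα : ∀ᶠ t in 𝓝 (0:ℝ), HasDerivAt α (α1 t) t) (hα1 : HasDerivAt α1 α2 0)
    (hβ : ∀ᶠ t in 𝓝 (0:ℝ), HasDerivAt β (β1 t) t) (hβ1 : HasDerivAt β1 β2 0)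
    (pη : 0 < η 0) (pα : 0 < α 0)
    (hm : IsLocalMax (fun t => η t * α t * Real.exp (β t ^ 2 / 2)) 0) :
    η1 0 / η 0 + α1 0 / α 0 + β 0 * β1 0 = 0 ∧
    η2 / η 0 - (η1 0 / η 0) ^ 2 + (α2 / α 0 - (α1 0 / α 0) ^ 2) + β1 0 ^ 2 + β 0 * β2 ≤ 0 := by
  have cη := hη.self_of_nhds
  have cα := hα.self_of_nhds
  have cβ := hβ.self_of_nhds
  have eη : ∀ᶠ t in 𝓝 (0:ℝ), 0 < η t := cη.continuousAt.eventually (lt_mem_nhds pη)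
  have eα : ∀ᶠ t in 𝓝 (0:ℝ), 0 < α t := cα.continuousAt.eventually (lt_mem_nhds pα)
  have key := snd_deriv_nonpos (g := fun t => Real.log (η t) + Real.log (α t) + β t ^ 2 / 2)
    (g' := fun t => η1 t / η t + α1 t / α t + β t * β1 t)
    (g2 := (η2 * η 0 - η1 0 * η1 0) / η 0 ^ 2 + (α2 * α 0 - α1 0 * α1 0) / α 0 ^ 2
      + (β1 0 * β1 0 + β 0 * β2)) ?_ ?_ ?_
  · refine ⟨key.1, ?_⟩
    have := key.2
    have e1 : η2 / η 0 - (η1 0 / η 0) ^ 2 = (η2 * η 0 - η1 0 * η1 0) / η 0 ^ 2 := by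
      field_simp
    have e2 : α2 / α 0 - (α1 0 / α 0) ^ 2 = (α2 * α 0 - α1 0 * α1 0) / α 0 ^ 2 := by
      field_simp
    rw [e1, e2]; linarith
  · filter_upwards [hη, hα, hβ, eη, eα] with t a b c d e
    have h := ((a.log d.ne').add (b.log e.ne')).add ((c.pow 2).div_const 2)
    refine h.congr_deriv ?_
    simp; ring
  · exact ((hη1.div cη pη.ne').add (hα1.div cα pα.ne')).add (cβ.mul hβ1)
  · have hl : ∀ t, 0 < η t → 0 < α t → Real.log (η t) + Real.log (α t) + β t ^ 2 / 2
        = Real.log (η t * α t * Real.exp (β t ^ 2 / 2)) := by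
      intro t a b
      rw [Real.log_mul (by positivity) (by positivity), Real.log_mul a.ne' b.ne', Real.log_exp]
    filter_upwards [hm, eη, eα] with t a b c
    rw [hl t b c, hl 0 pη pα]
    exact Real.log_le_log (by positivity) a

/-- Purely algebraic part of the Pogorelov computation. -/
lemma pog_alg {η a b d v1 v2 a1 a2 a11 a12 a22 d1 f f1 f11 : ℝ} (hη : 0 < η) (ha : 0 < a)
    (hf : a * d - b * b = f) (hf1 : a1 * d + a * d1 - 2 * b * a2 = f1)
    (hf11 : a11 * d + 2 * a1 * d1 + a * a22 - 2 * a2 ^ 2 - 2 * b * a12 = f11)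
    (fo1 : -v1 / η + a1 / a + v1 * a = 0)
    (fo2 : -v2 / η + a2 / a + v1 * b = 0)
    (so : ∀ s t : ℝ, (-(s^2 * a + 2 * s * t * b + t^2 * d)) / η - (-(s * v1 + t * v2) / η) ^ 2 +
      ((s^2 * a11 + 2 * s * t * a12 + t^2 * a22) / a - ((s * a1 + t * a2) / a) ^ 2) +
      (s * a + t * b) ^ 2 + v1 * (s^2 * a1 + 2 * s * t * a2 + t^2 * d1) ≤ 0) (hfp : 0 < f) :
    f * (a * η) * (1 + v1^2) + f11 * η / a - 2 * f1 * v1 / a + 3 * v1 * f1 * η - 2 * f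
      - 2 * v1^2 * f ≤ 0 := by
  have h1 := so 1 0
  have h2 := so (-b) a
  have h3 := mul_nonneg hη.le (sub_nonneg.2 (add_le_add (mul_le_mul_of_nonneg_left h1 hfp.le) h2))
  have e1 : a1 = a * (v1 / η - v1 * a) := by field_simp at fo1 ⊢; linarith
  have e2 : a2 = a * (v2 / η - v1 * b) := by field_simp at fo2 ⊢; linarith
  have ed : d = (f + b * b) / a := by field_simp; linarith
  have ed1 : d1 = (f1 - a1 * d + 2 * b * a2) / a := by field_simp; linarith
  have ea : a22 = (f11 - a11 * d - 2 * a1 * d1 + 2 * a2^2 + 2 * b * a12) / a := by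
    field_simp; linarith
  refine le_of_mul_le_mul_left ?_ ha
  rw [mul_zero]
  refine le_trans (le_of_eq ?_) (neg_nonpos.2 h3)
  clear h1 h2 h3 so fo1 fo2 hf hf1 hf11
  subst ea ed1 ed
  subst e1 e2
  field_simp
  ring

lemma pog_fin {X η ω a v1 f f1 f11 F G : ℝ} (hX : X = a * η) (hη : 0 < η) (hηω : η ≤ ω) (ha : 0 < a)
    (hf : 0 < f) (hf1 : |f1| ≤ F * f) (hf11 : 0 ≤ f11) (hG : |v1| ≤ G)
    (h : f * (a * η) * (1 + v1^2) + f11 * η / a - 2 * f1 * v1 / a + 3 * v1 * f1 * η - 2 * f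
      - 2 * v1^2 * f ≤ 0) : X ≤ 3 + 5 * G * F * ω + 2 * G ^ 2 := by
  have hG0 : 0 ≤ G := (abs_nonneg _).trans hG
  have hF0 : 0 ≤ F := by
    by_contra hc
    push Not at hc
    have := (abs_nonneg _).trans hf1
    nlinarith
  have hω : 0 < ω := hη.trans_le hηω
  by_cases hX1 : X ≤ 1
  · have : 0 ≤ 5 * G * F * ω := by positivity
    nlinarith [sq_nonneg G]
  push Not at hX1
  have hinv : 1 / a ≤ ω := by
    rw [div_le_iff₀ ha]; nlinarith
  have hm : |f1 * v1| ≤ F * f * G := by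
    rw [abs_mul]; exact mul_le_mul hf1 hG (abs_nonneg _) (by positivity)
  have hm' := abs_le.1 hm
  have hv2 : v1 ^ 2 ≤ G ^ 2 := sq_le_sq' (by linarith [abs_le.1 hG]) (abs_le.1 hG).2
  have t1 : 2 * f1 * v1 / a ≤ 2 * (F * f * G) * ω := by
    have : 2 * f1 * v1 / a = 2 * (f1 * v1) * (1 / a) := by ring
    rw [this]
    have h1 : 0 < 1 / a := by positivity
    have h2 : (f1 * v1) * (1 / a) ≤ (F * f * G) * (1 / a) := mul_le_mul_of_nonneg_right hm'.2 h1.le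
    have h3 : (F * f * G) * (1 / a) ≤ (F * f * G) * ω :=
      mul_le_mul_of_nonneg_left hinv (by positivity)
    linarith
  have t2 : -(3 * v1 * f1 * η) ≤ 3 * (F * f * G) * ω := by
    have h2 : -(f1 * v1) * η ≤ (F * f * G) * η :=
      mul_le_mul_of_nonneg_right (by linarith) hη.le
    have h3 : (F * f * G) * η ≤ (F * f * G) * ω :=
      mul_le_mul_of_nonneg_left hηω (by positivity)
    nlinarith
  have t3 : 0 ≤ f11 * η / a := by positivity
  have t4 : f * X ≤ f * (a * η) * (1 + v1^2) := by
    rw [hX]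
    have : 0 ≤ f * (a * η) * v1 ^ 2 := by positivity
    linarith
  have t5 : v1 ^ 2 * f ≤ G ^ 2 * f := mul_le_mul_of_nonneg_right hv2 hf.le
  have : f * X ≤ f * (3 + 5 * G * F * ω + 2 * G ^ 2) := by nlinarith
  exact le_of_mul_le_mul_left this hf

/-- Pogorelov's interior estimate for one pure second derivative. -/
lemma pogorelov {U : Set E2} (hU : IsOpen U) {v f : E2 → ℝ} {e₁ e₂ : E2}
    (hv : ContDiffOn ℝ (⊤ : ℕ∞) v U)
    (heq : ∀ p ∈ U, Dd e₁ (Dd e₁ v) p * Dd e₂ (Dd e₂ v) p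
      - Dd e₂ (Dd e₁ v) p * Dd e₂ (Dd e₁ v) p = f p)
    (hfpos : ∀ p ∈ U, 0 < f p) (hf11 : ∀ p ∈ U, 0 ≤ Dd e₁ (Dd e₁ f) p)
    (hpos : ∀ p ∈ U, 0 < Dd e₁ (Dd e₁ v) p)
    {z₀ : E2} {r ω F G : ℝ} (hr : 0 < r) (hsub : closedBall z₀ r ⊆ U)
    (hf1 : ∀ p ∈ closedBall z₀ r, |Dd e₁ f p| ≤ F * f p)
    (hG : ∀ p ∈ closedBall z₀ r, |Dd e₁ v p| ≤ G)
    (hω : 0 < ω) (hv0 : v z₀ = 0) (hvn : ∀ p ∈ closedBall z₀ r, 0 ≤ v p)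
    (hvω : ∀ p ∈ sphere z₀ r, ω ≤ v p) :
    ω * Dd e₁ (Dd e₁ v) z₀ ≤ (3 + 5 * G * F * ω + 2 * G ^ 2) * Real.exp (G ^ 2 / 2) := by
  have hz0 : z₀ ∈ closedBall z₀ r := mem_closedBall_self hr.le
  have s1 := Dd_smooth hU hv e₁
  have s2 := Dd_smooth hU hv e₂
  have s11 := Dd_smooth hU s1 e₁
  have s12 := Dd_smooth hU s1 e₂
  have s22 := Dd_smooth hU s2 e₂
  set a := Dd e₁ (Dd e₁ v) with ha
  set b := Dd e₂ (Dd e₁ v) with hb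
  set d := Dd e₂ (Dd e₂ v) with hd
  set β := Dd e₁ v with hβ
  let Φ : E2 → ℝ := fun p => (ω - v p) * a p * Real.exp (β p ^ 2 / 2)
  have hΦc : ContinuousOn Φ (closedBall z₀ r) := by
    have c1 := (hv.continuousOn).mono hsub
    have c2 := (s11.continuousOn).mono hsub
    have c3 := (s1.continuousOn).mono hsub
    exact ((continuousOn_const.sub c1).mul c2).mul
      (Real.continuous_exp.comp_continuousOn ((c3.pow 2).div_const 2))
  obtain ⟨p, hp, hpm⟩ := (isCompact_closedBall z₀ r).exists_isMaxOn ⟨z₀, hz0⟩ hΦc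
  have hpU := hsub hp
  have hΦz : ω * a z₀ ≤ Φ z₀ := by
    have h1 : 1 ≤ Real.exp (β z₀ ^ 2 / 2) := Real.one_le_exp (by positivity)
    have h2 : 0 < ω * a z₀ := mul_pos hω (hpos _ (hsub hz0))
    simp only [Φ, hv0, sub_zero]
    nlinarith
  have hΦp : 0 < Φ p :=
    (mul_pos hω (hpos _ (hsub hz0))).trans_le (hΦz.trans (hpm hz0))
  have hη : 0 < ω - v p := by
    have h1 := pos_of_mul_pos_left hΦp (Real.exp_pos _).le
    exact pos_of_mul_pos_left h1 (hpos p hpU).le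
  have hpb : p ∈ ball z₀ r := by
    rcases (mem_closedBall.1 hp).lt_or_eq with h | h
    · exact h
    · have := hvω p h
      linarith
  have hlm : IsLocalMax Φ p := by
    filter_upwards [isOpen_ball.mem_nhds hpb] with q hq
    exact hpm (ball_subset_closedBall hq)
  -- relations among third and fourth derivatives
  have hb1 : ∀ q ∈ U, Dd e₁ b q = Dd e₂ a q := fun q hq => Dd_comm hU s1 hq _ _
  have hd1 : ∀ q ∈ U, Dd e₁ d q = Dd e₂ b q := fun q hq => by
    rw [hd, Dd_comm hU s2 hq]
    exact Dd_congr hU (fun x hx => Dd_comm hU hv hx _ _) hq _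
  have hb11 : Dd e₁ (Dd e₁ b) p = Dd e₂ (Dd e₁ a) p := by
    rw [Dd_congr hU hb1 hpU, Dd_comm hU s11 hpU]
  have hd11 : Dd e₁ (Dd e₁ d) p = Dd e₂ (Dd e₂ a) p := by
    rw [Dd_congr hU hd1 hpU, Dd_comm hU s12 hpU]
    exact Dd_congr hU hb1 hpU _
  have dA : ∀ {g : E2 → ℝ}, ContDiffOn ℝ (⊤ : ℕ∞) g U → ∀ q ∈ U, DifferentiableAt ℝ g q :=
    fun hg q hq => smooth_diffAt hU hg hq
  have hF1 : ∀ q ∈ U, (Dd e₁ a q * d q + a q * Dd e₁ d q)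
      - (Dd e₁ b q * b q + b q * Dd e₁ b q) = Dd e₁ f q := by
    intro q hq
    rw [← Dd_congr hU heq hq, Dd_sub ((dA s11 q hq).fun_mul (dA s22 q hq))
      ((dA s12 q hq).fun_mul (dA s12 q hq)), Dd_mul (dA s11 q hq) (dA s22 q hq),
      Dd_mul (dA s12 q hq) (dA s12 q hq)]
  have s111 := Dd_smooth hU s11 e₁
  have s112 := Dd_smooth hU s11 e₂
  have s121 := Dd_smooth hU s12 e₁
  have s122 := Dd_smooth hU s12 e₂
  have s221 := Dd_smooth hU s22 e₁
  have hF11 : (Dd e₁ (Dd e₁ a) p * d p + Dd e₁ a p * Dd e₁ d p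
        + (Dd e₁ a p * Dd e₁ d p + a p * Dd e₁ (Dd e₁ d) p))
      - (Dd e₁ (Dd e₁ b) p * b p + Dd e₁ b p * Dd e₁ b p
        + (Dd e₁ b p * Dd e₁ b p + b p * Dd e₁ (Dd e₁ b) p)) = Dd e₁ (Dd e₁ f) p := by
    have A := dA s11 p hpU
    have B := dA s12 p hpU
    have D := dA s22 p hpU
    have A1 := dA s111 p hpU
    have B1 := dA s121 p hpU
    have D1 := dA s221 p hpU
    rw [← Dd_congr hU hF1 hpU,
      Dd_sub ((A1.fun_mul D).fun_add (A.fun_mul D1)) ((B1.fun_mul B).fun_add (B.fun_mul B1)),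
      Dd_add (A1.fun_mul D) (A.fun_mul D1), Dd_add (B1.fun_mul B) (B.fun_mul B1),
      Dd_mul A1 D, Dd_mul A D1, Dd_mul B1 B, Dd_mul B B1]
  -- second order condition in direction `s e₁ + t e₂`
  have main : ∀ s t : ℝ,
      (-(s * β p + t * Dd e₂ v p) / (ω - v p) + (s * Dd e₁ a p + t * Dd e₂ a p) / a p
        + β p * (s * a p + t * b p) = 0) ∧
      (-(s^2 * a p + 2 * s * t * b p + t^2 * d p)) / (ω - v p)
        - (-(s * β p + t * Dd e₂ v p) / (ω - v p)) ^ 2 +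
      ((s^2 * Dd e₁ (Dd e₁ a) p + 2 * s * t * Dd e₂ (Dd e₁ a) p + t^2 * Dd e₂ (Dd e₂ a) p) / a p
        - ((s * Dd e₁ a p + t * Dd e₂ a p) / a p) ^ 2) +
      (s * a p + t * b p) ^ 2
        + β p * (s^2 * Dd e₁ a p + 2 * s * t * Dd e₂ a p + t^2 * Dd e₁ d p) ≤ 0 := by
    intro s t
    set w : E2 := s • e₁ + t • e₂ with hw
    have hl := line_mem hU hpU w
    have lin2 : ∀ g : E2 → ℝ, ContDiffOn ℝ (⊤ : ℕ∞) g U → Dd w (Dd w g) p =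
        s^2 * Dd e₁ (Dd e₁ g) p + 2 * s * t * Dd e₂ (Dd e₁ g) p + t^2 * Dd e₂ (Dd e₂ g) p := by
      intro g hg
      have c := Dd_comm hU hg hpU e₁ e₂
      rw [hw, Dd_lin, ← hw, Dd_comm hU hg hpU, Dd_comm hU hg hpU e₂, hw, Dd_lin, Dd_lin, c]
      ring
    have base : ∀ g : E2 → ℝ, ContDiffOn ℝ (⊤ : ℕ∞) g U →
        (∀ᶠ x in 𝓝 (0:ℝ), HasDerivAt (fun x : ℝ => g (p + x • w)) (Dd w g (p + x • w)) x) ∧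
        HasDerivAt (fun x : ℝ => Dd w g (p + x • w)) (Dd w (Dd w g) p) 0 := by
      intro g hg
      refine ⟨hl.mono fun x hx => Dd_line (dA hg _ hx), ?_⟩
      have := Dd_line (f := Dd w g) (p := p) (w := w) (t := 0)
        (by simpa using dA (Dd_smooth hU hg w) p hpU)
      simpa using this
    have bv := base v hv
    have bα := base a s11
    have bβ := base β s1
    have hm : IsLocalMax (fun x : ℝ => (ω - v (p + x • w)) * a (p + x • w)
        * Real.exp (β (p + x • w) ^ 2 / 2)) 0 := by
      have hc : ContinuousAt (fun s : ℝ => p + s • w) 0 := by fun_prop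
      have : Tendsto (fun s : ℝ => p + s • w) (𝓝 0) (𝓝 p) := by simpa using hc.tendsto
      have := this.eventually hlm
      filter_upwards [this] with x hx
      simpa [Φ] using hx
    have key := pog_1d (η := fun x => ω - v (p + x • w)) (η1 := fun x => - Dd w v (p + x • w))
      (bv.1.mono fun x hx => by simpa using hx.const_sub ω) bv.2.neg bα.1 bα.2 bβ.1 bβ.2
      (by simpa using hη) (by simpa using hpos p hpU) hm
    simp only [zero_smul, add_zero] at key
    rw [lin2 v hv, lin2 a s11, lin2 β s1] at key
    have l1 : Dd w v p = s * β p + t * Dd e₂ v p := Dd_lin _ _ _ _ _ _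
    have l2 : Dd w a p = s * Dd e₁ a p + t * Dd e₂ a p := Dd_lin _ _ _ _ _ _
    have l3 : Dd w β p = s * a p + t * b p := Dd_lin _ _ _ _ _ _
    rw [l1, l2, l3] at key
    rw [hd1 p hpU]
    exact key
  have alg := pog_alg (η := ω - v p) (a := a p) (b := b p) (d := d p) (v1 := β p)
    (v2 := Dd e₂ v p) (a1 := Dd e₁ a p) (a2 := Dd e₂ a p) (a11 := Dd e₁ (Dd e₁ a) p)
    (a12 := Dd e₂ (Dd e₁ a) p) (a22 := Dd e₂ (Dd e₂ a) p) (d1 := Dd e₁ d p) (f := f p)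
    (f1 := Dd e₁ f p) (f11 := Dd e₁ (Dd e₁ f) p) hη (hpos p hpU) (heq p hpU)
    (by have := hF1 p hpU; rw [hb1 p hpU] at this; linarith)
    (by have := hF11; rw [hb1 p hpU, hb11, hd11] at this; linarith)
    (by have := (main 1 0).1; simpa using this)
    (by have := (main 0 1).1; simpa using this)
    (fun s t => (main s t).2) (hfpos p hpU)
  have hXb := pog_fin (X := a p * (ω - v p)) (ω := ω) rfl hη (by linarith [hvn p hp]) (hpos p hpU)
    (hfpos p hpU) (hf1 p hp) (hf11 p hpU) (hG p hp) alg
  have hexp : Real.exp (β p ^ 2 / 2) ≤ Real.exp (G ^ 2 / 2) := by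
    apply Real.exp_le_exp.2
    have := abs_le.1 (hG p hp)
    have : β p ^ 2 ≤ G ^ 2 := sq_le_sq' (by linarith) this.2
    linarith
  calc ω * a z₀ ≤ Φ z₀ := hΦz
    _ ≤ Φ p := hpm hz0
    _ = a p * (ω - v p) * Real.exp (β p ^ 2 / 2) := by simp only [Φ]; ring
    _ ≤ _ := mul_le_mul hXb hexp (Real.exp_pos _).le
        ((mul_pos (hpos p hpU) hη).le.trans hXb)

lemma tangent_le_s8 {U : Set E2} {v : E2 → ℝ} (hc : ConvexOn ℝ U v) {p q : E2} (hp : p ∈ U)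
    (hq : q ∈ U) (hd : DifferentiableAt ℝ v p) {w : E2} {t : ℝ} (ht : q = p + t • w) :
    v p + t * Dd w v p ≤ v q := by
  have h1 : ConvexOn ℝ (AffineMap.lineMap p q ⁻¹' U) (v ∘ AffineMap.lineMap (k := ℝ) p q) :=
    hc.comp_affineMap _
  have h2 : HasDerivAt (v ∘ AffineMap.lineMap (k := ℝ) p q) (Dd (q - p) v p) 0 := by
    have := Dd_line (f := v) (p := p) (w := q - p) (t := 0) (by simpa using hd)
    simp only [zero_smul, add_zero] at this
    convert this using 1
    ext s
    simp [AffineMap.lineMap_apply, add_comm]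
  have h3 := h1.le_slope_of_hasDerivAt (x := 0) (y := 1) (by simpa using hp) (by simpa using hq)
    zero_lt_one h2
  simp [slope_def_field] at h3
  have h4 : Dd (q - p) v p = t * Dd w v p := by
    subst ht; simp [Dd]
  linarith

/-- Integral inequality behind the strict convexity in dimension two. -/
lemma int_ineq {A B : ℝ → ℝ} {x₀ x₁ c S : ℝ} (hx : x₀ < x₁) (hc : 0 < c) (hS : 0 < S)
    (hA : ContinuousOn A (Set.Icc x₀ x₁)) (hB : ContinuousOn B (Set.Icc x₀ x₁))
    (hAp : ∀ x ∈ Set.Icc x₀ x₁, 0 < A x) (hAB : ∀ x ∈ Set.Icc x₀ x₁, c ≤ A x * B x)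
    (hI : ∫ x in x₀..x₁, A x ≤ S) : c * (x₁ - x₀) ^ 2 / S ≤ ∫ x in x₀..x₁, B x := by
  set l := (x₁ - x₀) / S with hl
  have iA : IntervalIntegrable A MeasureTheory.volume x₀ x₁ :=
    ContinuousOn.intervalIntegrable (by rwa [Set.uIcc_of_le hx.le])
  have iB : IntervalIntegrable B MeasureTheory.volume x₀ x₁ :=
    ContinuousOn.intervalIntegrable (by rwa [Set.uIcc_of_le hx.le])
  have h1 : ∫ x in x₀..x₁, (c * (2 * l) - c * l ^ 2 * A x) ≤ ∫ x in x₀..x₁, B x := by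
    apply intervalIntegral.integral_mono_on hx.le _ iB
    · intro x hx
      have hp := hAp x hx
      have hb := hAB x hx
      refine le_of_mul_le_mul_left (le_trans ?_ hb) hp
      nlinarith [mul_nonneg hc.le (sq_nonneg (l * A x - 1))]
    · exact intervalIntegrable_const.sub (iA.const_mul _)
  rw [intervalIntegral.integral_sub intervalIntegrable_const (iA.const_mul _),
    intervalIntegral.integral_const, intervalIntegral.integral_const_mul] at h1
  have h2 : c * l ^ 2 * ∫ x in x₀..x₁, A x ≤ c * l ^ 2 * S :=
    mul_le_mul_of_nonneg_left hI (by positivity)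
  have h3 : c * (x₁ - x₀) ^ 2 / S = (x₁ - x₀) • (c * (2 * l)) - c * l ^ 2 * S := by
    rw [hl, smul_eq_mul]; field_simp; ring
  linarith

lemma strict_conv {U : Set E2} (hU : IsOpen U) {v : E2 → ℝ} {e n z₀ : E2}
    (hv : ContDiffOn ℝ (⊤ : ℕ∞) v U) (hc : ConvexOn ℝ U v)
    {r T G c ε : ℝ} (hr : 0 < r) (hT : 0 < T) (hG : 0 < G) (hcp : 0 < c) (hε : 0 < ε)
    (hrect : ∀ x ∈ Set.Icc 0 r, ∀ y ∈ Set.Icc 0 T, z₀ + x • e + y • n ∈ U)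
    (hvn : ∀ x ∈ Set.Icc 0 r, ∀ y ∈ Set.Icc 0 T, 0 ≤ v (z₀ + x • e + y • n))
    (hGn : ∀ x ∈ Set.Icc 0 r, ∀ y ∈ Set.Icc 0 T, |Dd n v (z₀ + x • e + y • n)| ≤ G)
    (hve : ∀ x ∈ Set.Icc 0 r, v (z₀ + x • e) ≤ ε)
    (hpos : ∀ p ∈ U, 0 < Dd e (Dd e v) p)
    (hdet : ∀ p ∈ U, c ≤ Dd e (Dd e v) p * Dd n (Dd n v) p) :
    c * r ^ 3 / 54 * ((Real.log (ε + G * T) - Real.log ε) / G) ≤ 2 * G * r / 3 := by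
  set P : ℝ → ℝ → E2 := fun x y => z₀ + x • e + y • n with hP
  have dv : ∀ p ∈ U, DifferentiableAt ℝ v p := fun p hp => smooth_diffAt hU hv hp
  have sN := Dd_smooth hU hv n
  have sE := Dd_smooth hU hv e
  have sNN := Dd_smooth hU sN n
  have sEE := Dd_smooth hU sE e
  have hTT : T ∈ Set.Icc 0 T := ⟨hT.le, le_rfl⟩
  have h0T : (0:ℝ) ∈ Set.Icc 0 T := ⟨le_rfl, hT.le⟩
  have hsub : ∀ x ∈ Set.Icc (r/3) (2*r/3), x ∈ Set.Icc 0 r := fun x hx =>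
    ⟨by linarith [hx.1], by linarith [hx.2]⟩
  have st1 : ∀ x ∈ Set.Icc 0 r, ∀ y ∈ Set.Icc 0 T, v (P x y) ≤ ε + G * y := by
    intro x hx y hy
    have h := tangent_le_s8 hc (hrect x hx y hy) (hrect x hx 0 h0T) (dv _ (hrect x hx y hy))
      (w := n) (t := -y) (by simp)
    have h1 := hve x hx
    have h2 := (abs_le.1 (hGn x hx y hy)).2
    simp only [zero_smul, add_zero] at h
    simp only [hP]
    nlinarith [hy.1]
  have st2 : ∀ y ∈ Set.Icc 0 T, Dd e v (P (2*r/3) y) - Dd e v (P (r/3) y) ≤ 6 * (ε + G * y) / r := by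
    intro y hy
    have i0 : (0:ℝ) ∈ Set.Icc 0 r := ⟨le_rfl, hr.le⟩
    have i1 : r/3 ∈ Set.Icc 0 r := ⟨by linarith, by linarith⟩
    have i2 : 2*r/3 ∈ Set.Icc 0 r := ⟨by linarith, by linarith⟩
    have i3 : r ∈ Set.Icc 0 r := ⟨hr.le, le_rfl⟩
    have a1 := tangent_le_s8 hc (hrect _ i1 y hy) (hrect _ i0 y hy) (dv _ (hrect _ i1 y hy))
      (w := e) (t := -(r/3)) (by module)
    have a2 := tangent_le_s8 hc (hrect _ i2 y hy) (hrect _ i3 y hy) (dv _ (hrect _ i2 y hy))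
      (w := e) (t := r/3) (by module)
    have b1 := hvn _ i1 y hy
    have b2 := hvn _ i2 y hy
    have c1 := st1 _ i0 y hy
    have c2 := st1 _ i3 y hy
    rw [le_div_iff₀ hr]
    simp only [hP] at c1 c2 ⊢
    nlinarith
  -- continuity on the rectangle
  have cP : Continuous (fun z : ℝ × ℝ => P z.1 z.2) := by simp only [hP]; fun_prop
  have cont : ∀ g : E2 → ℝ, ContDiffOn ℝ (⊤ : ℕ∞) g U →
      ContinuousOn (fun z : ℝ × ℝ => g (P z.1 z.2)) (Set.Icc (r/3) (2*r/3) ×ˢ Set.Icc 0 T) := by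
    intro g hg
    refine hg.continuousOn.comp cP.continuousOn ?_
    intro z hz
    exact hrect _ (hsub _ hz.1) _ hz.2
  have contx : ∀ g : E2 → ℝ, ContDiffOn ℝ (⊤ : ℕ∞) g U → ∀ y ∈ Set.Icc 0 T,
      ContinuousOn (fun x => g (P x y)) (Set.Icc (r/3) (2*r/3)) := by
    intro g hg y hy
    refine hg.continuousOn.comp (f := fun x => P x y) ?_ (fun x hx => hrect _ (hsub _ hx) _ hy)
    simp only [hP]; fun_prop
  have conty : ∀ g : E2 → ℝ, ContDiffOn ℝ (⊤ : ℕ∞) g U → ∀ x ∈ Set.Icc (r/3) (2*r/3),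
      ContinuousOn (fun y => g (P x y)) (Set.Icc 0 T) := by
    intro g hg x hx
    refine hg.continuousOn.comp (f := fun y => P x y) ?_ (fun y hy => hrect _ (hsub _ hx) _ hy)
    simp only [hP]; fun_prop
  have hx01 : r/3 < 2*r/3 := by linarith
  have st3 : ∀ y ∈ Set.Icc 0 T, ∫ x in (r/3)..(2*r/3), Dd e (Dd e v) (P x y)
      ≤ 6 * (ε + G * y) / r := by
    intro y hy
    rw [intervalIntegral.integral_eq_sub_of_hasDerivAt (f := fun x => Dd e v (P x y))]
    · exact st2 y hy
    · intro x hx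
      rw [Set.uIcc_of_le hx01.le] at hx
      have := Dd_line (f := Dd e v) (p := z₀ + y • n) (w := e) (t := x)
        (by
          have := smooth_diffAt hU sE (hrect x (hsub x hx) y hy)
          rwa [add_right_comm] at this)
      simp only [add_right_comm z₀ (y • n)] at this
      exact this
    · exact ContinuousOn.intervalIntegrable (by rw [Set.uIcc_of_le hx01.le]; exact contx _ sEE y hy)
  have st4 : ∀ y ∈ Set.Icc 0 T, c * r ^ 3 / 54 * (1 / (ε + G * y)) ≤
      ∫ x in (r/3)..(2*r/3), Dd n (Dd n v) (P x y) := by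
    intro y hy
    have hpy : 0 < ε + G * y := by nlinarith [hy.1]
    have := int_ineq hx01 hcp (S := 6 * (ε + G * y) / r) (by positivity) (contx _ sEE y hy)
      (contx _ sNN y hy) (fun x hx => hpos _ (hrect x (hsub x hx) y hy))
      (fun x hx => hdet _ (hrect x (hsub x hx) y hy)) (st3 y hy)
    refine le_trans (le_of_eq ?_) this
    field_simp
    ring
  have hInteg : MeasureTheory.IntegrableOn (fun z : ℝ × ℝ => Dd n (Dd n v) (P z.1 z.2))
      (Set.Icc (r/3) (2*r/3) ×ˢ Set.Icc 0 T) MeasureTheory.volume :=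
    (cont _ sNN).integrableOn_compact (isCompact_Icc.prod isCompact_Icc)
  have hInteg' : MeasureTheory.IntegrableOn (fun z : ℝ × ℝ => Dd n (Dd n v) (P z.1 z.2))
      (Set.Ioc (r/3) (2*r/3) ×ˢ Set.Ioc 0 T) MeasureTheory.volume :=
    hInteg.mono_set (Set.prod_mono Set.Ioc_subset_Icc_self Set.Ioc_subset_Icc_self)
  have swap := MeasureTheory.intervalIntegral_intervalIntegral_swap
    (F := fun x y => Dd n (Dd n v) (P x y)) (a := r/3) (b := 2*r/3) (c := 0) (d := T)
    (by rw [Set.uIoc_of_le hx01.le, Set.uIoc_of_le hT.le]; exact hInteg')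
  have outer : IntervalIntegrable (fun y => ∫ x in (r/3)..(2*r/3), Dd n (Dd n v) (P x y))
      MeasureTheory.volume 0 T := by
    rw [intervalIntegrable_iff_integrableOn_Ioc_of_le hT.le]
    have h := hInteg'
    rw [MeasureTheory.IntegrableOn, MeasureTheory.Measure.volume_eq_prod,
      ← MeasureTheory.Measure.prod_restrict] at h
    have := h.integral_prod_right
    refine this.congr (Filter.Eventually.of_forall fun y => ?_)
    simp only
    rw [intervalIntegral.integral_of_le hx01.le]
  have hden : ∀ y ∈ Set.Icc 0 T, 0 < ε + G * y := fun y hy => by nlinarith [hy.1]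
  have cden : ContinuousOn (fun y => c * r ^ 3 / 54 * (1 / (ε + G * y))) (Set.uIcc 0 T) := by
    rw [Set.uIcc_of_le hT.le]
    refine continuousOn_const.mul (continuousOn_const.div (by fun_prop) ?_)
    exact fun y hy => (hden y hy).ne'
  have low : c * r ^ 3 / 54 * ((Real.log (ε + G * T) - Real.log ε) / G) ≤
      ∫ y in (0:ℝ)..T, ∫ x in (r/3)..(2*r/3), Dd n (Dd n v) (P x y) := by
    have h1 := intervalIntegral.integral_mono_on hT.le cden.intervalIntegrable outer st4
    refine le_trans (le_of_eq ?_) h1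
    rw [intervalIntegral.integral_eq_sub_of_hasDerivAt
      (f := fun y => c * r ^ 3 / 54 * (Real.log (ε + G * y) / G)) _ cden.intervalIntegrable]
    · simp; ring
    · intro y hy
      rw [Set.uIcc_of_le hT.le] at hy
      have h2 : HasDerivAt (fun y => ε + G * y) G y := by
        simpa using ((hasDerivAt_id y).const_mul G).const_add ε
      have h3 := ((h2.log (hden y hy).ne').div_const G).const_mul (c * r ^ 3 / 54)
      refine h3.congr_deriv ?_
      field_simp
  have up : ∫ x in (r/3)..(2*r/3), ∫ y in (0:ℝ)..T, Dd n (Dd n v) (P x y) ≤ 2 * G * r / 3 := by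
    have hb : ∀ x ∈ Set.Icc (r/3) (2*r/3), ∫ y in (0:ℝ)..T, Dd n (Dd n v) (P x y) =
        Dd n v (P x T) - Dd n v (P x 0) := by
      intro x hx
      rw [intervalIntegral.integral_eq_sub_of_hasDerivAt (f := fun y => Dd n v (P x y))]
      · intro y hy
        rw [Set.uIcc_of_le hT.le] at hy
        exact Dd_line (smooth_diffAt hU sN (hrect x (hsub x hx) y hy))
      · exact ContinuousOn.intervalIntegrable (by rw [Set.uIcc_of_le hT.le]; exact conty _ sNN x hx)
    have hcongr : ∫ x in (r/3)..(2*r/3), ∫ y in (0:ℝ)..T, Dd n (Dd n v) (P x y) =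
        ∫ x in (r/3)..(2*r/3), (Dd n v (P x T) - Dd n v (P x 0)) := by
      apply intervalIntegral.integral_congr
      intro x hx
      rw [Set.uIcc_of_le hx01.le] at hx
      exact hb x hx
    rw [hcongr]
    have h1 := intervalIntegral.integral_mono_on (μ := MeasureTheory.volume)
      (f := fun x => Dd n v (P x T) - Dd n v (P x 0))
      (g := fun _ => 2 * G) hx01.le (ContinuousOn.intervalIntegrable (by
        rw [Set.uIcc_of_le hx01.le]; exact (contx _ sN T hTT).sub (contx _ sN 0 h0T)))
      intervalIntegrable_const
      (fun x hx => by
        have a1 := (abs_le.1 (hGn x (hsub x hx) T hTT)).2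
        have a2 := (abs_le.1 (hGn x (hsub x hx) 0 h0T)).1
        simp only [hP]; linarith)
    refine h1.trans (le_of_eq ?_)
    simp; ring
  rw [← swap] at low
  exact low.trans up

lemma conv_nonneg {U : Set E2} (hU : IsOpen U) {v : E2 → ℝ} (hv : ContDiffOn ℝ (⊤ : ℕ∞) v U)
    (hc : ConvexOn ℝ U v) {p : E2} (hp : p ∈ U) (w : E2) : 0 ≤ Dd w (Dd w v) p := by
  have hl := line_mem hU hp w
  have h2 : HasDerivAt (fun x : ℝ => Dd w v (p + x • w)) (Dd w (Dd w v) p) 0 := by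
    have := Dd_line (f := Dd w v) (p := p) (w := w) (t := 0)
      (by simpa using smooth_diffAt hU (Dd_smooth hU hv w) hp)
    simpa using this
  have key := snd_deriv_nonpos (g := fun t : ℝ => t * Dd w v p - v (p + t • w))
    (g' := fun t => Dd w v p - Dd w v (p + t • w)) (g2 := - Dd w (Dd w v) p) ?_ ?_ ?_
  · linarith [key.2]
  · filter_upwards [hl] with t ht
    have h3 := ((hasDerivAt_id t).mul_const (Dd w v p)).fun_sub (Dd_line (smooth_diffAt hU hv ht))
    simpa using h3
  · simpa using h2.const_sub (Dd w v p)
  · filter_upwards [hl] with t ht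
    have := tangent_le_s8 hc hp ht (smooth_diffAt hU hv hp) rfl
    simp only [zero_mul, zero_smul, add_zero]
    linarith

/-- The standard basis vectors. -/
def b0 : E2 := EuclideanSpace.single 0 1
def b1 : E2 := EuclideanSpace.single 1 1

lemma E2_decomp (e : E2) : e = e 0 • b0 + e 1 • b1 := by
  ext i; fin_cases i <;> simp [b0, b1]

lemma E2_norm_sq (e : E2) : ‖e‖ ^ 2 = e 0 ^ 2 + e 1 ^ 2 := by
  rw [EuclideanSpace.norm_sq_eq]; simp

/-- The right-hand side. -/
def rhs (c : ℝ) (z : E2) : ℝ := c * ((1 - ‖z‖ ^ 2) ^ 2)⁻¹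

lemma q_hasFDerivAt (p : E2) :
    HasFDerivAt (fun z : E2 => 1 - ‖z‖ ^ 2) (-(2 • innerSL ℝ p)) p := by
  have := (hasStrictFDerivAt_norm_sq p).hasFDerivAt
  exact this.const_sub 1

lemma q_pos {p : E2} (hp : p ∈ ball (0 : E2) 1) : 0 < 1 - ‖p‖ ^ 2 := by
  have h : ‖p‖ < 1 := by simpa using hp
  nlinarith [norm_nonneg p]

lemma Dd_rhs (c : ℝ) {p : E2} (hp : p ∈ ball (0 : E2) 1) (w : E2) :
    Dd w (rhs c) p = 4 * c * (inner ℝ p w * ((1 - ‖p‖ ^ 2) ^ 3)⁻¹) := by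
  have hq := q_pos hp
  have hl : HasDerivAt (fun t : ℝ => p + t • w) w 0 := by
    simpa using ((hasDerivAt_id (0:ℝ)).smul_const w).const_add p
  have h1 := (q_hasFDerivAt p)
  have h2 := (hasDerivAt_inv (pow_pos hq 2).ne').comp_hasFDerivAt p (h1.pow 2)
  have h3 := h2.const_mul c
  have h4 : Dd w (rhs c) p = _ := congrArg (fun L => L w) h3.fderiv
  rw [h4]
  simp
  field_simp
  ring

lemma Dd_Dd_rhs {c : ℝ} (hc : 0 < c) {p : E2} (hp : p ∈ ball (0 : E2) 1) (w : E2) :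
    0 ≤ Dd w (Dd w (rhs c)) p := by
  have hq := q_pos hp
  rw [Dd_congr isOpen_ball (fun q hq => Dd_rhs c hq w) hp]
  have h1 := (q_hasFDerivAt p)
  have h2 := (hasDerivAt_inv (pow_pos hq 3).ne').comp_hasFDerivAt p (h1.pow 3)
  have hi : HasFDerivAt (fun z : E2 => inner ℝ z w) (innerSL ℝ w) p := by
    have := (innerSL ℝ w).hasFDerivAt (x := p)
    simpa [real_inner_comm] using this
  have h3 := (hi.mul h2).const_mul (4 * c)
  have h4 : Dd w (fun q => 4 * c * (inner ℝ q w * ((1 - ‖q‖ ^ 2) ^ 3)⁻¹)) p = _ :=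
    congrArg (fun L => L w) h3.fderiv
  rw [h4]
  have e : ∀ X Y Q : ℝ, 0 < Q → 0 ≤ Y → 0 ≤ 4 * c * (6 * X ^ 2 * Q⁻¹ ^ 4 + Y * (Q ^ 3)⁻¹) := by
    intros; positivity
  refine le_trans (e (inner ℝ p w) (‖w‖ ^ 2) _ hq (by positivity)) (le_of_eq ?_)
  simp
  field_simp
  ring

lemma Dd_rhs_le {c : ℝ} (hc : 0 < c) {p : E2} {δ : ℝ} (hδ : 0 < δ) (hp : ‖p‖ ≤ 1 - δ) {w : E2}
    (hw : ‖w‖ = 1) : |Dd w (rhs c) p| ≤ 4 / δ * rhs c p := by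
  have hpb : p ∈ ball (0 : E2) 1 := by simp; linarith
  have hq := q_pos hpb
  have hqδ : δ ≤ 1 - ‖p‖ ^ 2 := by nlinarith [norm_nonneg p]
  rw [Dd_rhs c hpb, rhs]
  have hin : |inner ℝ p w| ≤ 1 := by
    refine (abs_real_inner_le_norm p w).trans ?_
    rw [hw]; linarith
  have hQ : 0 < ((1 - ‖p‖ ^ 2) ^ 3)⁻¹ := by positivity
  rw [abs_mul (4 * c), abs_mul (inner ℝ p w), abs_of_pos hQ, abs_of_pos (by positivity : 0 < 4 * c)]
  calc 4 * c * (|inner ℝ p w| * ((1 - ‖p‖ ^ 2) ^ 3)⁻¹) ≤ 4 * c * (1 * ((1 - ‖p‖ ^ 2) ^ 3)⁻¹) := by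
        gcongr
    _ = 4 / (1 - ‖p‖ ^ 2) * (c * ((1 - ‖p‖ ^ 2) ^ 2)⁻¹) := by field_simp
    _ ≤ _ := by gcongr

lemma rhs_ge {c : ℝ} (hc : 0 < c) {p : E2} (hp : p ∈ ball (0 : E2) 1) : c ≤ rhs c p := by
  have hq := q_pos hp
  have : 1 ≤ ((1 - ‖p‖ ^ 2) ^ 2)⁻¹ := by
    apply (one_le_inv₀ (by positivity)).2
    apply pow_le_one₀ hq.le
    nlinarith [norm_nonneg p]
  unfold rhs
  nlinarith

lemma rot_det {U : Set E2} (hU : IsOpen U) {v : E2 → ℝ} (hv : ContDiffOn ℝ (⊤ : ℕ∞) v U)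
    {p : E2} (hp : p ∈ U) {x y : ℝ} (hxy : x ^ 2 + y ^ 2 = 1) :
    Dd b0 (Dd b0 v) p * Dd b1 (Dd b1 v) p - Dd b1 (Dd b0 v) p * Dd b1 (Dd b0 v) p ≤
    Dd (x • b0 + y • b1) (Dd (x • b0 + y • b1) v) p *
      Dd ((-y) • b0 + x • b1) (Dd ((-y) • b0 + x • b1) v) p := by
  have hs := Dd_comm hU hv hp b0 b1
  rw [Dd_Dd hU hv hp, Dd_Dd hU hv hp] at hs
  simp only [Dd_Dd hU hv hp, map_add, map_smul, add_apply, smul_apply, smul_eq_mul]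
  rw [hs]
  set α := fderiv ℝ (fderiv ℝ v) p b0 b0
  set β := fderiv ℝ (fderiv ℝ v) p b1 b0
  set γ := fderiv ℝ (fderiv ℝ v) p b1 b1
  have h := sq_nonneg (-x * y * α + (x ^ 2 - y ^ 2) * β + x * y * γ)
  have h2 : α * γ - β * β = (α * γ - β * β) * (x ^ 2 + y ^ 2) ^ 2 := by rw [hxy]; ring
  rw [h2]
  nlinarith

lemma exists_omega {c r T G : ℝ} (hc : 0 < c) (hr : 0 < r) (hT : 0 < T) (hG : 0 < G) :
    ∃ ω : ℝ, 0 < ω ∧ 2 * G * r / 3 < c * r ^ 3 / 54 * ((Real.log (ω + G * T) - Real.log ω) / G) := by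
  set k := 36 * G ^ 2 / (c * r ^ 2) + 1 with hk
  refine ⟨G * T * Real.exp (-k), by positivity, ?_⟩
  have h1 : k ≤ Real.log (G * T * Real.exp (-k) + G * T) - Real.log (G * T * Real.exp (-k)) := by
    rw [Real.log_mul (x := G * T) (by positivity) (Real.exp_pos _).ne', Real.log_exp]
    have : Real.log (G * T) ≤ Real.log (G * T * Real.exp (-k) + G * T) :=
      Real.log_le_log (by positivity) (by linarith [show 0 < G * T * Real.exp (-k) by positivity])
    linarith
  have h2 : 2 * G * r / 3 < c * r ^ 3 / 54 * (k / G) := by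
    have : c * r ^ 3 / 54 * (k / G) = 2 * G * r / 3 + c * r ^ 3 / 54 / G := by
      rw [hk]; field_simp; ring
    rw [this]
    have : 0 < c * r ^ 3 / 54 / G := by positivity
    linarith
  refine h2.trans_le ?_
  gcongr

lemma norm_b0 : ‖b0‖ = 1 := by simp [b0]
lemma norm_b1 : ‖b1‖ = 1 := by simp [b1]

/-- Uniform bound of pure second derivatives on the ball of radius `R = 1 - 4δ`. -/
lemma second_bound {c M₀ δ : ℝ} (hc : 0 < c) (hδ : 0 < δ) :
    ∃ M : ℝ, 0 ≤ M ∧ ∀ u : E2 → ℝ, ContDiffOn ℝ (⊤ : ℕ∞) u (ball (0 : E2) 1) →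
      ConvexOn ℝ (ball (0 : E2) 1) u →
      (∀ p ∈ ball (0 : E2) 1, Dd b0 (Dd b0 u) p * Dd b1 (Dd b1 u) p
        - Dd b1 (Dd b0 u) p * Dd b1 (Dd b0 u) p = rhs c p) →
      (∀ z ∈ ball (0 : E2) 1, |u z| ≤ M₀) →
      ∀ z : E2, ‖z‖ ≤ 1 - 4 * δ → ‖fderiv ℝ u z‖ ≤ M ∧
        Dd b0 (Dd b0 u) z ≤ M ∧ Dd b1 (Dd b1 u) z ≤ M := by
  set G0 : ℝ := ((Real.toNNReal (2 * M₀ / δ) : NNReal) : ℝ) with hG0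
  have hG00 : 0 ≤ G0 := NNReal.coe_nonneg _
  set G : ℝ := 2 * G0 + 1 with hG
  have hGp : 0 < G := by linarith
  obtain ⟨ω, hω, hωk⟩ := exists_omega hc hδ hδ hGp
  set C : ℝ := (3 + 5 * G * (4 / δ) * ω + 2 * G ^ 2) * Real.exp (G ^ 2 / 2) / ω with hC
  have hC0 : 0 ≤ C := by positivity
  refine ⟨G0 + C, by linarith, ?_⟩
  intro u hus huc hueq hub z₀ hz₀
  set U := ball (0 : E2) 1 with hUd
  have hU : IsOpen U := isOpen_ball
  have mem_of : ∀ p : E2, ‖p‖ < 1 - δ → p ∈ U := fun p hp => by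
    simp only [hUd, mem_ball_zero_iff]; linarith
  have hz0U : z₀ ∈ U := mem_of _ (by linarith)
  have hgrad : ∀ p : E2, ‖p‖ < 1 - δ → ‖fderiv ℝ u p‖ ≤ G0 := by
    intro p hp
    have hL := huc.lipschitzOnWith_of_abs_le hδ (fun a ha => hub a ha)
    exact norm_fderiv_le_of_lipschitzOn ℝ (isOpen_ball.mem_nhds (by simpa using hp)) hL
  -- subtract the tangent plane
  set v : E2 → ℝ := fun q => u q - (u z₀ + fderiv ℝ u z₀ (q - z₀)) with hv
  have hℓs : ContDiff ℝ (⊤ : ℕ∞) (fun q : E2 => u z₀ + fderiv ℝ u z₀ (q - z₀)) := by fun_prop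
  have hvs : ContDiffOn ℝ (⊤ : ℕ∞) v U := hus.sub hℓs.contDiffOn
  have hDv : ∀ w : E2, ∀ q ∈ U, Dd w v q = Dd w u q - fderiv ℝ u z₀ w := by
    intro w q hq
    rw [hv, Dd_sub (smooth_diffAt hU hus hq) (hℓs.differentiable (by simp) q)]
    congr 1
    have : HasFDerivAt (fun q : E2 => u z₀ + fderiv ℝ u z₀ (q - z₀)) (fderiv ℝ u z₀) q := by
      have := ((fderiv ℝ u z₀).hasFDerivAt (x := q - z₀)).comp q
        ((hasFDerivAt_id q).sub_const z₀)
      simpa using this.const_add (u z₀)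
    rw [Dd, this.fderiv]
  have hDDv : ∀ w w' : E2, ∀ q ∈ U, Dd w' (Dd w v) q = Dd w' (Dd w u) q := by
    intro w w' q hq
    rw [Dd_congr hU (hDv w) hq, Dd_sub (smooth_diffAt hU (Dd_smooth hU hus w) hq)
      (differentiableAt_const _)]
    simp [Dd]
  have hvc : ConvexOn ℝ U v := by
    refine huc.sub ⟨huc.1, ?_⟩
    intro x _ y _ a b _ _ hab
    have : (a • x + b • y) - z₀ = a • (x - z₀) + b • (y - z₀) := by
      have : z₀ = a • z₀ + b • z₀ := by rw [← add_smul, hab, one_smul]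
      nth_rewrite 1 [this]
      module
    beta_reduce
    rw [this]
    simp only [map_add, map_smul, smul_eq_mul]
    have : u z₀ = (a + b) * u z₀ := by rw [hab, one_mul]
    linarith
  have hvn : ∀ q ∈ U, 0 ≤ v q := by
    intro q hq
    have := tangent_le_s8 huc hz0U hq (smooth_diffAt hU hus hz0U) (w := q - z₀) (t := 1) (by simp)
    simp only [hv]
    simp only [Dd] at this
    linarith
  have hv0 : v z₀ = 0 := by simp [hv]
  have hGv : ∀ w : E2, ‖w‖ = 1 → ∀ p : E2, ‖p‖ < 1 - δ → |Dd w v p| ≤ G := by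
    intro w hw p hp
    rw [hDv w p (mem_of p hp)]
    have h1 : |Dd w u p| ≤ G0 := by
      have := (fderiv ℝ u p).le_opNorm w
      rw [hw, mul_one] at this
      exact this.trans (hgrad p hp)
    have h2 : |fderiv ℝ u z₀ w| ≤ G0 := by
      have := (fderiv ℝ u z₀).le_opNorm w
      rw [hw, mul_one] at this
      exact this.trans (hgrad z₀ (by linarith))
    have := abs_sub (Dd w u p) (fderiv ℝ u z₀ w)
    linarith
  have heq : ∀ p ∈ U, Dd b0 (Dd b0 v) p * Dd b1 (Dd b1 v) p
        - Dd b1 (Dd b0 v) p * Dd b1 (Dd b0 v) p = rhs c p := by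
    intro p hp
    simp only [hDDv _ _ p hp]
    exact hueq p hp
  have hrpos : ∀ p ∈ U, 0 < rhs c p := fun p hp => hc.trans_le (rhs_ge hc hp)
  have hpos0 : ∀ p ∈ U, 0 < Dd b0 (Dd b0 v) p := by
    intro p hp
    refine lt_of_le_of_ne (conv_nonneg hU hvs hvc hp b0) (fun h => ?_)
    have := heq p hp
    rw [← h] at this
    nlinarith [hrpos p hp, sq_nonneg (Dd b1 (Dd b0 v) p)]
  have hpos1 : ∀ p ∈ U, 0 < Dd b1 (Dd b1 v) p := by
    intro p hp
    refine lt_of_le_of_ne (conv_nonneg hU hvs hvc hp b1) (fun h => ?_)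
    have := heq p hp
    rw [← h] at this
    nlinarith [hrpos p hp, sq_nonneg (Dd b1 (Dd b0 v) p)]
  -- strict convexity
  have hstrict : ∀ p ∈ sphere z₀ δ, ω ≤ v p := by
    intro p hp
    by_contra hlt
    push Not at hlt
    have hpd : ‖p - z₀‖ = δ := by rw [← dist_eq_norm]; exact hp
    set e : E2 := δ⁻¹ • (p - z₀) with he
    have hen : ‖e‖ = 1 := by
      rw [he, norm_smul, hpd, norm_inv, Real.norm_of_nonneg hδ.le]; field_simp
    have hpe : p = z₀ + δ • e := by
      rw [he, smul_smul, mul_inv_cancel₀ hδ.ne', one_smul]; abel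
    have hxy : e 0 ^ 2 + e 1 ^ 2 = 1 := by rw [← E2_norm_sq, hen]; norm_num
    have hed := E2_decomp e
    set n : E2 := (-(e 1)) • b0 + (e 0) • b1 with hn
    have hnn : ‖n‖ = 1 := by
      have h1 : ‖n‖ ^ 2 = 1 := by
        rw [E2_norm_sq]
        simp [hn, b0, b1]
        linarith
      nlinarith [norm_nonneg n]
    have hnorm : ∀ x ∈ Set.Icc 0 δ, ∀ y ∈ Set.Icc 0 δ, ‖z₀ + x • e + y • n‖ < 1 - δ := by
      intro x hx y hy
      have h1 := norm_add₃_le (a := z₀) (b := x • e) (c := y • n)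
      rw [norm_smul x e, norm_smul y n, hen, hnn, Real.norm_of_nonneg hx.1, Real.norm_of_nonneg hy.1] at h1
      linarith [hx.2, hy.2]
    have hdet : ∀ q ∈ U, c ≤ Dd e (Dd e v) q * Dd n (Dd n v) q := by
      intro q hq
      have h1 := rot_det hU hvs hq hxy
      rw [heq q hq, ← hed] at h1
      exact (rhs_ge hc hq).trans h1
    have hpU : p ∈ U := by
      have := hnorm δ ⟨hδ.le, le_rfl⟩ 0 ⟨le_rfl, hδ.le⟩
      rw [zero_smul, add_zero, ← hpe] at this
      exact mem_of p this
    have key := strict_conv hU (e := e) (n := n) (z₀ := z₀) hvs hvc hδ hδ hGp hc hω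
      (fun x hx y hy => mem_of _ (hnorm x hx y hy))
      (fun x hx y hy => hvn _ (mem_of _ (hnorm x hx y hy)))
      (fun x hx y hy => hGv n hnn _ (hnorm x hx y hy)) ?_ ?_ hdet
    · exact absurd key (not_le.2 hωk)
    · intro x hx
      have hx1 : x / δ ≤ 1 := (div_le_one hδ).2 hx.2
      have hx0 : 0 ≤ x / δ := div_nonneg hx.1 hδ.le
      have h1 : v ((1 - x / δ) • z₀ + (x / δ) • p) ≤ (1 - x / δ) • v z₀ + (x / δ) • v p :=
        hvc.2 hz0U hpU (by linarith) hx0 (by ring)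
      have h2 : (1 - x / δ) • z₀ + (x / δ) • p = z₀ + x • e := by
        rw [hpe]
        have : (x / δ) • (z₀ + δ • e) = (x / δ) • z₀ + x • e := by
          rw [smul_add, smul_smul, div_mul_cancel₀ _ hδ.ne']
        rw [this, sub_smul, one_smul]; abel
      rw [h2, hv0] at h1
      simp only [smul_eq_mul, mul_zero, zero_add] at h1
      have h3 := hvn p hpU
      nlinarith
    · intro q hq
      refine lt_of_le_of_ne (conv_nonneg hU hvs hvc hq e) (fun h => ?_)
      have := hdet q hq
      rw [← h] at this
      linarith
  have hcb : ∀ p ∈ closedBall z₀ δ, ‖p‖ < 1 - δ := by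
    intro p hp
    have h1 : ‖p - z₀‖ ≤ δ := by rw [← dist_eq_norm]; exact hp
    have h2 := norm_add_le (p - z₀) z₀
    rw [sub_add_cancel] at h2
    linarith
  have P0 := pogorelov hU (e₁ := b0) (e₂ := b1) hvs heq hrpos (fun p hp => Dd_Dd_rhs hc hp b0)
    hpos0 hδ (fun p hp => mem_of p (hcb p hp))
    (fun p hp => Dd_rhs_le hc hδ (hcb p hp).le norm_b0)
    (fun p hp => hGv b0 norm_b0 p (hcb p hp)) hω hv0
    (fun p hp => hvn p (mem_of p (hcb p hp))) hstrict
  have P1 := pogorelov hU (e₁ := b1) (e₂ := b0) hvs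
    (fun p hp => by
      have h1 := heq p hp
      rw [Dd_comm hU hvs hp b0 b1]
      linarith) hrpos (fun p hp => Dd_Dd_rhs hc hp b1)
    hpos1 hδ (fun p hp => mem_of p (hcb p hp))
    (fun p hp => Dd_rhs_le hc hδ (hcb p hp).le norm_b1)
    (fun p hp => hGv b1 norm_b1 p (hcb p hp)) hω hv0
    (fun p hp => hvn p (mem_of p (hcb p hp))) hstrict
  rw [hDDv _ _ _ hz0U] at P0 P1
  have Q0 : Dd b0 (Dd b0 u) z₀ ≤ C := by rw [hC, le_div_iff₀ hω]; linarith
  have Q1 : Dd b1 (Dd b1 u) z₀ ≤ C := by rw [hC, le_div_iff₀ hω]; linarith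
  refine ⟨?_, ?_, ?_⟩
  · have := hgrad z₀ (by linarith)
    linarith
  · linarith
  · linarith

/-- **Lemma 2.14 (interior C² estimate).** A uniformly bounded sequence of smooth convex
solutions of `det D²uₙ(z) = (1/|K|)·(1−|z|²)⁻²` on `𝔻` has uniformly bounded `C²`-norms on
every compact subset of `𝔻`. -/
theorem interior_C2_estimate
    (K : ℝ) (hK : K < 0) (u : ℕ → E2 → ℝ)
    (hus : ∀ n, ContDiffOn ℝ (⊤ : ℕ∞) (u n) (ball (0 : E2) 1))
    (huc : ∀ n, ConvexOn ℝ (ball (0 : E2) 1) (u n))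
    (hueq : ∀ n, ∀ z ∈ ball (0 : E2) 1,
      detHess (u n) z = (1 / |K|) * ((1 - ‖z‖ ^ 2) ^ 2)⁻¹)
    (M₀ : ℝ) (hub : ∀ n, ∀ z ∈ ball (0 : E2) 1, |u n z| ≤ M₀)
    (Ω : Set E2) (hΩc : IsCompact Ω) (hΩs : Ω ⊆ ball (0 : E2) 1) :
    ∃ M : ℝ, ∀ n, ∀ z ∈ Ω,
      |u n z| + ‖gradient (u n) z‖ + ‖fderiv ℝ (fderiv ℝ (u n)) z‖ ≤ M := by
  have hc : 0 < 1 / |K| := by have := abs_pos.2 hK.ne; positivity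
  obtain ⟨R, hR1, hR⟩ : ∃ R < 1, ∀ z ∈ Ω, ‖z‖ ≤ R := by
    rcases Ω.eq_empty_or_nonempty with h | h
    · exact ⟨0, one_pos, by simp [h]⟩
    · obtain ⟨z, hz, hm⟩ := hΩc.exists_isMaxOn h continuous_norm.continuousOn
      exact ⟨‖z‖, by simpa using hΩs hz, fun y hy => hm hy⟩
  obtain ⟨M, hM0, hM⟩ := second_bound (c := 1 / |K|) (M₀ := M₀) (δ := (1 - R) / 4) hc (by linarith)
  refine ⟨M₀ + M + 4 * M, ?_⟩
  intro n z hz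
  have hzU := hΩs hz
  have hU : IsOpen (ball (0 : E2) 1) := isOpen_ball
  have heq : ∀ p ∈ ball (0 : E2) 1, Dd b0 (Dd b0 (u n)) p * Dd b1 (Dd b1 (u n)) p
        - Dd b1 (Dd b0 (u n)) p * Dd b1 (Dd b0 (u n)) p = rhs (1 / |K|) p := by
    intro p hp
    have h := hueq n p hp
    have hs := Dd_comm hU (hus n) hp b0 b1
    nth_rewrite 1 [← hs]
    simp only [Dd_Dd hU (hus n) hp]
    exact h
  obtain ⟨g1, g2, g3⟩ := hM (u n) (hus n) (huc n) heq (hub n) z (by linarith [hR z hz])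
  have n0 := conv_nonneg hU (hus n) (huc n) hzU b0
  have n1 := conv_nonneg hU (hus n) (huc n) hzU b1
  have hdet := heq z hzU
  have hr : 0 < rhs (1 / |K|) z := hc.trans_le (rhs_ge hc hzU)
  have hs := Dd_comm hU (hus n) hzU b0 b1
  have hb : |Dd b1 (Dd b0 (u n)) z| ≤ M := by
    apply abs_le_of_sq_le_sq _ hM0
    have : Dd b0 (Dd b0 (u n)) z * Dd b1 (Dd b1 (u n)) z ≤ M * M := mul_le_mul g2 g3 n1 hM0
    nlinarith
  simp only [Dd_Dd hU (hus n) hzU] at n0 n1 hb g2 g3 hs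
  have hgr : ‖gradient (u n) z‖ ≤ M := by
    unfold gradient
    rw [LinearIsometryEquiv.norm_map]
    exact g1
  have hop : ‖fderiv ℝ (fderiv ℝ (u n)) z‖ ≤ 4 * M := by
    refine ContinuousLinearMap.opNorm_le_bound₂ _ (by linarith) ?_
    intro x y
    have hx := E2_decomp x
    have hy := E2_decomp y
    have x0 : |x 0| ≤ ‖x‖ := by simpa using PiLp.norm_apply_le x 0
    have x1 : |x 1| ≤ ‖x‖ := by simpa using PiLp.norm_apply_le x 1
    have y0 : |y 0| ≤ ‖y‖ := by simpa using PiLp.norm_apply_le y 0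
    have y1 : |y 1| ≤ ‖y‖ := by simpa using PiLp.norm_apply_le y 1
    have hB : fderiv ℝ (fderiv ℝ (u n)) z x y =
        x 0 * y 0 * fderiv ℝ (fderiv ℝ (u n)) z b0 b0 + x 0 * y 1 * fderiv ℝ (fderiv ℝ (u n)) z b1 b0
        + x 1 * y 0 * fderiv ℝ (fderiv ℝ (u n)) z b1 b0
        + x 1 * y 1 * fderiv ℝ (fderiv ℝ (u n)) z b1 b1 := by
      conv_lhs => rw [hx, hy]
      simp only [map_add, map_smul, add_apply, smul_apply, smul_eq_mul]
      rw [hs]; ring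
    have hterm : ∀ s t B : ℝ, |s| ≤ ‖x‖ → |t| ≤ ‖y‖ → |B| ≤ M → |s * t * B| ≤ ‖x‖ * ‖y‖ * M := by
      intro s t B h1 h2 h3
      rw [abs_mul, abs_mul]
      gcongr
    have t1 := hterm _ _ _ x0 y0 (abs_le.2 ⟨by linarith, g2⟩)
    have t2 := hterm _ _ _ x0 y1 hb
    have t3 := hterm _ _ _ x1 y0 hb
    have t4 := hterm _ _ _ x1 y1 (abs_le.2 ⟨by linarith, g3⟩)
    rw [hB, Real.norm_eq_abs]
    refine (abs_add_le _ _).trans ?_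
    have a1 := abs_add_le (x 0 * y 0 * fderiv ℝ (fderiv ℝ (u n)) z b0 b0
      + x 0 * y 1 * fderiv ℝ (fderiv ℝ (u n)) z b1 b0) (x 1 * y 0 * fderiv ℝ (fderiv ℝ (u n)) z b1 b0)
    have a2 := abs_add_le (x 0 * y 0 * fderiv ℝ (fderiv ℝ (u n)) z b0 b0)
      (x 0 * y 1 * fderiv ℝ (fderiv ℝ (u n)) z b1 b0)
    linarith
  have := hub n z hzU
  linarith
end
end

section
/- Let f : ℝ² → ℝ be a convex function such that for every x ∈ ℝ² there exist a nonzero vector v ∈ ℝ², a real number α, and ε > 0 with f(x + tv) = f(x) + αt for all t ∈ (−ε, ε) (i.e. every point lies in the interior of a segment on which f is affine). Then there exist x₀ ∈ ℝ², a nonzero vector v ∈ ℝ², and α ∈ ℝ such that f(x₀ + tv) = f(x₀) + αt for every t ∈ ℝ; that is, f is affine along an entire line of ℝ². -/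
open Metric Filter
open scoped RealInnerProductSpace Topology

noncomputable section

lemma aux_decomp (v w : E2) (hv : v ≠ 0) :
    (∃ k : ℝ, w = k • v) ∨ ∀ u : E2, ∃ a b : ℝ, u = a • v + b • w := by
  by_cases hD : v 0 * w 1 - v 1 * w 0 = 0
  · left
    by_cases h0 : v 0 = 0
    · have h1 : v 1 ≠ 0 := by
        intro h1
        apply hv
        ext i
        fin_cases i <;> simp [h0, h1]
      refine ⟨w 1 / v 1, ?_⟩
      have hw0 : w 0 = 0 := by
        rw [h0] at hD
        have : v 1 * w 0 = 0 := by linarith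
        exact (mul_eq_zero.mp this).resolve_left h1
      ext i
      fin_cases i
      · simp [h0, hw0]
      · simp [h1]
    · refine ⟨w 0 / v 0, ?_⟩
      ext i
      fin_cases i
      · simp [h0]
      · simp
        field_simp
        linarith
  · right
    intro u
    refine ⟨(u 0 * w 1 - u 1 * w 0) / (v 0 * w 1 - v 1 * w 0),
      (v 0 * u 1 - v 1 * u 0) / (v 0 * w 1 - v 1 * w 0), ?_⟩
    ext i
    fin_cases i
    · simp
      rw [div_mul_eq_mul_div, div_mul_eq_mul_div, ← add_div, eq_div_iff hD]
      ring
    · simp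
      rw [div_mul_eq_mul_div, div_mul_eq_mul_div, ← add_div, eq_div_iff hD]
      ring

lemma aux_endpoint (K : Set E2) (hc : Convex ℝ K) (hcl : IsClosed K) (x v : E2) (hx : x ∈ K)
    (h : ¬ ∀ t : ℝ, x + t • v ∈ K) :
    ∃ (σ s : ℝ), (σ = 1 ∨ σ = -1) ∧ 0 ≤ s ∧ x + s • (σ • v) ∈ K ∧
      ∀ t > s, x + t • (σ • v) ∉ K := by
  push Not at h
  obtain ⟨t₀, ht₀⟩ := h
  obtain ⟨σ, hσ, hT⟩ : ∃ σ : ℝ, (σ = 1 ∨ σ = -1) ∧ x + |t₀| • (σ • v) ∉ K := by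
    rcases le_total 0 t₀ with h | h
    · exact ⟨1, Or.inl rfl, by simpa [abs_of_nonneg h] using ht₀⟩
    · exact ⟨-1, Or.inr rfl, by simpa [abs_of_nonpos h] using ht₀⟩
  set w := σ • v
  let S : Set ℝ := {s | 0 ≤ s ∧ x + s • w ∈ K}
  have hS0 : (0 : ℝ) ∈ S := ⟨le_rfl, by simpa using hx⟩
  have hSb : ∀ s ∈ S, s ≤ |t₀| := by
    rintro s ⟨hs0, hs⟩
    by_contra hlt
    push Not at hlt
    apply hT
    have hspos : 0 < s := lt_of_le_of_lt (abs_nonneg _) hlt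
    have := hc hx hs (a := 1 - |t₀| / s) (b := |t₀| / s)
      (by rw [sub_nonneg, div_le_one hspos]; exact hlt.le) (by positivity) (by ring)
    convert this using 1
    have e : (|t₀| / s) • s • w = |t₀| • w := by
      rw [smul_smul, div_mul_cancel₀ _ hspos.ne']
    rw [smul_add, e]
    module
  have hSc : IsClosed S := by
    apply IsClosed.inter (isClosed_Ici (a := (0 : ℝ)))
    exact hcl.preimage (by fun_prop : Continuous fun s : ℝ => x + s • w)
  have hbdd : BddAbove S := ⟨_, hSb⟩
  have hmem := hSc.csSup_mem ⟨0, hS0⟩ hbdd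
  refine ⟨σ, sSup S, hσ, hmem.1, hmem.2, ?_⟩
  intro t ht hK
  have : t ∈ S := ⟨hmem.1.trans ht.le, hK⟩
  exact absurd (le_csSup hbdd this) (not_le.mpr ht)

lemma aux_line (K : Set E2) (hc : Convex ℝ K) (hcl : IsClosed K) (x : E2) (hx : x ∈ K)
    (hK : ∀ x ∈ K, ∃ (v : E2) (ε : ℝ), v ≠ 0 ∧ 0 < ε ∧ ∀ t : ℝ, |t| < ε → x + t • v ∈ K) :
    ∃ x v : E2, v ≠ 0 ∧ ∀ t : ℝ, x + t • v ∈ K := by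
  by_contra hno
  push Not at hno
  obtain ⟨v₀, -, hv₀, -, -⟩ := hK x hx
  obtain ⟨σ, s₀, hσ, -, hy, hyend⟩ := aux_endpoint K hc hcl x v₀ hx
    (by simpa using hno x v₀ hv₀)
  set v := σ • v₀ with hvdef
  have hv : v ≠ 0 := by
    apply smul_ne_zero _ hv₀
    rcases hσ with h | h <;> rw [h] <;> norm_num
  set y := x + s₀ • v with hydef
  have hyend' : ∀ t > (0 : ℝ), y + t • v ∉ K := by
    intro t ht h
    apply hyend (s₀ + t) (by linarith)
    convert h using 1
    rw [hydef]
    module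
  obtain ⟨w₀, η, hw₀, hη, hyw₀⟩ := hK y hy
  obtain ⟨σ', s, hσ', hs0, hz, hzend⟩ := aux_endpoint K hc hcl y w₀ hy
    (by simpa using hno y w₀ hw₀)
  have habs : |σ'| = 1 := by rcases hσ' with h | h <;> rw [h] <;> norm_num
  set w := σ' • w₀ with hwdef
  have hw : w ≠ 0 := by
    apply smul_ne_zero _ hw₀
    rcases hσ' with h | h <;> rw [h] <;> norm_num
  have hyw : ∀ t : ℝ, |t| < η → y + t • w ∈ K := by
    intro t ht
    have := hyw₀ (t * σ') (by rw [abs_mul, habs, mul_one]; exact ht)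
    rwa [← smul_smul] at this
  have hs : 0 < s := by
    by_contra hle
    exact hzend (η / 2) (by linarith) (hyw _ (by rw [abs_of_pos (by positivity)]; linarith))
  obtain ⟨u, ε, hu, hε, hzu⟩ := hK _ hz
  -- helper for sign selection
  have sgn : ∀ (a m : ℝ), a ≠ 0 → 0 < m → ∃ t, |t| = m ∧ 0 < t * a := by
    intro a m ha hm
    rcases lt_or_gt_of_ne ha with h | h
    · exact ⟨-m, by rw [abs_neg, abs_of_pos hm], by nlinarith⟩
    · exact ⟨m, abs_of_pos hm, by positivity⟩
  rcases aux_decomp v w hv with ⟨k, hk⟩ | hdec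
  · have hk0 : k ≠ 0 := by
      rintro rfl
      exact hw (by simpa using hk)
    obtain ⟨t, ht, hta⟩ := sgn k (η / 2) hk0 (by positivity)
    have := hyw t (by rw [ht]; linarith)
    rw [hk, smul_smul] at this
    exact hyend' _ hta this
  · obtain ⟨a, b, hab⟩ := hdec u
    have ha : a ≠ 0 := by
      rintro rfl
      have hb : b ≠ 0 := by
        rintro rfl
        exact hu (by simpa using hab)
      obtain ⟨t, ht, hta⟩ := sgn b (ε / 2) hb (by positivity)
      have := hzu t (by rw [ht]; linarith)
      apply hzend (s + t * b) (by linarith)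
      convert this using 1
      rw [hab]
      module
    obtain ⟨t, ht, hta⟩ := sgn a (min (ε / 2) (s / (|b| + 1))) ha (by positivity)
    have hP := hzu t (by
      rw [ht]
      exact lt_of_le_of_lt (min_le_left _ _) (by linarith))
    have htb : 0 < s + t * b := by
      have h1 : |t| ≤ s / (|b| + 1) := by rw [ht]; exact min_le_right _ _
      rw [le_div_iff₀ (by positivity)] at h1
      have h2 : 0 < |t| := by rw [ht]; positivity
      have h3 := neg_abs_le (t * b)
      rw [abs_mul] at h3
      nlinarith
    have hQ := hyw (-(η / 2)) (by rw [abs_neg, abs_of_pos (by positivity)]; linarith)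
    set c := s + t * b with hcdef
    have hd : 0 < η / 2 + c := by positivity
    have := hc hP hQ (a := (η / 2) / (η / 2 + c)) (b := c / (η / 2 + c))
      (by positivity) (by positivity) (by field_simp)
    apply hyend' ((η / 2) / (η / 2 + c) * (t * a)) (by positivity)
    convert this using 1
    have e1 : y + s • w + t • u = y + c • w + (t * a) • v := by
      rw [hab, hcdef]
      module
    rw [e1]
    clear_value y c v w
    match_scalars <;> field_simp <;> ring

lemma aux_subgrad (f : E2 → ℝ) (hf : ConvexOn ℝ Set.univ f) :
    ∃ l : E2 →L[ℝ] ℝ, ∀ y, f 0 + l y ≤ f y := by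
  have hcont : Continuous f := by
    rw [← continuousOn_univ]
    exact hf.continuousOn isOpen_univ
  have hconv := hf.convex_strict_epigraph
  have hopen : IsOpen {p : E2 × ℝ | p.1 ∈ Set.univ ∧ f p.1 < p.2} := by
    simp only [Set.mem_univ, true_and]
    exact isOpen_lt (by fun_prop) (by fun_prop)
  obtain ⟨L, hL⟩ := geometric_hahn_banach_open_point hconv hopen
    (x := ((0 : E2), f 0)) (by simp)
  have hdec : ∀ (y : E2) (r : ℝ), L (y, r) = L (y, 0) + r * L (0, 1) := by
    intro y r
    have : ((y, r) : E2 × ℝ) = (y, 0) + r • ((0 : E2), (1 : ℝ)) := by simp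
    rw [this, map_add, map_smul, smul_eq_mul]
  set c := L (0, 1) with hcdef
  have hc : c < 0 := by
    have := hL (0, f 0 + 1) (by simp)
    rw [hdec 0 (f 0 + 1), hdec 0 (f 0)] at this
    linarith
  have h00 : L ((0 : E2), (0 : ℝ)) = 0 := map_zero L
  have key : ∀ y, L (y, 0) + f y * c ≤ f 0 * c := by
    intro y
    apply le_of_forall_pos_le_add
    intro e he
    have := hL (y, f y + e / (-c)) (by
      have : 0 < e / (-c) := div_pos he (by linarith)
      simpa using this)
    rw [hdec y, hdec 0 (f 0), h00] at this
    have h2 : e / (-c) * c = -e := by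
      rw [div_neg, neg_mul, div_mul_cancel₀ _ hc.ne]
    nlinarith
  refine ⟨(-c)⁻¹ • L.comp (ContinuousLinearMap.inl ℝ E2 ℝ), fun y => ?_⟩
  have := key y
  simp only [smul_apply, ContinuousLinearMap.comp_apply,
    ContinuousLinearMap.inl_apply, smul_eq_mul]
  have hc' : 0 < -c := by linarith
  rw [inv_mul_eq_div, ← le_sub_iff_add_le', div_le_iff₀ hc']
  linarith

/-- **Lemma 4.3.** A convex function `f : ℝ² → ℝ` which, at every point, is affine on some
nontrivial segment through that point, must be affine along an entire line. -/
theorem convex_locally_affine_implies_affine_on_line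
    (f : E2 → ℝ) (hf : ConvexOn ℝ Set.univ f)
    (hloc : ∀ x : E2, ∃ (v : E2) (α ε : ℝ), v ≠ 0 ∧ 0 < ε ∧
      ∀ t : ℝ, |t| < ε → f (x + t • v) = f x + α * t) :
    ∃ (x₀ v : E2) (α : ℝ), v ≠ 0 ∧
      ∀ t : ℝ, f (x₀ + t • v) = f x₀ + α * t := by
  obtain ⟨l, hl⟩ := aux_subgrad f hf
  have hcont : Continuous f := by
    rw [← continuousOn_univ]
    exact hf.continuousOn isOpen_univ
  let K : Set E2 := {y | f y ≤ f 0 + l y}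
  have hc : Convex ℝ K := by
    intro y hy z hz a b ha hb hab
    have h1 := hf.2 (Set.mem_univ y) (Set.mem_univ z) ha hb hab
    have hy' : f y ≤ f 0 + l y := hy
    have hz' : f z ≤ f 0 + l z := hz
    change f (a • y + b • z) ≤ f 0 + l (a • y + b • z)
    simp only [map_add, map_smul, smul_eq_mul] at h1 ⊢
    have h2 := mul_le_mul_of_nonneg_left hy' ha
    have h3 := mul_le_mul_of_nonneg_left hz' hb
    have h4 : a * f 0 + b * f 0 = f 0 := by rw [← add_mul, hab, one_mul]
    linarith
  have hcl : IsClosed K := isClosed_le hcont (by fun_prop)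
  obtain ⟨x, v, hv, hline⟩ := aux_line K hc hcl 0 (by simp [K]) (by
    intro x hx
    obtain ⟨v, α, ε, hv, hε, h⟩ := hloc x
    refine ⟨v, ε, hv, hε, fun t ht => ?_⟩
    have hx' : f x ≤ f 0 + l x := hx
    have h1 := h t ht
    have h2 := h (-t) (by rwa [abs_neg])
    have h3 := hl (x + (-t) • v)
    change f (x + t • v) ≤ f 0 + l (x + t • v)
    simp only [map_add, map_smul, smul_eq_mul] at h3 ⊢
    linarith)
  have heq : ∀ t : ℝ, f (x + t • v) = f 0 + l (x + t • v) :=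
    fun t => le_antisymm (hline t) (hl _)
  refine ⟨x, v, l v, hv, fun t => ?_⟩
  have h0 := heq 0
  rw [zero_smul, add_zero] at h0
  rw [heq t, h0, map_add, map_smul, smul_eq_mul]
  ring
end
end

section
/- Let f : ℝ² → ℝ be convex and 1-Lipschitz (so that its graph is the boundary of a future-convex domain in Minkowski space), let z ∈ ℝ² with ‖z‖ = 1, and suppose u(z) := sup_{p∈ℝ²}(⟨p, z⟩ − f(p)) is finite. Then lim_{r→+∞}(r − f(rz)) = u(z). -/
open Metric Filter
open scoped RealInnerProductSpace Topology

noncomputable section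

/-- **Section 2.3.** If `f : ℝ² → ℝ` is convex and `1`-Lipschitz and `z` is a unit vector for
which the support function value `u(z) = sup_p (⟨p,z⟩ − f(p))` is finite, then
`lim_{r→∞} (r − f(rz)) = u(z)`. -/
theorem limit_along_rays_eq_support_function
    (f : E2 → ℝ) (hconv : ConvexOn ℝ Set.univ f) (hlip : LipschitzWith 1 f)
    (z : E2) (hz : ‖z‖ = 1)
    (hbdd : BddAbove (Set.range fun p : E2 => ⟪p, z⟫ - f p)) :
    Tendsto (fun r : ℝ => r - f (r • z)) atTop
      (𝓝 (⨆ p : E2, (⟪p, z⟫ - f p))) := by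
  have hzz : (⟪z, z⟫ : ℝ) = 1 := by
    rw [real_inner_self_eq_norm_sq, hz]; norm_num
  rw [tendsto_order]
  constructor
  · intro b hb
    obtain ⟨p, hp⟩ := exists_lt_of_lt_ciSup hb
    set a : ℝ := ⟪p, z⟫ with ha
    obtain ⟨ε, hε, hεb⟩ : ∃ ε : ℝ, 0 < ε ∧ b + ε < a - f p :=
      ⟨(a - f p - b) / 2, by linarith, by linarith⟩
    filter_upwards [eventually_ge_atTop (a + ‖p‖ ^ 2 / (2 * ε))] with r hr
    have h1 : ‖p‖ ^ 2 ≤ 2 * ε * (r - a) := by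
      have h : ‖p‖ ^ 2 / (2 * ε) ≤ r - a := by linarith
      rw [div_le_iff₀ (by positivity)] at h
      linarith
    have h2 : 0 ≤ r - a := by
      have : 0 ≤ ‖p‖ ^ 2 / (2 * ε) := by positivity
      linarith
    have h3 : ‖r • z - p‖ ^ 2 = r ^ 2 - 2 * (r * a) + ‖p‖ ^ 2 := by
      rw [norm_sub_sq_real, norm_smul, hz, real_inner_smul_left, real_inner_comm, ← ha]
      simp
    have h4 : ‖r • z - p‖ ≤ r - a + ε := by
      refine abs_le_of_sq_le_sq' ?_ (by linarith) |>.2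
      rw [h3]
      nlinarith [sq_nonneg a, sq_nonneg ε]
    have h5 := hlip.dist_le_mul (r • z) p
    rw [Real.dist_eq, dist_eq_norm, NNReal.coe_one, one_mul] at h5
    have h6 := le_abs_self (f (r • z) - f p)
    linarith
  · intro b hb
    refine Eventually.of_forall fun r => lt_of_le_of_lt ?_ hb
    have h := le_ciSup hbdd (r • z)
    simp only [real_inner_smul_left, hzz, mul_one] at h
    exact h
end
end

section
/- For each n ∈ ℕ and for n = ∞, let fₙ : ℝ² → ℝ be a convex C¹ function with ‖∇fₙ(p)‖ < 1 for all p ∈ ℝ² (so its graph is a spacelike entire graph), and suppose that the associated support functions uₙ : 𝔻 → ℝ, defined by uₙ(z) = sup_{p∈ℝ²}(⟨p, z⟩ − fₙ(p)), are finite-valued and C¹ on 𝔻. If uₙ converges to u_∞ uniformly on compact subsets of 𝔻, then fₙ converges to f_∞ uniformly on compact subsets of ℝ². -/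
open Metric Filter
open scoped RealInnerProductSpace Topology

noncomputable section

/-- The support function on the Klein disc `𝔻` of the spacelike entire graph of `f`. -/
def suppFn (f : E2 → ℝ) (z : E2) : ℝ := ⨆ p : E2, (⟪p, z⟫ - f p)

lemma aux_tangent (g : E2 → ℝ) (hg : Differentiable ℝ g) (hc : ConvexOn ℝ Set.univ g) (p q : E2) :
    g p + ⟪gradient g p, q - p⟫ ≤ g q := by
  have h1 : ConvexOn ℝ Set.univ (fun t : ℝ => g (AffineMap.lineMap p q t)) := by
    have := hc.comp_affineMap (AffineMap.lineMap (k := ℝ) p q)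
    simpa [Function.comp_def] using this
  have h2 : HasDerivAt (fun t : ℝ => g (AffineMap.lineMap p q t)) (⟪gradient g p, q - p⟫) 0 := by
    have hl : HasDerivAt (fun t : ℝ => (AffineMap.lineMap p q t : E2)) (q - p) 0 :=
      AffineMap.hasDerivAt_lineMap
    have hgr : HasFDerivAt g (InnerProductSpace.toDual ℝ E2 (gradient g p))
        (AffineMap.lineMap p q (0 : ℝ)) := by
      rw [AffineMap.lineMap_apply_zero]
      exact (hg p).hasGradientAt.hasFDerivAt
    have := hgr.comp_hasDerivAt (0 : ℝ) hl
    simpa [Function.comp_def] using this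
  have h3 := h1.le_slope_of_hasDerivAt (Set.mem_univ 0) (Set.mem_univ 1) one_pos h2
  simp only [slope_def_field, AffineMap.lineMap_apply_zero, AffineMap.lineMap_apply_one, sub_zero,
    div_one] at h3
  linarith

lemma aux_lip (f : E2 → ℝ) (hd : Differentiable ℝ f) (hb : ∀ p, ‖gradient f p‖ < 1) (p q : E2) :
    |f p - f q| ≤ ‖p - q‖ := by
  have := convex_univ.norm_image_sub_le_of_norm_fderiv_le (𝕜 := ℝ) (f := f) (C := 1) (s := Set.univ)
    (fun x _ => hd x) (fun x _ => by
      have h := (hb x).le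
      rwa [gradient, LinearIsometryEquiv.norm_map] at h) (Set.mem_univ q) (Set.mem_univ p)
  simpa using this

lemma aux_young (f : E2 → ℝ) (z : E2)
    (hb : BddAbove (Set.range fun p : E2 => ⟪p, z⟫ - f p)) (p : E2) :
    ⟪p, z⟫ - f p ≤ suppFn f z := le_ciSup hb p

lemma aux_pointwise (f : ℕ → E2 → ℝ) (g : E2 → ℝ)
    (hf : ∀ n, ∀ p q, |f n p - f n q| ≤ ‖p - q‖)
    (hgd : Differentiable ℝ g) (hgc : ConvexOn ℝ Set.univ g) (hgb : ∀ p : E2, ‖gradient g p‖ < 1)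
    (hffin : ∀ n, ∀ z ∈ ball (0 : E2) 1,
      BddAbove (Set.range fun p : E2 => ⟪p, z⟫ - f n p))
    (hgfin : ∀ z ∈ ball (0 : E2) 1,
      BddAbove (Set.range fun p : E2 => ⟪p, z⟫ - g p))
    (hgC1 : ContDiffOn ℝ 1 (suppFn g) (ball (0 : E2) 1))
    (hconv : ∀ Ω : Set E2, IsCompact Ω → Ω ⊆ ball (0 : E2) 1 →
      TendstoUniformlyOn (fun n => suppFn (f n)) (suppFn g) atTop Ω) (p : E2) (ε : ℝ) (hε : 0 < ε) :
    ∀ᶠ n in atTop, |f n p - g p| ≤ 10 * ε := by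
  set z := gradient g p with hz
  have hzb : z ∈ ball (0 : E2) 1 := by simpa using hgb p
  have hnh : ball (0 : E2) 1 ∈ 𝓝 z := isOpen_ball.mem_nhds hzb
  have huz : suppFn g z = ⟪p, z⟫ - g p := by
    apply le_antisymm _ (aux_young g z (hgfin z hzb) p)
    apply ciSup_le
    intro q
    have h := aux_tangent g hgd hgc p q
    rw [← hz, inner_sub_right] at h
    have a1 := real_inner_comm z q
    have a2 := real_inner_comm z p
    linarith
  have hud : DifferentiableAt ℝ (suppFn g) z := (hgC1.contDiffAt hnh).differentiableAt (by simp)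
  have hder : HasFDerivAt (suppFn g) (innerSL ℝ p) z := by
    have hmin : IsLocalMin (fun w => suppFn g w - innerSL ℝ p w) z := by
      filter_upwards [hnh] with w hw
      have := aux_young g w (hgfin w hw) p
      simp only [innerSL_apply_apply]
      linarith
    have h0 := hmin.hasFDerivAt_eq_zero (hud.hasFDerivAt.sub (innerSL ℝ p).hasFDerivAt)
    rw [← sub_eq_zero.mp h0]
    exact hud.hasFDerivAt
  have hlo := (hasFDerivAt_iff_isLittleO.mp hder).def hε
  obtain ⟨r, hr, hr'⟩ := Metric.eventually_nhds_iff.mp (hlo.and hnh)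
  set δ := min (r / 2) 1 with hδ
  have hδ0 : 0 < δ := by positivity
  have hδ1 : δ ≤ 1 := min_le_right _ _
  have hδr : δ < r := by have := min_le_left (r / 2) 1; linarith
  have hsub : closedBall z δ ⊆ ball (0 : E2) 1 := fun w hw =>
    (hr' (lt_of_le_of_lt (mem_closedBall.mp hw) hδr)).2
  have hη : 0 < ε * δ := by positivity
  have hηε : ε * δ ≤ ε := by nlinarith
  have hU := Metric.tendstoUniformlyOn_iff.mp (hconv _ (isCompact_closedBall z δ) hsub) _ hη
  filter_upwards [hU] with n hn
  have hn' : ∀ w ∈ closedBall z δ, |suppFn g w - suppFn (f n) w| < ε * δ := fun w hw => by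
    simpa [Real.dist_eq] using hn w hw
  obtain ⟨q, hq⟩ : ∃ q, suppFn (f n) z - ε * δ < ⟪q, z⟫ - f n q :=
    exists_lt_of_lt_ciSup (by show _ < suppFn (f n) z; linarith)
  have hqu := aux_young (f n) z (hffin n z hzb) q
  have hnz := abs_lt.mp (hn' z (mem_closedBall_self hδ0.le))
  have hqp : ‖q - p‖ ≤ 4 * ε := by
    rcases eq_or_ne q p with h | h
    · simp [h]; positivity
    have hd : 0 < ‖q - p‖ := norm_pos_iff.mpr (sub_ne_zero.mpr h)
    set w := z + (δ / ‖q - p‖) • (q - p) with hw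
    have hwz : w - z = (δ / ‖q - p‖) • (q - p) := by simp [hw]
    have hwn : ‖w - z‖ = δ := by
      rw [hwz, norm_smul, Real.norm_of_nonneg (by positivity)]; field_simp
    have hwb : w ∈ closedBall z δ := by rw [mem_closedBall, dist_eq_norm, hwn]
    have hnw := abs_lt.mp (hn' w hwb)
    have hqw := aux_young (f n) w (hffin n w (hsub hwb)) q
    have hl := (hr' (lt_of_le_of_lt (mem_closedBall.mp hwb) hδr)).1
    rw [hwn, Real.norm_eq_abs, innerSL_apply_apply] at hl
    have hl' := (abs_le.mp hl).2
    have e1 : ⟪q, w - z⟫ - ⟪p, w - z⟫ = δ * ‖q - p‖ := by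
      rw [← inner_sub_left, hwz, inner_smul_right, real_inner_self_eq_norm_sq]; field_simp
    have e2 : ⟪q, w - z⟫ = ⟪q, w⟫ - ⟪q, z⟫ := inner_sub_right _ _ _
    have : δ * ‖q - p‖ ≤ δ * (4 * ε) := by linarith
    exact le_of_mul_le_mul_left this hδ0
  have hL := abs_le.mp (hf n p q)
  rw [norm_sub_rev] at hL
  have hI : |⟪q - p, z⟫| ≤ ‖q - p‖ := by
    refine (abs_real_inner_le_norm _ _).trans ?_
    have := (hgb p).le
    rw [← hz] at this
    nlinarith [norm_nonneg (q - p)]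
  rw [inner_sub_left] at hI
  have hI' := abs_le.mp hI
  rw [abs_le]
  constructor <;> linarith

/-- **Lemma 4.2.** If the (finite-valued, `C¹`) support functions of a sequence of spacelike
entire graphs converge uniformly on compact subsets of `𝔻`, then the graph functions converge
uniformly on compact subsets of `ℝ²`. -/
theorem convergence_support_functions_implies_convergence_graphs
    (f : ℕ → E2 → ℝ) (g : E2 → ℝ)
    (hfc : ∀ n, ContDiff ℝ 1 (f n) ∧ ConvexOn ℝ Set.univ (f n) ∧
      ∀ p : E2, ‖gradient (f n) p‖ < 1)
    (hgc : ContDiff ℝ 1 g ∧ ConvexOn ℝ Set.univ g ∧ ∀ p : E2, ‖gradient g p‖ < 1)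
    (hffin : ∀ n, ∀ z ∈ ball (0 : E2) 1,
      BddAbove (Set.range fun p : E2 => ⟪p, z⟫ - f n p))
    (hgfin : ∀ z ∈ ball (0 : E2) 1,
      BddAbove (Set.range fun p : E2 => ⟪p, z⟫ - g p))
    (hfC1 : ∀ n, ContDiffOn ℝ 1 (suppFn (f n)) (ball (0 : E2) 1))
    (hgC1 : ContDiffOn ℝ 1 (suppFn g) (ball (0 : E2) 1))
    (hconv : ∀ Ω : Set E2, IsCompact Ω → Ω ⊆ ball (0 : E2) 1 →
      TendstoUniformlyOn (fun n => suppFn (f n)) (suppFn g) atTop Ω) :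
    ∀ Ω : Set E2, IsCompact Ω → TendstoUniformlyOn f g atTop Ω := by
  have hlf := fun n => aux_lip (f n) ((hfc n).1.differentiable (by simp)) (hfc n).2.2
  have hgd : Differentiable ℝ g := hgc.1.differentiable (by simp)
  have hlg := aux_lip g hgd hgc.2.2
  intro Ω hΩ
  rw [← tendstoLocallyUniformlyOn_iff_tendstoUniformlyOn_of_compact hΩ,
    Metric.tendstoLocallyUniformlyOn_iff]
  intro ε hε x _
  refine ⟨ball x (ε / 4), mem_nhdsWithin_of_mem_nhds (ball_mem_nhds x (by positivity)), ?_⟩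
  filter_upwards [aux_pointwise f g hlf hgd hgc.2.1 hgc.2.2 hffin hgfin hgC1 hconv x (ε / 40)
    (by positivity)] with n hn y hy
  rw [mem_ball, dist_eq_norm] at hy
  have h1 := abs_le.mp (hlf n y x)
  have h2 := abs_le.mp (hlg y x)
  have h3 := abs_le.mp hn
  rw [Real.dist_eq, abs_lt]
  constructor <;> linarith
end
end

section
/- Let u : 𝔻 → ℝ be a C² function whose Hessian D²u(z) is positive definite at every z ∈ 𝔻, and define Φ : 𝔻 → ℝ³ by Φ(z) = (∇u(z), ⟨z, ∇u(z)⟩ − u(z)). If Φ is proper (preimages of compact sets are compact), then ∇u(𝔻) = ℝ²; equivalently, the boundary of the future-convex domain in Minkowski space defined by the support function u is a spacelike entire graph. -/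
open Metric Filter
open scoped RealInnerProductSpace Topology

noncomputable section

set_option maxHeartbeats 1000000 in
/-- First-order convexity inequality for `u` on the disc. -/
lemma convex_ineq_aux (u : E2 → ℝ) (hu : ContDiffOn ℝ 2 u (ball (0 : E2) 1))
    (hpd : ∀ z ∈ ball (0 : E2) 1, ∀ v : E2, v ≠ 0 → 0 < hess u z v v)
    {x y : E2} (hx : x ∈ ball (0 : E2) 1) (hy : y ∈ ball (0 : E2) 1) :
    u x + fderiv ℝ u x (y - x) ≤ u y := by
  have hseg : ∀ t ∈ Set.Icc (0 : ℝ) 1, x + t • (y - x) ∈ ball (0 : E2) 1 := fun t ht =>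
    (convex_ball (0 : E2) 1).add_smul_sub_mem hx hy ht
  have hline : ∀ t : ℝ, HasDerivAt (fun t : ℝ => x + t • (y - x)) (y - x) t := fun t => by
    simpa using ((hasDerivAt_id t).smul_const (y - x)).const_add x
  have hcd : ∀ z ∈ ball (0 : E2) 1, ContDiffAt ℝ 2 u z := fun z hz =>
    hu.contDiffAt (isOpen_ball.mem_nhds hz)
  have h1 : ∀ t ∈ Set.Icc (0 : ℝ) 1, HasDerivAt (fun t : ℝ => u (x + t • (y - x)))
      (fderiv ℝ u (x + t • (y - x)) (y - x)) t := fun t ht =>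
    (((hcd _ (hseg t ht)).differentiableAt (by norm_num)).hasFDerivAt).comp_hasDerivAt t (hline t)
  have h2 : ∀ t ∈ Set.Icc (0 : ℝ) 1,
      HasDerivAt (fun t : ℝ => fderiv ℝ u (x + t • (y - x)) (y - x))
      (hess u (x + t • (y - x)) (y - x) (y - x)) t := fun t ht => by
    have hF : DifferentiableAt ℝ (fderiv ℝ u) (x + t • (y - x)) :=
      ((hcd _ (hseg t ht)).fderiv_right (m := 1) (by norm_num)).differentiableAt (by norm_num)
    have := (hF.hasFDerivAt.comp_hasDerivAt t (hline t)).clm_apply (hasDerivAt_const t (y - x))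
    simpa [hess] using this
  obtain ⟨c, hc, hce⟩ := exists_hasDerivAt_eq_slope (fun t : ℝ => u (x + t • (y - x)))
    (fun t : ℝ => fderiv ℝ u (x + t • (y - x)) (y - x)) (zero_lt_one (α := ℝ))
    (fun t ht => (h1 t ht).continuousAt.continuousWithinAt)
    (fun t ht => h1 t (Set.Ioo_subset_Icc_self ht))
  obtain ⟨d, hd, hde⟩ := exists_hasDerivAt_eq_slope
    (fun t : ℝ => fderiv ℝ u (x + t • (y - x)) (y - x))
    (fun t : ℝ => hess u (x + t • (y - x)) (y - x) (y - x)) hc.1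
    (fun t ht => (h2 t ⟨ht.1, ht.2.trans hc.2.le⟩).continuousAt.continuousWithinAt)
    (fun t ht => h2 t ⟨ht.1.le, ht.2.le.trans hc.2.le⟩)
  have hnn : 0 ≤ hess u (x + d • (y - x)) (y - x) (y - x) := by
    by_cases h0 : y - x = 0
    · simp [h0, hess]
    · exact (hpd _ (hseg d ⟨hd.1.le, hd.2.le.trans hc.2.le⟩) _ h0).le
  rw [hde, sub_zero, le_div_iff₀ hc.1] at hnn
  simp at hce hnn
  rw [map_sub]
  linarith

/-- The image of the gradient is open. -/
lemma isOpen_image_aux (u : E2 → ℝ) (hu : ContDiffOn ℝ 2 u (ball (0 : E2) 1))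
    (hpd : ∀ z ∈ ball (0 : E2) 1, ∀ v : E2, v ≠ 0 → 0 < hess u z v v) :
    IsOpen (gradient u '' ball (0 : E2) 1) := by
  have hF : IsOpen (fderiv ℝ u '' ball (0 : E2) 1) := by
    rw [isOpen_iff_mem_nhds]
    rintro _ ⟨z, hz, rfl⟩
    have hs : HasStrictFDerivAt (fderiv ℝ u) (fderiv ℝ (fderiv ℝ u) z) z :=
      ((hu.contDiffAt (isOpen_ball.mem_nhds hz)).fderiv_right (m := 1)
        (by norm_num)).hasStrictFDerivAt (by norm_num)
    have hinj : Function.Injective (fderiv ℝ (fderiv ℝ u) z).toLinearMap := by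
      rw [injective_iff_map_eq_zero]
      intro v hv
      by_contra h0
      have := hpd z hz v h0
      have hv' : fderiv ℝ (fderiv ℝ u) z v = 0 := hv
      simp [hess, hv'] at this
    have hfin : Module.finrank ℝ E2 = Module.finrank ℝ (E2 →L[ℝ] ℝ) :=
      (InnerProductSpace.toDual ℝ E2).toLinearEquiv.finrank_eq
    have : FiniteDimensional ℝ (E2 →L[ℝ] ℝ) :=
      (InnerProductSpace.toDual ℝ E2).toLinearEquiv.finiteDimensional
    have hsurj := (LinearMap.injective_iff_surjective_of_finrank_eq_finrank hfin).1 hinj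
    rw [← hs.map_nhds_eq_of_surj (LinearMap.range_eq_top.2 hsurj)]
    exact image_mem_map (isOpen_ball.mem_nhds hz)
  have : gradient u '' ball (0 : E2) 1 =
      (InnerProductSpace.toDual ℝ E2).symm '' (fderiv ℝ u '' ball (0 : E2) 1) := by
    rw [Set.image_image]; rfl
  rw [this]
  exact (InnerProductSpace.toDual ℝ E2).symm.toHomeomorph.isOpenMap _ hF

/-- **Lemma A.1 (criterion for spacelike entire graphs).** Let `u` be a `C²` support function
on `𝔻` with positive definite Hessian, and suppose the inverse Gauss map
`Φ(z) = (∇u(z), ⟨z, ∇u(z)⟩ − u(z))` is proper. Then `∇u(𝔻) = ℝ²`, i.e. the boundary of the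
future-convex domain defined by `u` is a spacelike entire graph. -/
theorem entire_graph_criterion
    (u : E2 → ℝ) (hu : ContDiffOn ℝ 2 u (ball (0 : E2) 1))
    (hpd : ∀ z ∈ ball (0 : E2) 1, ∀ v : E2, v ≠ 0 → 0 < hess u z v v)
    (hproper : ∀ Kc : Set (E2 × ℝ), IsCompact Kc →
      IsCompact {z ∈ ball (0 : E2) 1 |
        (gradient u z, ⟪z, gradient u z⟫ - u z) ∈ Kc}) :
    ∀ w : E2, ∃ z ∈ ball (0 : E2) 1, gradient u z = w := by
  have hgc : ContinuousOn (gradient u) (ball (0 : E2) 1) := by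
    have : ContinuousOn (fderiv ℝ u) (ball (0 : E2) 1) :=
      hu.continuousOn_fderiv_of_isOpen isOpen_ball (by norm_num)
    exact (InnerProductSpace.toDual ℝ E2).symm.continuous.comp_continuousOn this
  have hconv : ∀ x ∈ ball (0 : E2) 1, ∀ y ∈ ball (0 : E2) 1,
      u x + ⟪gradient u x, y - x⟫ ≤ u y := by
    intro x hx y hy
    have := convex_ineq_aux u hu hpd hx hy
    simpa [gradient] using this
  have hlip : ∀ x ∈ ball (0 : E2) 1, ∀ y ∈ ball (0 : E2) 1,
      (⟪x, gradient u x⟫ - u x) - (⟪y, gradient u y⟫ - u y) ≤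
        ‖gradient u x - gradient u y‖ := by
    intro x hx y hy
    have h1 := hconv y hy x hx
    have h2 := real_inner_le_norm x (gradient u x - gradient u y)
    have h3 : ‖x‖ ≤ 1 := (mem_ball_zero_iff.1 hx).le
    have h4 := mul_le_mul_of_nonneg_right h3 (norm_nonneg (gradient u x - gradient u y))
    rw [inner_sub_right, real_inner_comm, real_inner_comm y] at h1
    rw [inner_sub_right] at h2
    linarith
  have hopen := isOpen_image_aux u hu hpd
  have hclosed : IsClosed (gradient u '' ball (0 : E2) 1) := by
    refine isClosed_of_closure_subset fun p hp => ?_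
    obtain ⟨_, ⟨z0, hz0, rfl⟩, hd0⟩ := Metric.mem_closure_iff.1 hp 1 one_pos
    set h0 := ⟪z0, gradient u z0⟫ - u z0 with hh0
    have hC := hproper (closedBall p 1 ×ˢ closedBall h0 2)
      ((isCompact_closedBall _ _).prod (isCompact_closedBall _ _))
    set C := {z ∈ ball (0 : E2) 1 | (gradient u z, ⟪z, gradient u z⟫ - u z) ∈
      closedBall p 1 ×ˢ closedBall h0 2} with hCdef
    have hGC : IsClosed (gradient u '' C) :=
      (hC.image_of_continuousOn (hgc.mono fun z hz => hz.1)).isClosed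
    have hsub : gradient u '' C ⊆ gradient u '' ball (0 : E2) 1 :=
      Set.image_mono fun z hz => hz.1
    apply hsub
    rw [← hGC.closure_eq]
    rw [Metric.mem_closure_iff] at hp ⊢
    intro ε hε
    obtain ⟨_, ⟨z, hz, rfl⟩, hd⟩ := hp (min ε 1) (lt_min hε one_pos)
    have hd1 := hd.trans_le (min_le_right _ _)
    refine ⟨_, ⟨z, ⟨hz, ?_, ?_⟩, rfl⟩, hd.trans_le (min_le_left _ _)⟩
    · rw [mem_closedBall, dist_comm]; exact hd1.le
    · have a := hlip z hz z0 hz0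
      have b := hlip z0 hz0 z hz
      have e : dist (gradient u z) (gradient u z0) ≤ 2 := by
        have := dist_triangle_left (gradient u z) (gradient u z0) p
        linarith
      rw [← dist_eq_norm] at a b
      rw [dist_comm] at b
      rw [mem_closedBall, Real.dist_eq, abs_le]
      constructor <;> simp only <;> linarith
  have huniv : gradient u '' ball (0 : E2) 1 = Set.univ :=
    IsClopen.eq_univ ⟨hclosed, hopen⟩ ⟨_, 0, by simp, rfl⟩
  intro w
  have hw : w ∈ gradient u '' ball (0 : E2) 1 := huniv ▸ Set.mem_univ w
  exact hw
end
end

section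
/- Let f : ℝ² → ℝ be a smooth convex function with ‖∇f(p)‖ < 1 for all p, and suppose there is d > 0 such that D²f(p)(v,v) ≥ d·√(1−‖∇f(p)‖²)·(‖v‖² − ⟨∇f(p),v⟩²) for all p, v ∈ ℝ² (the principal curvatures of the spacelike entire graph of f are bounded below by d). Fix p₀ ∈ ℝ² and set c = 1/√(1−‖∇f(p₀)‖²). Then for every y ∈ ℝ², f(y) ≥ f(p₀) − c/d + √(1/d² + ‖y − p₀ + (c/d)∇f(p₀)‖²); that is, the graph of f is contained in the future of the hyperboloid of curvature −d² tangent to the graph at (p₀, f(p₀)). -/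
open Metric Filter
open scoped RealInnerProductSpace Topology

noncomputable section

/-- Lower bound for the model quadratic form. -/
lemma form_lower (a v : E2) : (1 - ‖a‖ ^ 2) * ‖v‖ ^ 2 ≤ ‖v‖ ^ 2 - ⟪a, v⟫ ^ 2 := by
  have h := abs_real_inner_le_norm a v
  have h2 : ⟪a, v⟫ ^ 2 ≤ (‖a‖ * ‖v‖) ^ 2 := by
    rw [← sq_abs]
    exact pow_le_pow_left₀ (abs_nonneg _) h 2
  nlinarith

/-- Inverse of the quadratic form inequality. -/
lemma form_inv (a e v : E2) (d w : ℝ) (hd : 0 < d) (hw : 0 < w) (hw2 : w ^ 2 = 1 - ‖a‖ ^ 2)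
    (h : ⟪e, v⟫ ≥ d * w * (‖v‖ ^ 2 - ⟪a, v⟫ ^ 2)) :
    ⟪e, v⟫ ≤ (1 / d) * (‖e‖ ^ 2 / w + ⟪a, e⟫ ^ 2 / w ^ 3) := by
  set k : ℝ := ⟪a, e⟫ with hk
  set u : E2 := (1 / (d * w)) • (e + (k / w ^ 2) • a) with hu
  have h1 := form_lower a (v - u)
  have h0 : 0 ≤ ‖v - u‖ ^ 2 - ⟪a, v - u⟫ ^ 2 := by
    refine le_trans ?_ h1
    rw [← hw2]; positivity
  have hau : ⟪a, u⟫ = k / (d * w ^ 3) := by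
    rw [hu, inner_smul_right, inner_add_right, inner_smul_right, real_inner_self_eq_norm_sq]
    have : ‖a‖ ^ 2 = 1 - w ^ 2 := by linarith
    rw [this, ← hk]; field_simp; ring
  have hvu : ⟪v, u⟫ = (1 / (d * w)) * (⟪e, v⟫ + k / w ^ 2 * ⟪a, v⟫) := by
    rw [hu, inner_smul_right, inner_add_right, inner_smul_right, real_inner_comm e v,
      real_inner_comm a v]
  have heu : ⟪e, u⟫ = (1 / d) * (‖e‖ ^ 2 / w + k ^ 2 / w ^ 3) := by
    rw [hu, inner_smul_right, inner_add_right, inner_smul_right, real_inner_self_eq_norm_sq,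
      real_inner_comm a e, ← hk]; field_simp
  have huu : ‖u‖ ^ 2 = (1 / (d * w)) * (⟪e, u⟫ + k / w ^ 2 * ⟪a, u⟫) := by
    rw [← real_inner_self_eq_norm_sq]
    nth_rewrite 1 [hu]
    rw [real_inner_smul_left, inner_add_left, real_inner_smul_left]
  have hexp : d * w * (‖v - u‖ ^ 2 - ⟪a, v - u⟫ ^ 2)
      = d * w * (‖v‖ ^ 2 - ⟪a, v⟫ ^ 2) - 2 * ⟪e, v⟫ + ⟪e, u⟫ := by
    rw [norm_sub_sq_real, inner_sub_right, huu, hvu, hau]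
    field_simp
    ring
  have h3 : 0 ≤ d * w * (‖v - u‖ ^ 2 - ⟪a, v - u⟫ ^ 2) := by positivity
  rw [← heu]; linarith

/-- The inverse Riesz map, as a real-linear map. -/
def rieszInv : StrongDual ℝ E2 →L[ℝ] E2 where
  toFun := (InnerProductSpace.toDual ℝ E2).symm
  map_add' := fun x y => map_add _ x y
  map_smul' := fun t x => by simp
  cont := (InnerProductSpace.toDual ℝ E2).symm.continuous

lemma inner_rieszInv (l : StrongDual ℝ E2) (w : E2) : ⟪rieszInv l, w⟫ = l w :=
  InnerProductSpace.toDual_symm_apply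

/-- The derivative of the gradient. -/
def gradDeriv (f : E2 → ℝ) (p : E2) : E2 →L[ℝ] E2 :=
  rieszInv ∘L (fderiv ℝ (fderiv ℝ f) p)

lemma inner_gradDeriv (f : E2 → ℝ) (p v w : E2) : ⟪gradDeriv f p v, w⟫ = hess f p v w := by
  simp [gradDeriv, hess, inner_rieszInv]

lemma hasStrictFDerivAt_gradient (f : E2 → ℝ) (hf : ContDiff ℝ (⊤ : ℕ∞) f) (p : E2) :
    HasStrictFDerivAt (gradient f) (gradDeriv f p) p := by
  have h1 : ContDiff ℝ 1 (fderiv ℝ f) := hf.fderiv_right (m := 1) (WithTop.coe_le_coe.2 (le_top : (1 + 1 : ℕ∞) ≤ ⊤))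
  have h2 := (h1.contDiffAt (x := p)).hasStrictFDerivAt one_ne_zero
  exact rieszInv.hasStrictFDerivAt.comp p h2

lemma inner_gradient (f : E2 → ℝ) (p v : E2) : ⟪gradient f p, v⟫ = fderiv ℝ f p v := by
  simp [gradient]

/-- Existence of the path of points with prescribed gradients. -/
lemma exists_path (f : E2 → ℝ) (hf : ContDiff ℝ (⊤ : ℕ∞) f)
    (hsp : ∀ p : E2, ‖gradient f p‖ < 1)
    (d : ℝ) (hd : 0 < d)
    (hpc : ∀ p v : E2,
      hess f p v v ≥
        d * Real.sqrt (1 - ‖gradient f p‖ ^ 2) * (‖v‖ ^ 2 - ⟪gradient f p, v⟫ ^ 2))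
    (p₀ a₁ : E2) (ha₁ : ‖a₁‖ < 1) :
    ∃ p v : ℝ → E2, p 0 = p₀ ∧ ∀ s ∈ Set.Icc (0 : ℝ) 1,
      gradient f (p s) = gradient f p₀ + s • (a₁ - gradient f p₀) ∧
      HasDerivAt p (v s) s ∧ gradDeriv f (p s) (v s) = a₁ - gradient f p₀ := by
  set G := gradient f with hG
  have hlow : ∀ p v : E2, d * Real.sqrt (1 - ‖G p‖ ^ 2) * ((1 - ‖G p‖ ^ 2) * ‖v‖ ^ 2) ≤
      ⟪gradDeriv f p v, v⟫ := fun p v => by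
    rw [inner_gradDeriv]
    exact (mul_le_mul_of_nonneg_left (form_lower _ _) (by positivity)).trans (hpc p v)
  have hw0 : ∀ p, 0 < 1 - ‖G p‖ ^ 2 := fun p => by
    have := hsp p
    have := norm_nonneg (G p)
    nlinarith
  have hpos : ∀ p v : E2, v ≠ 0 → 0 < ⟪gradDeriv f p v, v⟫ := fun p v hv => by
    refine lt_of_lt_of_le ?_ (hlow p v)
    have := hw0 p
    have := norm_pos_iff.2 hv
    positivity
  have hinjA : ∀ p, Function.Injective (gradDeriv f p) := fun p => by
    rw [injective_iff_map_eq_zero]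
    intro v hv
    by_contra hne
    have := hpos p v hne
    rw [hv] at this
    simp at this
  let A : E2 → (E2 ≃L[ℝ] E2) := fun p =>
    (LinearEquiv.ofInjectiveEndo (gradDeriv f p : E2 →ₗ[ℝ] E2) (hinjA p)).toContinuousLinearEquiv
  have hA : ∀ p, (A p : E2 →L[ℝ] E2) = gradDeriv f p := fun p => by ext; rfl
  have hstrict : ∀ p, HasStrictFDerivAt G (A p : E2 →L[ℝ] E2) p := fun p => by
    rw [hA]; exact hasStrictFDerivAt_gradient f hf p
  have hopen : IsOpenMap G := isOpenMap_of_hasStrictFDerivAt_equiv (f' := A) hstrict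
  have hcont : Continuous G := continuous_iff_continuousAt.2 fun p => (hstrict p).hasFDerivAt.continuousAt
  have hinj : Function.Injective G := by
    intro p q hpq
    by_contra hne
    have hv : q - p ≠ 0 := sub_ne_zero.2 (Ne.symm hne)
    have hder : ∀ t : ℝ, HasDerivAt (fun t : ℝ => ⟪G (p + t • (q - p)), q - p⟫)
        ⟪gradDeriv f (p + t • (q - p)) (q - p), q - p⟫ t := fun t => by
      have h1 : HasDerivAt (fun t : ℝ => p + t • (q - p)) (q - p) t := by
        simpa using ((hasDerivAt_id t).smul_const (q - p)).const_add p
      have h2 := (hasStrictFDerivAt_gradient f hf (p + t • (q - p))).hasFDerivAt.comp_hasDerivAt t h1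
      refine (h2.inner ℝ (hasDerivAt_const t (q - p))).congr_deriv ?_
      rw [inner_zero_right, zero_add]
    have hm : StrictMono (fun t : ℝ => ⟪G (p + t • (q - p)), q - p⟫) := by
      apply strictMono_of_deriv_pos
      intro t
      rw [(hder t).deriv]
      exact hpos _ _ hv
    have := hm (zero_lt_one' ℝ)
    simp [hpq] at this
  have hemb : Topology.IsOpenEmbedding G := .of_continuous_injective_isOpenMap hcont hinj hopen
  let φ := hemb.toOpenPartialHomeomorph G
  have hφG : ∀ p, φ p = G p := fun p => rfl
  have hleft : ∀ p, φ.symm (G p) = p := fun p => φ.left_inv (x := p) (by simp [φ])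
  set e := a₁ - G p₀ with he
  let a : ℝ → E2 := fun s => G p₀ + s • e
  have ha : ∀ s, HasDerivAt a e s := fun s => by
    refine (((hasDerivAt_id s).smul_const e).const_add (G p₀)).congr_deriv ?_
    rw [one_smul]
  have hac : Continuous a := continuous_iff_continuousAt.2 fun s => (ha s).continuousAt
  let P : ℝ → E2 := fun s => φ.symm (a s)
  let V : ℝ → E2 := fun s => (A (P s)).symm e
  have hP : ∀ s, a s ∈ Set.range G → G (P s) = a s ∧ HasDerivAt P (V s) s := by
    rintro s ⟨p, hp⟩
    have hPs : P s = p := by simp only [P]; rw [← hp, hleft]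
    refine ⟨by rw [hPs, hp], ?_⟩
    have hd1 : HasFDerivAt φ.symm ((A (P s)).symm : E2 →L[ℝ] E2) (a s) := by
      apply φ.hasFDerivAt_symm
      · change a s ∈ φ.target
        simp only [φ, Topology.IsOpenEmbedding.toOpenPartialHomeomorph_target]
        exact ⟨p, hp⟩
      · exact (hstrict _).hasFDerivAt
    exact hd1.comp_hasDerivAt s (ha s)
  -- bound
  set R := max ‖G p₀‖ ‖a₁‖ with hR
  have hR1 : R < 1 := max_lt (hsp p₀) ha₁
  have hR0 : 0 ≤ R := le_max_of_le_left (norm_nonneg _)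
  have haR : ∀ s ∈ Set.Icc (0 : ℝ) 1, ‖a s‖ ≤ R := by
    intro s hs
    have h1 : a s = (1 - s) • G p₀ + s • a₁ := by simp only [a, he]; module
    rw [h1]
    refine (norm_add_le _ _).trans ?_
    rw [norm_smul, norm_smul, Real.norm_of_nonneg hs.1, Real.norm_of_nonneg (by linarith [hs.2])]
    have h2 : ‖G p₀‖ ≤ R := le_max_left _ _
    have h3 : ‖a₁‖ ≤ R := le_max_right _ _
    nlinarith [hs.1, hs.2]
  set ε := d * Real.sqrt (1 - R ^ 2) * (1 - R ^ 2) with hε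
  have hR2 : 0 < 1 - R ^ 2 := by nlinarith
  have hε0 : 0 < ε := by positivity
  have hbd : ∀ s ∈ Set.Icc (0 : ℝ) 1, a s ∈ Set.range G → ‖V s‖ ≤ ‖e‖ / ε := by
    intro s hs hsr
    have h1 := (hP s hsr).1
    have h2 := hlow (P s) (V s)
    have h3 : gradDeriv f (P s) (V s) = e := by
      rw [← hA]; simp [V]
    rw [h3, h1] at h2
    have h4 := real_inner_le_norm e (V s)
    have h5 : 1 - R ^ 2 ≤ 1 - ‖a s‖ ^ 2 := by
      have := haR s hs
      have := norm_nonneg (a s)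
      nlinarith
    have h6 : ε * ‖V s‖ ^ 2 ≤ ‖e‖ * ‖V s‖ := by
      refine le_trans ?_ (h2.trans h4)
      rw [hε, mul_assoc]
      gcongr
    rw [le_div_iff₀ hε0]
    rcases (norm_nonneg (V s)).eq_or_lt with h0 | h0
    · rw [← h0]; simp
    · nlinarith
  -- surjectivity
  have hsurj : ∀ s ∈ Set.Icc (0 : ℝ) 1, a s ∈ Set.range G := by
    by_contra hcon
    push Not at hcon
    let C : Set ℝ := Set.Icc 0 1 ∩ a ⁻¹' (Set.range G)ᶜ
    have hCc : IsCompact C := isCompact_Icc.inter_right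
      ((hopen.isOpen_range.isClosed_compl).preimage hac)
    have hCn : C.Nonempty := by
      obtain ⟨s, hs, h⟩ := hcon
      exact ⟨s, hs, h⟩
    obtain ⟨t, ht, htmin⟩ := hCc.exists_isLeast hCn
    have htmem := ht.1
    have ht0 : 0 < t := by
      rcases htmem.1.eq_or_lt with h | h
      · exfalso
        apply ht.2
        rw [← h]
        exact ⟨p₀, by simp [a]⟩
      · exact h
    have hlt : ∀ s ∈ Set.Ico 0 t, a s ∈ Set.range G := by
      intro s hs
      by_contra hn
      have := htmin ⟨⟨hs.1, hs.2.le.trans htmem.2⟩, hn⟩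
      exact absurd this (not_le.2 hs.2)
    have hlip : LipschitzOnWith (Real.toNNReal (‖e‖ / ε)) P (Set.Ico 0 t) := by
      apply (convex_Ico 0 t).lipschitzOnWith_of_nnnorm_hasDerivWithin_le (f' := V)
      · intro s hs
        exact (hP s (hlt s hs)).2.hasDerivWithinAt
      · intro s hs
        rw [← norm_toNNReal]
        exact Real.toNNReal_le_toNNReal (hbd s ⟨hs.1, hs.2.le.trans htmem.2⟩ (hlt s hs))
    obtain ⟨g, hg, hgP⟩ := hlip.extend_finite_dimension
    have hcl : Set.Icc 0 t ⊆ {s | G (g s) = a s} := by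
      rw [← closure_Ico ht0.ne]
      apply closure_minimal
      · intro s hs
        change G (g s) = a s
        rw [← hgP hs]
        exact (hP s (hlt s hs)).1
      · exact isClosed_eq (hcont.comp hg.continuous) hac
    exact ht.2 ⟨g t, hcl ⟨ht0.le, le_rfl⟩⟩
  refine ⟨P, V, ?_, ?_⟩
  · have : a 0 = G p₀ := by simp [a]
    simp only [P]; rw [this, hleft]
  · intro s hs
    refine ⟨(hP s (hsurj s hs)).1, (hP s (hsurj s hs)).2, ?_⟩
    rw [← hA]; simp [V]

/-- **Lemma 5.6.** A spacelike entire graph with principal curvatures bounded below by `d > 0`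
lies in the future of the tangent hyperboloid of curvature `−d²` at any of its points. -/
theorem graph_above_tangent_hyperboloid
    (f : E2 → ℝ) (hf : ContDiff ℝ (⊤ : ℕ∞) f) (hconv : ConvexOn ℝ Set.univ f)
    (hsp : ∀ p : E2, ‖gradient f p‖ < 1)
    (d : ℝ) (hd : 0 < d)
    (hpc : ∀ p v : E2,
      hess f p v v ≥
        d * Real.sqrt (1 - ‖gradient f p‖ ^ 2) * (‖v‖ ^ 2 - ⟪gradient f p, v⟫ ^ 2))
    (p₀ : E2) (c : ℝ) (hc : c = 1 / Real.sqrt (1 - ‖gradient f p₀‖ ^ 2)) :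
    ∀ y : E2, f y ≥ f p₀ - c / d +
      Real.sqrt (1 / d ^ 2 + ‖y - p₀ + (c / d) • gradient f p₀‖ ^ 2) := by
  intro y
  have hfd : Differentiable ℝ f := hf.differentiable (by simp)
  set z : E2 := y - p₀ + (c / d) • gradient f p₀ with hz
  set S := Real.sqrt (1 / d ^ 2 + ‖z‖ ^ 2) with hS
  have hS2 : S ^ 2 = 1 / d ^ 2 + ‖z‖ ^ 2 := Real.sq_sqrt (by positivity)
  have hSpos : 0 < S := Real.sqrt_pos.2 (by positivity)
  set a₁ : E2 := (1 / S) • z with ha₁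
  have hn1 : ‖a₁‖ ^ 2 = 1 - (1 / (d * S)) ^ 2 := by
    rw [ha₁, norm_smul, mul_pow, Real.norm_of_nonneg (by positivity)]
    have : ‖z‖ ^ 2 = S ^ 2 - 1 / d ^ 2 := by linarith
    rw [this]; field_simp
  have hlt : ‖a₁‖ < 1 := by
    have : 0 < (1 / (d * S)) ^ 2 := by positivity
    have := norm_nonneg a₁
    nlinarith
  obtain ⟨p, v, hp0, hp⟩ := exists_path f hf hsp d hd hpc p₀ a₁ hlt
  set a₀ := gradient f p₀ with ha₀
  set e := a₁ - a₀ with he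
  let a : ℝ → E2 := fun s => a₀ + s • e
  have ha : ∀ s, HasDerivAt a e s := fun s => by
    refine (((hasDerivAt_id s).smul_const e).const_add a₀).congr_deriv ?_
    rw [one_smul]
  have hpa : ∀ s ∈ Set.Icc (0 : ℝ) 1, gradient f (p s) = a s := fun s hs => (hp s hs).1
  let w : ℝ → ℝ := fun s => Real.sqrt (1 - ‖a s‖ ^ 2)
  have hn : ∀ s ∈ Set.Icc (0 : ℝ) 1, 0 < 1 - ‖a s‖ ^ 2 := fun s hs => by
    rw [← hpa s hs]
    have := hsp (p s)
    have := norm_nonneg (gradient f (p s))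
    nlinarith
  have hwpos : ∀ s ∈ Set.Icc (0 : ℝ) 1, 0 < w s := fun s hs => Real.sqrt_pos.2 (hn s hs)
  have hw2 : ∀ s ∈ Set.Icc (0 : ℝ) 1, w s ^ 2 = 1 - ‖a s‖ ^ 2 :=
    fun s hs => Real.sq_sqrt (hn s hs).le
  have hwd : ∀ s ∈ Set.Icc (0 : ℝ) 1, HasDerivAt w (-(⟪a s, e⟫ / w s)) s := fun s hs => by
    have h1 := (((ha s).norm_sq).const_sub 1).sqrt (hn s hs).ne'
    refine h1.congr_deriv ?_
    have := hwpos s hs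
    change _ / (2 * w s) = _
    field_simp
  have hkd : ∀ s, HasDerivAt (fun s => ⟪a s, e⟫) (‖e‖ ^ 2) s := fun s => by
    simpa [real_inner_self_eq_norm_sq] using (ha s).inner ℝ (hasDerivAt_const s e)
  -- the difference of first derivatives
  let r : E2 := p₀ - (c / d) • a₀
  let D : ℝ → ℝ := fun s => ⟪p s, e⟫ - ⟪r, e⟫ - (1 / d) * (⟪a s, e⟫ / w s)
  have hDd : ∀ s ∈ Set.Icc (0 : ℝ) 1, HasDerivAt D
      (⟪v s, e⟫ - (1 / d) * (‖e‖ ^ 2 / w s + ⟪a s, e⟫ ^ 2 / w s ^ 3)) s := fun s hs => by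
    have h1 : HasDerivAt (fun s => ⟪p s, e⟫) ⟪v s, e⟫ s := by
      simpa using (hp s hs).2.1.inner ℝ (hasDerivAt_const s e)
    have hw := hwpos s hs
    have h2 := ((hkd s).div (hwd s hs) hw.ne').const_mul (1 / d)
    refine ((h1.sub_const ⟪r, e⟫).sub h2).congr_deriv ?_
    field_simp
    ring
  have hDd' : ∀ s ∈ Set.Icc (0 : ℝ) 1,
      ⟪v s, e⟫ - (1 / d) * (‖e‖ ^ 2 / w s + ⟪a s, e⟫ ^ 2 / w s ^ 3) ≤ 0 := fun s hs => by
    have h1 := hpc (p s) (v s)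
    rw [← inner_gradDeriv, (hp s hs).2.2, hpa s hs] at h1
    have h2 := form_inv (a s) e (v s) d (w s) hd (hwpos s hs) (hw2 s hs) h1
    rw [real_inner_comm e (v s)]
    linarith
  have hc' : c = 1 / w 0 := by rw [hc]; simp [w, a]
  have h0m : (0 : ℝ) ∈ Set.Icc (0 : ℝ) 1 := by simp
  have h1m : (1 : ℝ) ∈ Set.Icc (0 : ℝ) 1 := by simp
  have ha0 : a 0 = a₀ := by simp [a]
  have ha1 : a 1 = a₁ := by simp [a, he]
  have hD0 : D 0 = 0 := by
    simp only [D, r, hp0, inner_sub_left, real_inner_smul_left, ha0, hc']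
    ring
  have hDanti : AntitoneOn D (Set.Icc 0 1) := by
    apply antitoneOn_of_deriv_nonpos (convex_Icc 0 1)
    · exact fun s hs => (hDd s hs).continuousAt.continuousWithinAt
    · intro s hs
      rw [interior_Icc] at hs
      exact (hDd s (Set.Ioo_subset_Icc_self hs)).differentiableAt.differentiableWithinAt
    · intro s hs
      rw [interior_Icc] at hs
      have hs' := Set.Ioo_subset_Icc_self hs
      rw [(hDd s hs').deriv]
      exact hDd' s hs'
  let Φ : ℝ → ℝ := fun s => ⟪a s, p s⟫ - f (p s) - ⟪a s, r⟫ + (1 / d) * w s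
  have hΦd : ∀ s ∈ Set.Icc (0 : ℝ) 1, HasDerivAt Φ (D s) s := fun s hs => by
    have h1 := (ha s).inner ℝ (hp s hs).2.1
    have h2 := (hfd (p s)).hasFDerivAt.comp_hasDerivAt s (hp s hs).2.1
    rw [← inner_gradient, hpa s hs] at h2
    have h3 : HasDerivAt (fun s => ⟪a s, r⟫) ⟪e, r⟫ s := by
      simpa using (ha s).inner ℝ (hasDerivAt_const s r)
    refine (((h1.sub h2).sub h3).add ((hwd s hs).const_mul (1 / d))).congr_deriv ?_
    simp only [D]
    rw [real_inner_comm e (p s), real_inner_comm e r]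
    ring
  have hΦanti : AntitoneOn Φ (Set.Icc 0 1) := by
    apply antitoneOn_of_deriv_nonpos (convex_Icc 0 1)
    · exact fun s hs => (hΦd s hs).continuousAt.continuousWithinAt
    · intro s hs
      rw [interior_Icc] at hs
      exact (hΦd s (Set.Ioo_subset_Icc_self hs)).differentiableAt.differentiableWithinAt
    · intro s hs
      rw [interior_Icc] at hs
      have hs' := Set.Ioo_subset_Icc_self hs
      rw [(hΦd s hs').deriv, ← hD0]
      exact hDanti h0m hs' hs'.1
  have hkey := hΦanti h0m h1m zero_le_one
  have hw0 := hwpos 0 h0m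
  have hΦ0 : Φ 0 = - f p₀ + c / d := by
    have h1 : ‖a₀‖ ^ 2 = 1 - w 0 ^ 2 := by rw [hw2 0 h0m, ha0]; ring
    simp only [Φ, r, hp0, ha0, inner_sub_right, inner_smul_right, real_inner_self_eq_norm_sq]
    rw [h1, hc']
    field_simp
    ring
  have hw1 : w 1 = 1 / (d * S) := by
    simp only [w]
    rw [ha1, hn1]
    rw [show 1 - (1 - (1 / (d * S)) ^ 2) = (1 / (d * S)) ^ 2 by ring]
    exact Real.sqrt_sq (by positivity)
  -- convexity
  have hsupp : f (p 1) + ⟪a₁, y - p 1⟫ ≤ f y := by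
    let γ : ℝ → ℝ := fun t => f (p 1 + t • (y - p 1))
    have hγ : ConvexOn ℝ Set.univ γ := by
      have := hconv.comp_affineMap (AffineMap.lineMap (p 1) y)
      simp only [Set.preimage_univ] at this
      refine this.congr ?_
      intro t _
      simp [γ, AffineMap.lineMap_apply, add_comm]
    have hγd : HasDerivAt γ ⟪a₁, y - p 1⟫ 0 := by
      have h1 : HasDerivAt (fun t : ℝ => p 1 + t • (y - p 1)) (y - p 1) 0 := by
        simpa using ((hasDerivAt_id (0 : ℝ)).smul_const (y - p 1)).const_add (p 1)
      have h2 := (hfd (p 1 + (0 : ℝ) • (y - p 1))).hasFDerivAt.comp_hasDerivAt 0 h1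
      rw [← inner_gradient, zero_smul, add_zero, hpa 1 h1m, ha1] at h2
      exact h2
    have h3 := hγ.le_slope_of_hasDerivAt (Set.mem_univ 0) (Set.mem_univ 1) zero_lt_one hγd
    simp [slope_def_field, γ] at h3
    linarith
  have hΦ1 : Φ 1 = ⟪a₁, p 1⟫ - f (p 1) - ⟪a₁, r⟫ + (1 / d) * (1 / (d * S)) := by
    simp only [Φ, ha1, hw1]
  have hyz : ⟪a₁, y⟫ - ⟪a₁, r⟫ = ‖z‖ ^ 2 / S := by
    rw [← inner_sub_right, show y - r = z by simp only [r, hz]; abel, ha₁, real_inner_smul_left,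
      real_inner_self_eq_norm_sq]
    ring
  have hSeq : ‖z‖ ^ 2 / S + (1 / d) * (1 / (d * S)) = S := by
    have : ‖z‖ ^ 2 = S ^ 2 - 1 / d ^ 2 := by linarith
    rw [this]; field_simp; ring
  rw [inner_sub_right] at hsupp
  rw [hΦ0, hΦ1] at hkey
  linarith
end
end

section
/- Let f : ℝ² → ℝ be a smooth convex function with ‖∇f(p)‖ < 1 for all p, such that for some d > 0 one has D²f(p)(v,v) ≥ d·√(1−‖∇f(p)‖²)·(‖v‖² − ⟨∇f(p),v⟩²) for all p, v ∈ ℝ² (principal curvatures bounded below by d). Fix p₀ ∈ ℝ² and set c = 1/√(1−‖∇f(p₀)‖²). Then the graph of f is contained in the open future cone of the point r_d(p₀) = (p₀, f(p₀)) − (1/d)·c·(∇f(p₀), 1); explicitly, f(y) > f(p₀) − c/d + ‖y − p₀ + (c/d)∇f(p₀)‖ for every y ∈ ℝ². -/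
open Metric Filter
open scoped RealInnerProductSpace Topology

noncomputable section

/-- Abbreviation-free first order condition for convex functions. -/
lemma convex_first_order (f : E2 → ℝ) (hf : Differentiable ℝ f) (hconv : ConvexOn ℝ Set.univ f)
    (p y : E2) : f p + ⟪gradient f p, y - p⟫ ≤ f y := by
  have h1 : ConvexOn ℝ Set.univ (f ∘ AffineMap.lineMap (k := ℝ) p y) := by
    simpa using hconv.comp_affineMap (AffineMap.lineMap (k := ℝ) p y)
  have h2 : HasDerivAt (f ∘ AffineMap.lineMap (k := ℝ) p y) (⟪gradient f p, y - p⟫) 0 := by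
    have hg : HasFDerivAt f (InnerProductSpace.toDual ℝ E2 (gradient f p))
        (AffineMap.lineMap (k := ℝ) p y (0 : ℝ)) := by
      simpa using (hf p).hasGradientAt.hasFDerivAt
    have := hg.comp_hasDerivAt (0 : ℝ) (AffineMap.hasDerivAt_lineMap (a := p) (b := y))
    exact this
  have h3 := h1.le_slope_of_hasDerivAt (Set.mem_univ 0) (Set.mem_univ 1) zero_lt_one h2
  rw [slope_def_field] at h3
  simp only [Function.comp, AffineMap.lineMap_apply_zero, AffineMap.lineMap_apply_one,
    sub_zero, div_one] at h3
  linarith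

lemma eventually_le_of_deriv_lt (φ ψ : ℝ → ℝ) (a b t : ℝ) (hφ : HasDerivAt φ a t)
    (hψ : HasDerivAt ψ b t) (hab : a < b) (h : φ t ≤ ψ t) : ∀ᶠ s in 𝓝[>] t, φ s ≤ ψ s := by
  have h1 := (hψ.sub hφ).hasDerivWithinAt (s := Set.Ioi t)
  have h2 := (hasDerivWithinAt_iff_tendsto_slope' (by simp)).1 h1
  have h3 := h2.eventually (lt_mem_nhds (sub_pos.2 hab))
  filter_upwards [h3, self_mem_nhdsWithin] with s hs hst
  have hst' : 0 < s - t := sub_pos.2 hst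
  rw [slope_def_field] at hs
  have := (div_pos_iff_of_pos_right hst').1 hs
  simp at this
  linarith

lemma cs_bound (ξ D v : E2) (d s : ℝ) (hd : 0 < d) (hs : 0 < s) (hs2 : s ^ 2 = 1 - ‖ξ‖ ^ 2)
    (hX : d * s * (‖v‖ ^ 2 - ⟪ξ, v⟫ ^ 2) ≤ ⟪v, D⟫) :
    d * s ^ 3 * ⟪v, D⟫ ≤ s ^ 2 * ‖D‖ ^ 2 + ⟪ξ, D⟫ ^ 2 := by
  set w : E2 := (d * s ^ 3) • v - (s ^ 2 • D + ⟪ξ, D⟫ • ξ) with hw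
  have h1 : ⟪ξ, w⟫ ^ 2 ≤ ‖w‖ ^ 2 := by
    have h := abs_real_inner_le_norm ξ w
    have h' : ‖ξ‖ ≤ 1 := by nlinarith [norm_nonneg ξ, sq_nonneg s]
    have h'' : |⟪ξ, w⟫| ≤ ‖w‖ := h.trans (by nlinarith [norm_nonneg w])
    exact sq_le_sq' (by linarith [(abs_le.1 h'').1]) (abs_le.1 h'').2
  have hξξ : ⟪ξ, ξ⟫ = 1 - s ^ 2 := by rw [real_inner_self_eq_norm_sq]; linarith
  have h2 : ⟪ξ, w⟫ = d * s ^ 3 * ⟪ξ, v⟫ - ⟪ξ, D⟫ := by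
    simp only [hw, inner_sub_right, inner_add_right, inner_smul_right, hξξ]; ring
  have h3 : ‖w‖ ^ 2 = (d * s ^ 3) ^ 2 * ‖v‖ ^ 2
      - 2 * (d * s ^ 3) * (s ^ 2 * ⟪v, D⟫ + ⟪ξ, D⟫ * ⟪ξ, v⟫)
      + (s ^ 4 * ‖D‖ ^ 2 + 2 * s ^ 2 * ⟪ξ, D⟫ ^ 2 + ⟪ξ, D⟫ ^ 2 * (1 - s ^ 2)) := by
    rw [← real_inner_self_eq_norm_sq, ← real_inner_self_eq_norm_sq, ← real_inner_self_eq_norm_sq]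
    simp only [hw, inner_sub_right, inner_add_right, inner_smul_right, inner_sub_left,
      inner_add_left, real_inner_smul_left, hξξ]
    rw [real_inner_comm v D, real_inner_comm ξ v, real_inner_comm D ξ]
    ring
  rw [h2, h3] at h1
  have h4 : 0 ≤ (d * s ^ 5) * (⟪v, D⟫ - d * s * (‖v‖ ^ 2 - ⟪ξ, v⟫ ^ 2)) :=
    mul_nonneg (by positivity) (by linarith)
  have h5 : 0 ≤ s ^ 2 * (s ^ 2 * ‖D‖ ^ 2 + ⟪ξ, D⟫ ^ 2 - d * s ^ 3 * ⟪v, D⟫) := by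
    nlinarith
  have := nonneg_of_mul_nonneg_right h5 (by positivity : 0 < s ^ 2)
  linarith

/-- Local solvability of `∇f(P(s)) = η + (s - t) D` near `t`. -/
lemma local_path (f : E2 → ℝ) (hf : ContDiff ℝ (⊤ : ℕ∞) f) (p D : E2) (ξ : ℝ → E2) (t : ℝ)
    (hξ : HasDerivAt ξ D t) (hp : gradient f p = ξ t)
    (hpos : ∀ v : E2, v ≠ 0 → 0 < hess f p v v) :
    ∃ (P : ℝ → E2) (v : E2), P t = p ∧ HasDerivAt P v t ∧ (∀ᶠ s in 𝓝 t, gradient f (P s) = ξ s) ∧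
      ⟪v, D⟫ = hess f p v v := by
  have h2 : ContDiff ℝ 1 (fderiv ℝ f) := hf.fderiv_right (by norm_cast)
  have h3 : HasStrictFDerivAt (fderiv ℝ f) (fderiv ℝ (fderiv ℝ f) p) p :=
    h2.contDiffAt.hasStrictFDerivAt (by norm_num)
  let L : (E2 →L[ℝ] ℝ) →L[ℝ] E2 :=
    LinearMap.toContinuousLinearMap
      { toFun := fun l => (InnerProductSpace.toDual ℝ E2).symm l
        map_add' := fun x y => map_add _ x y
        map_smul' := fun r x => by simp }
  have hLi : ∀ (l : E2 →L[ℝ] ℝ) (w : E2), ⟪L l, w⟫ = l w := fun l w =>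
    InnerProductSpace.toDual_symm_apply (𝕜 := ℝ) (x := w) (y := l)
  let A : E2 →L[ℝ] E2 := L.comp (fderiv ℝ (fderiv ℝ f) p)
  have hA : HasStrictFDerivAt (gradient f) A p := L.hasStrictFDerivAt.comp p h3
  have hAi : ∀ v w, ⟪A v, w⟫ = hess f p v w := fun v w => hLi _ _
  have hinj : Function.Injective (A : E2 →ₗ[ℝ] E2) := by
    rw [injective_iff_map_eq_zero]
    intro v hv
    by_contra hne
    have := hpos v hne
    rw [← hAi] at this
    have hv' : A v = 0 := hv
    rw [hv'] at this
    simp at this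
  let e : E2 ≃L[ℝ] E2 := (LinearEquiv.ofInjectiveEndo (A : E2 →ₗ[ℝ] E2) hinj).toContinuousLinearEquiv
  have heA : ∀ v, e v = A v := fun v => rfl
  have he : HasStrictFDerivAt (gradient f) (e : E2 →L[ℝ] E2) p := by
    have h : (e : E2 →L[ℝ] E2) = A := ContinuousLinearMap.ext heA
    rw [h]; exact hA
  refine ⟨fun s => he.localInverse (gradient f) e p (ξ s), e.symm D, ?_, ?_, ?_, ?_⟩
  · simp only
    rw [← hp]; exact he.localInverse_apply_image
  · have := he.to_localInverse.hasFDerivAt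
    rw [hp] at this
    exact this.comp_hasDerivAt t hξ
  · have := he.eventually_right_inverse
    rw [hp] at this
    exact hξ.continuousAt.eventually this
  · rw [← hAi, ← heA, e.apply_symm_apply, real_inner_comm]

set_option maxHeartbeats 1000000 in
/-- Continuity method: solve `∇f(p) = ξ₁` with control of the Legendre transform. -/
lemma exists_preimage
    (f : E2 → ℝ) (hf : ContDiff ℝ (⊤ : ℕ∞) f)
    (d : ℝ) (hd : 0 < d)
    (hpc : ∀ p v : E2,
      hess f p v v ≥
        d * Real.sqrt (1 - ‖gradient f p‖ ^ 2) * (‖v‖ ^ 2 - ⟪gradient f p, v⟫ ^ 2))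
    (p₀ q ξ₁ : E2) (h0 : ‖gradient f p₀‖ < 1) (h1 : ‖ξ₁‖ < 1) (t₀ ε : ℝ) (hε : 0 < ε)
    (hq : q = p₀ - (1 / Real.sqrt (1 - ‖gradient f p₀‖ ^ 2) / d) • gradient f p₀)
    (ht₀ : t₀ = f p₀ - 1 / Real.sqrt (1 - ‖gradient f p₀‖ ^ 2) / d) :
    ∃ p, gradient f p = ξ₁ ∧
      ⟪p, ξ₁⟫ - f p ≤ ⟪q, ξ₁⟫ - t₀ - (1 / d) * Real.sqrt (1 - ‖ξ₁‖ ^ 2) + 2 * ε := by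
  have hdf : Differentiable ℝ f := hf.differentiable (by simp)
  set ξ₀ := gradient f p₀ with hξ₀
  set D := ξ₁ - ξ₀ with hD
  set ξ : ℝ → E2 := fun t => ξ₀ + t • D with hξ
  set S : ℝ → ℝ := fun t => Real.sqrt (1 - ‖ξ t‖ ^ 2) with hS
  set r := max ‖ξ₀‖ ‖ξ₁‖ with hr
  have hr1 : r < 1 := max_lt h0 h1
  have hr0 : 0 ≤ r := (norm_nonneg _).trans (le_max_left _ _)
  have hξr : ∀ t ∈ Set.Icc (0 : ℝ) 1, ‖ξ t‖ ≤ r := by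
    rintro t ⟨ht0, ht1⟩
    have : ξ t = (1 - t) • ξ₀ + t • ξ₁ := by simp only [hξ, hD]; module
    rw [this]
    refine (norm_add_le _ _).trans ?_
    rw [norm_smul, norm_smul, Real.norm_of_nonneg ht0, Real.norm_of_nonneg (by linarith)]
    have := le_max_left ‖ξ₀‖ ‖ξ₁‖
    have := le_max_right ‖ξ₀‖ ‖ξ₁‖
    nlinarith
  have hξc : Continuous ξ := by fun_prop
  have hSc : Continuous S := by fun_prop
  have hξd : ∀ t, HasDerivAt ξ D t := fun t => by
    have := ((hasDerivAt_id t).smul_const D).const_add ξ₀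
    rw [one_smul] at this
    exact this
  have hpos1 : ∀ t ∈ Set.Icc (0 : ℝ) 1, 1 - r ^ 2 ≤ 1 - ‖ξ t‖ ^ 2 := fun t ht => by
    nlinarith [hξr t ht, norm_nonneg (ξ t)]
  have hrr : 0 < 1 - r ^ 2 := by nlinarith
  have hSpos : ∀ t ∈ Set.Icc (0 : ℝ) 1, 0 < S t := fun t ht =>
    Real.sqrt_pos.2 (hrr.trans_le (hpos1 t ht))
  have hS2 : ∀ t ∈ Set.Icc (0 : ℝ) 1, S t ^ 2 = 1 - ‖ξ t‖ ^ 2 := fun t ht =>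
    Real.sq_sqrt (hrr.le.trans (hpos1 t ht))
  have hsr : 0 < Real.sqrt (1 - r ^ 2) := Real.sqrt_pos.2 hrr
  have hSge : ∀ t ∈ Set.Icc (0 : ℝ) 1, Real.sqrt (1 - r ^ 2) ≤ S t := fun t ht =>
    Real.sqrt_le_sqrt (hpos1 t ht)
  have hSd : ∀ t ∈ Set.Icc (0 : ℝ) 1, HasDerivAt S (-(⟪ξ t, D⟫ / S t)) t := by
    intro t ht
    have h := ((hξd t).norm_sq.const_sub 1).sqrt (hrr.trans_le (hpos1 t ht)).ne'
    convert h using 1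
    have := (hSpos t ht).ne'
    change _ = _ / (2 * S t)
    field_simp
  have hId : ∀ t, HasDerivAt (fun t => ⟪ξ t, D⟫) (‖D‖ ^ 2) t := fun t => by
    have := (hξd t).inner ℝ (hasDerivAt_const t D)
    simpa using this
  set m := d * Real.sqrt (1 - r ^ 2) * (1 - r ^ 2) with hm
  have hmpos : 0 < m := by positivity
  have hhess : ∀ t ∈ Set.Icc (0 : ℝ) 1, ∀ p, gradient f p = ξ t → ∀ v,
      m * ‖v‖ ^ 2 ≤ hess f p v v := by
    intro t ht p hp v
    refine le_trans ?_ (hpc p v)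
    rw [hp]
    have hcs : ⟪ξ t, v⟫ ^ 2 ≤ r ^ 2 * ‖v‖ ^ 2 := by
      rw [← mul_pow, ← sq_abs]
      gcongr
      exact (abs_real_inner_le_norm _ _).trans (by gcongr; exact hξr t ht)
    have := hSge t ht
    rw [hm, mul_assoc]
    change _ ≤ d * S t * _
    gcongr
    linarith
  set C := ‖D‖ / m + 1 with hC
  have hC0 : 0 < C := by positivity
  let K : Set (ℝ × E2) := {x | gradient f x.2 = ξ x.1 ∧ ‖x.2 - p₀‖ ≤ C * x.1 ∧
    ⟪x.2, D⟫ * S x.1 ≤ (⟪q, D⟫ + ε * x.1) * S x.1 + (1 / d) * ⟪ξ x.1, D⟫ ∧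
    ⟪x.2, ξ x.1⟫ - f x.2 ≤ ⟪q, ξ x.1⟫ - t₀ - (1 / d) * S x.1 + 2 * ε * x.1}
  have hgc : Continuous (gradient f) := by
    have : Continuous (fderiv ℝ f) := hf.continuous_fderiv (by simp)
    exact (InnerProductSpace.toDual ℝ E2).symm.continuous.comp this
  have hKc : IsClosed K := by
    have hfc := hf.continuous
    simp only [K, Set.ofPred_and]
    refine IsClosed.inter ?_ (IsClosed.inter ?_ (IsClosed.inter ?_ ?_))
    · exact isClosed_eq (by fun_prop) (by fun_prop)
    · exact isClosed_le (by fun_prop) (by fun_prop)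
    · exact isClosed_le (by fun_prop) (by fun_prop)
    · exact isClosed_le (by fun_prop) (by fun_prop)
  have hcl : IsClosed ({t | ∃ p, (t, p) ∈ K} ∩ Set.Icc (0 : ℝ) 1) := by
    have hcomp : IsCompact (K ∩ (Set.Icc (0 : ℝ) 1 ×ˢ closedBall p₀ C)) :=
      (isCompact_Icc.prod (isCompact_closedBall p₀ C)).inter_left hKc
    have := (hcomp.image continuous_fst).isClosed
    convert this using 1
    ext t
    constructor
    · rintro ⟨⟨p, hp⟩, ht⟩
      refine ⟨(t, p), ⟨hp, ht, ?_⟩, rfl⟩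
      have h := hp.2.1
      simp only at h
      rw [mem_closedBall, dist_eq_norm]
      nlinarith [ht.2]
    · rintro ⟨⟨t', p⟩, ⟨hp, ht, -⟩, rfl⟩
      exact ⟨⟨p, hp⟩, ht⟩
  have hS0 : 0 < S 0 := hSpos 0 (by simp)
  have hξ0' : ξ 0 = ξ₀ := by simp [hξ]
  have hξ1' : ξ 1 = ξ₁ := by simp [hξ, hD]
  have hS0e : S 0 = Real.sqrt (1 - ‖ξ₀‖ ^ 2) := by simp only [hS, hξ0']
  rw [← hS0e] at hq ht₀
  have hmem : (1 : ℝ) ∈ {t | ∃ p, (t, p) ∈ K} := by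
    refine hcl.mem_of_ge_of_forall_exists_gt ?_ zero_le_one ?_
    · refine ⟨p₀, ?_, ?_, ?_, ?_⟩
      · simp only [hξ0', hξ₀]
      · simp
      · simp only [hξ0', hq, inner_sub_left, real_inner_smul_left]
        apply le_of_eq; field_simp; ring
      · have h := hS2 0 (by simp)
        rw [hξ0'] at h
        simp only [hξ0', hq, ht₀, inner_sub_left, real_inner_smul_left, real_inner_self_eq_norm_sq]
        have h' : ‖ξ₀‖ ^ 2 = 1 - S 0 ^ 2 := by linarith
        rw [h']
        apply le_of_eq; field_simp; ring
    · rintro t ⟨⟨p, hp1, hp2, hp3, hp4⟩, ht⟩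
      simp only at hp1 hp2 hp3 hp4
      have htI : t ∈ Set.Icc (0 : ℝ) 1 := ⟨ht.1, ht.2.le⟩
      have hh := hhess t htI p hp1
      obtain ⟨P, v, hPt, hPd, hPe, hvD⟩ := local_path f hf p D ξ t (hξd t) hp1 (fun v hv => by
        have := norm_pos_iff.2 hv
        exact lt_of_lt_of_le (by positivity) (hh v))
      have hst := hSpos t htI
      have hv : ‖v‖ < C := by
        have h1 := hh v
        rw [← hvD] at h1
        have h2 := h1.trans (real_inner_le_norm v D)
        rcases (norm_nonneg v).eq_or_lt with h | h
        · rw [← h]; exact hC0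
        · have : m * ‖v‖ ≤ ‖D‖ := by nlinarith
          rw [hC]
          have : ‖v‖ ≤ ‖D‖ / m := by rw [le_div_iff₀ hmpos]; linarith
          linarith
      have hkey : d * S t ^ 3 * ⟪v, D⟫ ≤ S t ^ 2 * ‖D‖ ^ 2 + ⟪ξ t, D⟫ ^ 2 := by
        refine cs_bound (ξ t) D v d (S t) hd hst (hS2 t htI) ?_
        have := hpc p v
        rw [hp1] at this
        rw [hvD]
        exact this
      -- the norm condition
      have e2 : ∀ᶠ s in 𝓝[>] t, ‖P s - p₀‖ ≤ C * s := by
        have := (hPd.sub_const p₀).hasDerivWithinAt (s := Set.Ioi t) |>.limsup_slope_norm_le hv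
        filter_upwards [this, self_mem_nhdsWithin] with s hs hts
        have hts' : 0 < s - t := sub_pos.2 hts
        rw [Real.norm_of_nonneg hts'.le, inv_mul_lt_iff₀ hts', hPt] at hs
        linarith
      have hPD : HasDerivAt (fun s => ⟪P s, D⟫) ⟪v, D⟫ t := by
        have := hPd.inner ℝ (hasDerivAt_const t D)
        simpa using this
      have e3 : ∀ᶠ s in 𝓝[>] t, ⟪P s, D⟫ ≤ (⟪q, D⟫ + ε * s) + (1 / d) * (⟪ξ s, D⟫ / S s) := by
        have hψ := (((hasDerivAt_id t).const_mul ε).const_add ⟪q, D⟫).add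
          (((hId t).div (hSd t htI) hst.ne').const_mul (1 / d))
        refine eventually_le_of_deriv_lt _ _ _ _ t hPD hψ ?_ ?_
        · have : ⟪v, D⟫ ≤ (S t ^ 2 * ‖D‖ ^ 2 + ⟪ξ t, D⟫ ^ 2) / (d * S t ^ 3) := by
            rw [le_div_iff₀ (by positivity)]; linarith
          refine lt_of_le_of_lt this ?_
          have e : (S t ^ 2 * ‖D‖ ^ 2 + ⟪ξ t, D⟫ ^ 2) / (d * S t ^ 3) =
            1 / d * ((‖D‖ ^ 2 * S t - ⟪ξ t, D⟫ * -(⟪ξ t, D⟫ / S t)) / S t ^ 2) := by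
            field_simp
            ring
          rw [e]
          linarith
        · simp only [hPt]
          have : (⟪q, D⟫ + ε * t) + 1 / d * (⟪ξ t, D⟫ / S t) =
            ((⟪q, D⟫ + ε * t) * S t + 1 / d * ⟪ξ t, D⟫) / S t := by field_simp
          rw [this, le_div_iff₀ hst]
          exact hp3
      have e4 : ∀ᶠ s in 𝓝[>] t, ⟪P s, ξ s⟫ - f (P s) ≤
          ⟪q, ξ s⟫ - t₀ - (1 / d) * S s + 2 * ε * s := by
        have hfP : HasDerivAt (fun s => f (P s)) ⟪gradient f p, v⟫ t := by
          have hg : HasFDerivAt f (InnerProductSpace.toDual ℝ E2 (gradient f p)) (P t) := by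
            rw [hPt]; exact (hdf p).hasGradientAt.hasFDerivAt
          exact hg.comp_hasDerivAt t hPd
        have hφ := (hPd.inner ℝ (hξd t)).sub hfP
        have hψ := ((((hasDerivAt_const t q).inner ℝ (hξd t)).sub_const t₀).sub
          ((hSd t htI).const_mul (1 / d))).add ((hasDerivAt_id t).const_mul (2 * ε))
        refine eventually_le_of_deriv_lt _ _ _ _ t hφ hψ ?_ ?_
        · rw [hPt, hp1, real_inner_comm v (ξ t)]
          simp only [inner_zero_left]
          have : ⟪p, D⟫ ≤ (⟪q, D⟫ + ε * t) + 1 / d * (⟪ξ t, D⟫ / S t) := by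
            have : (⟪q, D⟫ + ε * t) + 1 / d * (⟪ξ t, D⟫ / S t) =
              ((⟪q, D⟫ + ε * t) * S t + 1 / d * ⟪ξ t, D⟫) / S t := by field_simp
            rw [this, le_div_iff₀ hst]
            exact hp3
          have h6 : ε * t < ε * 2 := by
            apply mul_lt_mul_of_pos_left _ hε
            linarith [ht.2]
          linarith
        · simp only [Pi.add_apply, Pi.sub_apply, id, hPt]
          exact hp4
      have e5 : ∀ᶠ s in 𝓝[>] t, s ∈ Set.Ioc t 1 := Ioc_mem_nhdsGT ht.2
      obtain ⟨s, s1, s2, s3, s4, s5⟩ :=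
        ((hPe.filter_mono nhdsWithin_le_nhds).and (e2.and (e3.and (e4.and e5)))).exists
      refine ⟨s, ⟨P s, s1, s2, ?_, s4⟩, s5⟩
      have hss := hSpos s ⟨ht.1.trans s5.1.le, s5.2⟩
      have : (⟪q, D⟫ + ε * s) + 1 / d * (⟪ξ s, D⟫ / S s) =
        ((⟪q, D⟫ + ε * s) * S s + 1 / d * ⟪ξ s, D⟫) / S s := by field_simp
      rw [this, le_div_iff₀ hss] at s3
      exact s3
  obtain ⟨p, hp1, -, -, hp4⟩ := hmem
  simp only [hS, hξ1'] at hp1 hp4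
  exact ⟨p, hp1, by linarith⟩

/-- **Lemma 5.7.** A spacelike entire graph with principal curvatures bounded below by `d > 0`
is contained in the open future cone of the point `r_d(p₀) = (p₀, f(p₀)) − (1/d)·ν(p₀)`, where
`ν(p₀) = c·(∇f(p₀), 1)` is the future unit normal and `c = 1/√(1−‖∇f(p₀)‖²)`. -/
theorem graph_in_future_cone
    (f : E2 → ℝ) (hf : ContDiff ℝ (⊤ : ℕ∞) f) (hconv : ConvexOn ℝ Set.univ f)
    (hsp : ∀ p : E2, ‖gradient f p‖ < 1)
    (d : ℝ) (hd : 0 < d)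
    (hpc : ∀ p v : E2,
      hess f p v v ≥
        d * Real.sqrt (1 - ‖gradient f p‖ ^ 2) * (‖v‖ ^ 2 - ⟪gradient f p, v⟫ ^ 2))
    (p₀ : E2) (c : ℝ) (hc : c = 1 / Real.sqrt (1 - ‖gradient f p₀‖ ^ 2)) :
    ∀ y : E2, f y > f p₀ - c / d + ‖y - p₀ + (c / d) • gradient f p₀‖ := by
  intro y
  have hdf : Differentiable ℝ f := hf.differentiable (by simp)
  set q : E2 := p₀ - (c / d) • gradient f p₀ with hq
  set z : E2 := y - q with hz
  have hz' : y - p₀ + (c / d) • gradient f p₀ = z := by rw [hz, hq]; abel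
  rw [hz']
  set R := Real.sqrt (1 / d ^ 2 + ‖z‖ ^ 2) with hR
  have hR2 : R ^ 2 = 1 / d ^ 2 + ‖z‖ ^ 2 := Real.sq_sqrt (by positivity)
  have hRpos : 0 < R := Real.sqrt_pos.2 (by positivity)
  have hd2 : 0 < 1 / d ^ 2 := by positivity
  have hRz : ‖z‖ < R := by nlinarith [norm_nonneg z]
  have hn : ‖(1 / R) • z‖ = ‖z‖ / R := by
    rw [norm_smul, Real.norm_of_nonneg (by positivity)]; ring
  have hsq : Real.sqrt (1 - ‖(1 / R) • z‖ ^ 2) = 1 / (d * R) := by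
    rw [hn, Real.sqrt_eq_iff_mul_self_eq_of_pos (by positivity)]
    have : ‖z‖ ^ 2 = R ^ 2 - 1 / d ^ 2 := by linarith
    rw [div_pow, this]
    field_simp
    ring
  obtain ⟨p, hp, hle⟩ := exists_preimage f hf d hd hpc p₀ q ((1 / R) • z) (hsp p₀)
    (by rw [hn, div_lt_one hRpos]; exact hRz) (f p₀ - c / d) ((R - ‖z‖) / 4) (by linarith)
    (by rw [hq, hc]) (by rw [hc])
  have hfo := convex_first_order f hdf hconv p y
  rw [hp, inner_sub_right, real_inner_comm p] at hfo
  rw [hsq] at hle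
  have hyq : ⟪(1 / R) • z, y⟫ - ⟪q, (1 / R) • z⟫ = ‖z‖ ^ 2 / R := by
    rw [real_inner_comm _ q, ← inner_sub_right, ← hz, real_inner_smul_left,
      real_inner_self_eq_norm_sq]; ring
  have hfin : ‖z‖ ^ 2 / R + 1 / d * (1 / (d * R)) = R := by
    have : ‖z‖ ^ 2 = R ^ 2 - 1 / d ^ 2 := by linarith
    rw [this]; field_simp; ring
  linarith
end
end
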